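/- For T ≥ 2, the integral ∫₁ᵀ |ζ(1/2+it)|⁴ dt is O(T·(log T)⁴); i.e., there exists a constant C > 0 such that for all T ≥ 2, ∫₁ᵀ |ζ(1/2+it)|⁴ dt ≤ C·T·(log T)⁴. -/

import Mathlib

open MeasureTheory

namespace HardyLittlewood

open scoped FourierTransform SchwartzMap ContDiff in
/-- **Plancherel's theorem** for functions in `L¹ ∩ L²`. -/
theorem plancherel {g : ℝ → ℂ} (h1 : Integrable g) (h2 : MemLp g 2) :
    MemLp (𝓕 g) 2 ∧ ∫ x, ‖𝓕 g x‖ ^ 2 = ∫ x, ‖g x‖ ^ 2 := by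
  set f : Lp ℂ 2 (volume : Measure ℝ) := h2.toLp g with hf
  have hcont : Continuous (𝓕 g) :=
    VectorFourier.fourierIntegral_continuous Real.continuous_fourierChar
      (by exact continuous_inner) h1
  have key : (𝓕 f : Lp ℂ 2 (volume : Measure ℝ)) =ᵐ[volume] 𝓕 g := by
    have hl : LocallyIntegrable (fun x => (𝓕 f : Lp ℂ 2 (volume : Measure ℝ)) x - 𝓕 g x) volume :=
      ((Lp.memLp _).locallyIntegrable (by norm_num)).sub hcont.locallyIntegrable
    have := ae_eq_zero_of_integral_contDiff_smul_eq_zero hl ?_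
    · filter_upwards [this] with x hx
      exact sub_eq_zero.mp hx
    intro φ hφ hφc
    have hc1 : HasCompactSupport (Complex.ofRealCLM ∘ φ) := hφc.comp_left rfl
    have hc2 : ContDiff ℝ ∞ (Complex.ofRealCLM ∘ φ) := by fun_prop
    set ψ : 𝓢(ℝ, ℂ) := hc1.toSchwartzMap hc2 with hψ
    have hψx : ∀ x, ψ x = (φ x : ℂ) := fun x => rfl
    have e1 : ∫ x, ψ x • (𝓕 f : Lp ℂ 2 (volume : Measure ℝ)) x = ∫ x, (𝓕 ψ) x • g x := by
      have := congrArg (fun T => T ψ) (Lp.fourier_toTemperedDistribution_eq f)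
      simp only [TemperedDistribution.fourier_apply, Lp.toTemperedDistribution_apply] at this
      rw [← this]
      apply integral_congr_ae
      filter_upwards [h2.coeFn_toLp] with x hx
      rw [hf, hx]
    have e2 : ∫ x, (𝓕 ψ) x • g x = ∫ x, ψ x • 𝓕 g x := by
      have := VectorFourier.integral_fourierIntegral_smul_eq_flip (L := innerₗ ℝ)
        (μ := volume) (ν := volume) (f := ψ) (g := g) Real.continuous_fourierChar
        (by exact continuous_inner) ψ.integrable h1
      rw [flip_innerₗ] at this
      exact this
    have i1 : Integrable (fun x => ψ x • (𝓕 f : Lp ℂ 2 (volume : Measure ℝ)) x) := by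
      exact (ψ.memLp 2 volume).integrable_mul (Lp.memLp (𝓕 f))
    have i2 : Integrable (fun x => ψ x • 𝓕 g x) :=
      (ψ.continuous.smul hcont).integrable_of_hasCompactSupport hc1.smul_right
    simp only [smul_sub]
    calc _ = ∫ x, (ψ x • (𝓕 f : Lp ℂ 2 (volume : Measure ℝ)) x - ψ x • 𝓕 g x) := by
          simp only [hψx, Complex.real_smul, smul_eq_mul]
      _ = 0 := by rw [integral_sub i1 i2, e1, e2, sub_self]
  have hm : MemLp (𝓕 g) 2 := (Lp.memLp (𝓕 f)).ae_eq key
  refine ⟨hm, ?_⟩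
  have hn := Lp.norm_fourier_eq f
  have n1 : ∀ k : Lp ℂ 2 (volume : Measure ℝ), ‖k‖ ^ 2 = ∫ x, ‖k x‖ ^ 2 := by
    intro k
    have h := L2.inner_def (𝕜 := ℂ) k k
    simp only [inner_self_eq_norm_sq_to_K] at h
    norm_cast at h
  have := congrArg (· ^ 2) hn
  simp only [n1] at this
  rw [integral_congr_ae (g := fun x => ‖𝓕 g x‖ ^ 2)] at this
  · rw [this]
    apply integral_congr_ae
    filter_upwards [h2.coeFn_toLp] with x hx
    rw [hf, hx]
  · filter_upwards [key] with x hx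
    rw [hx]

theorem exp_div_four_le_norm_sin {z : ℂ} (hz : 1 ≤ z.im) : Real.exp z.im / 4 ≤ ‖Complex.sin z‖ := by
  rw [Complex.sin, norm_div, norm_mul, Complex.norm_I, Complex.norm_ofNat, mul_one]
  have h := norm_sub_norm_le (Complex.exp (-z * Complex.I)) (Complex.exp (z * Complex.I))
  rw [Complex.norm_exp, Complex.norm_exp] at h
  simp only [Complex.mul_re, Complex.neg_re, Complex.I_re, mul_zero, Complex.neg_im, Complex.I_im,
    mul_one, zero_sub, neg_neg] at h
  have h1 : Real.exp (-z.im) ≤ Real.exp z.im / 2 := by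
    have : 2 ≤ Real.exp (2 * z.im) := by
      have := Real.add_one_le_exp (2 * z.im)
      linarith
    have h2 : Real.exp z.im = Real.exp (-z.im) * Real.exp (2 * z.im) := by
      rw [← Real.exp_add]; ring_nf
    rw [h2]
    nlinarith [Real.exp_pos (-z.im)]
  linarith

theorem norm_sin_le_exp {z : ℂ} (hz : 0 ≤ z.im) : ‖Complex.sin z‖ ≤ Real.exp z.im := by
  rw [Complex.sin, norm_div, norm_mul, Complex.norm_I, Complex.norm_ofNat, mul_one]
  have h := norm_sub_le (Complex.exp (-z * Complex.I)) (Complex.exp (z * Complex.I))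
  rw [Complex.norm_exp, Complex.norm_exp] at h
  simp only [Complex.mul_re, Complex.neg_re, Complex.I_re, mul_zero, Complex.neg_im, Complex.I_im,
    mul_one, zero_sub, neg_neg] at h
  have h1 : Real.exp (-z.im) ≤ Real.exp z.im := Real.exp_le_exp.mpr (by linarith)
  linarith

theorem norm_Gamma_conj (s : ℂ) : ‖Complex.Gamma ((starRingEnd ℂ) s)‖ = ‖Complex.Gamma s‖ := by
  rw [Complex.Gamma_conj, RCLike.norm_conj]

theorem norm_Gamma_half_sq_le {y : ℝ} (hy : 1 / 2 ≤ y) :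
    ‖Complex.Gamma (1 / 2 + y * Complex.I)‖ ^ 2 ≤ 4 * Real.pi * Real.exp (-(Real.pi * y)) := by
  have h := Complex.Gamma_mul_Gamma_one_sub (1 / 2 + y * Complex.I)
  have hc : 1 - (1 / 2 + y * Complex.I) = (starRingEnd ℂ) (1 / 2 + y * Complex.I) := by
    apply Complex.ext <;> simp; norm_num
  rw [hc] at h
  have h2 := congrArg norm h
  rw [norm_mul, norm_Gamma_conj, norm_div, Complex.norm_real, Real.norm_of_nonneg Real.pi_pos.le,
    ← sq] at h2
  rw [h2]
  have him : ((Real.pi : ℂ) * (1 / 2 + y * Complex.I)).im = Real.pi * y := by simp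
  have h3 := exp_div_four_le_norm_sin (z := (Real.pi : ℂ) * (1 / 2 + y * Complex.I))
    (by rw [him]; nlinarith [Real.pi_gt_three])
  rw [him] at h3
  rw [Real.exp_neg, ← div_eq_mul_inv, div_le_div_iff₀ (by linarith [h3, Real.exp_pos (Real.pi * y)]) (Real.exp_pos _)]
  nlinarith [Real.pi_pos]

theorem norm_Gamma_one_sq_le {y : ℝ} (hy : 1 / 2 ≤ y) :
    ‖Complex.Gamma (1 + y * Complex.I)‖ ^ 2 ≤ 4 * Real.pi * y * Real.exp (-(Real.pi * y)) := by
  have h := Complex.Gamma_mul_Gamma_one_sub (y * Complex.I)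
  have hc : 1 - (y * Complex.I) = (starRingEnd ℂ) (1 + y * Complex.I) := by
    apply Complex.ext <;> simp
  have hne : (y * Complex.I : ℂ) ≠ 0 := by
    simp; linarith
  rw [hc] at h
  have h2 := congrArg (fun z => y * ‖z‖) h
  simp only [norm_mul, norm_Gamma_conj, norm_div, Complex.norm_real,
    Real.norm_of_nonneg Real.pi_pos.le] at h2
  have h4 : ‖Complex.Gamma (1 + y * Complex.I)‖ = y * ‖Complex.Gamma (y * Complex.I)‖ := by
    rw [add_comm, Complex.Gamma_add_one _ hne, norm_mul]
    simp [abs_of_nonneg (show 0 ≤ y by linarith)]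
  rw [← mul_assoc, ← h4, ← sq] at h2
  rw [h2]
  have him : ((Real.pi : ℂ) * (y * Complex.I)).im = Real.pi * y := by simp
  have h3 := exp_div_four_le_norm_sin (z := (Real.pi : ℂ) * (y * Complex.I))
    (by rw [him]; nlinarith [Real.pi_gt_three])
  rw [him] at h3
  have := Real.exp_pos (Real.pi * y)
  rw [Real.exp_neg, ← div_eq_mul_inv, ← mul_div_assoc, div_le_div_iff₀ (by linarith) (Real.exp_pos _)]
  have : 0 < y * Real.pi := by nlinarith [Real.pi_pos]
  nlinarith

theorem norm_Gamma_three_quarters_sq_le : ∃ C : ℝ, 0 < C ∧ ∀ y : ℝ,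
    ‖Complex.Gamma (3 / 4 + y * Complex.I)‖ ^ 2 ≤
      C * (‖Complex.Gamma (1 / 2 + y * Complex.I)‖ * ‖Complex.Gamma (1 + y * Complex.I)‖) := by
  have hsum : Summable (fun j : ℕ => 1 / ((j : ℝ) + 1) ^ 2) := by
    have := (summable_nat_add_iff 1).mpr (Real.summable_one_div_nat_pow.mpr (le_refl 2))
    simpa using this
  refine ⟨Real.exp (∑' j : ℕ, 1 / ((j : ℝ) + 1) ^ 2), Real.exp_pos _, fun y => ?_⟩
  have t1 := (Complex.GammaSeq_tendsto_Gamma (3 / 4 + y * Complex.I)).norm.pow 2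
  have t2 := ((Complex.GammaSeq_tendsto_Gamma (1 / 2 + y * Complex.I)).norm.mul
    (Complex.GammaSeq_tendsto_Gamma (1 + y * Complex.I)).norm).const_mul
      (Real.exp (∑' j : ℕ, 1 / ((j : ℝ) + 1) ^ 2))
  refine le_of_tendsto_of_tendsto t1 t2 ?_
  filter_upwards [Filter.eventually_gt_atTop 0] with n hn
  have hn' : (0 : ℝ) < n := by exact_mod_cast hn
  have hG : ∀ a : ℝ, 0 < a → ‖Complex.GammaSeq (a + y * Complex.I) n‖ =
      (n : ℝ) ^ a * n.factorial / ∏ j ∈ Finset.range (n + 1), ‖((a + j : ℝ) : ℂ) + y * Complex.I‖ := by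
    intro a ha
    rw [Complex.GammaSeq, norm_div, norm_mul, norm_prod, Complex.norm_natCast,
      ← Complex.ofReal_natCast n, Complex.norm_cpow_eq_rpow_re_of_pos hn']
    congr 1
    · simp
    · apply Finset.prod_congr rfl; intro j _; congr 1; push_cast; ring
  have e34 : ((3 / 4 : ℝ) : ℂ) = 3 / 4 := by push_cast; rfl
  have e12 : ((1 / 2 : ℝ) : ℂ) = 1 / 2 := by push_cast; rfl
  have h34 := hG (3 / 4) (by norm_num)
  have h12 := hG (1 / 2) (by norm_num)
  have h1 := hG 1 (by norm_num)
  rw [e34] at h34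
  rw [e12] at h12
  rw [Complex.ofReal_one] at h1
  have hpos : ∀ a : ℝ, 0 < a →
      0 < ∏ j ∈ Finset.range (n + 1), ‖((a + j : ℝ) : ℂ) + y * Complex.I‖ := by
    intro a ha
    apply Finset.prod_pos
    intro j _
    rw [norm_pos_iff]
    intro h
    have := congrArg Complex.re h
    simp at this
    have hj : (0 : ℝ) ≤ j := j.cast_nonneg
    linarith
  have hprod : (∏ j ∈ Finset.range (n + 1), ‖((1 / 2 + j : ℝ) : ℂ) + y * Complex.I‖) *
      (∏ j ∈ Finset.range (n + 1), ‖((1 + j : ℝ) : ℂ) + y * Complex.I‖) ≤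
      Real.exp (∑' j : ℕ, 1 / ((j : ℝ) + 1) ^ 2) *
        (∏ j ∈ Finset.range (n + 1), ‖((3 / 4 + j : ℝ) : ℂ) + y * Complex.I‖) ^ 2 := by
    have : Real.exp (∑ j ∈ Finset.range (n + 1), 1 / ((j : ℝ) + 1) ^ 2) ≤
        Real.exp (∑' j : ℕ, 1 / ((j : ℝ) + 1) ^ 2) :=
      Real.exp_le_exp.mpr (hsum.sum_le_tsum _ (fun _ _ => by positivity))
    refine le_trans ?_ (mul_le_mul_of_nonneg_right this (by positivity))
    rw [Real.exp_sum, ← Finset.prod_pow, ← Finset.prod_mul_distrib, ← Finset.prod_mul_distrib]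
    apply Finset.prod_le_prod
    · intros; positivity
    intro j _
    have hj : (0 : ℝ) ≤ j := j.cast_nonneg
    have nsq : ∀ a : ℝ, ‖((a + j : ℝ) : ℂ) + y * Complex.I‖ ^ 2 = (a + j) ^ 2 + y ^ 2 := by
      intro a
      rw [Complex.sq_norm, Complex.normSq_add_mul_I]
    have hexp : 1 + 1 / ((j : ℝ) + 1) ^ 2 ≤ Real.exp (1 / ((j : ℝ) + 1) ^ 2) := by
      rw [add_comm]; exact Real.add_one_le_exp _
    refine le_trans ?_ (mul_le_mul_of_nonneg_right hexp (by positivity))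
    rw [nsq (3 / 4)]
    have hx : (3 / 4 + (j : ℝ)) ^ 2 + y ^ 2 + 1 / 16 ≤
        (1 + 1 / ((j : ℝ) + 1) ^ 2) * ((3 / 4 + (j : ℝ)) ^ 2 + y ^ 2) := by
      have : 1 / 16 ≤ 1 / ((j : ℝ) + 1) ^ 2 * ((3 / 4 + (j : ℝ)) ^ 2 + y ^ 2) := by
        rw [div_mul_eq_mul_div, div_le_div_iff₀ (by norm_num) (by positivity)]
        nlinarith [sq_nonneg y]
      linarith
    refine le_trans ?_ hx
    apply abs_le_of_sq_le_sq' _ (by positivity) |>.2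
    rw [mul_pow, nsq, nsq]
    nlinarith [sq_nonneg y, sq_nonneg ((j : ℝ) + 3 / 4)]
  rw [h34, h12, h1, div_pow, div_mul_div_comm, ← mul_div_assoc,
    div_le_div_iff₀ (pow_pos (hpos _ (by norm_num)) 2)
      (mul_pos (hpos _ (by norm_num)) (hpos _ (by norm_num)))]
  have e : ((n : ℝ) ^ (3 / 4 : ℝ) * n.factorial) ^ 2 =
      (n : ℝ) ^ (1 / 2 : ℝ) * n.factorial * ((n : ℝ) ^ (1 : ℝ) * n.factorial) := by
    have : ((n : ℝ) ^ (3 / 4 : ℝ)) ^ 2 = (n : ℝ) ^ (1 / 2 : ℝ) * (n : ℝ) ^ (1 : ℝ) := by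
      rw [← Real.rpow_natCast, ← Real.rpow_mul hn'.le, ← Real.rpow_add hn']
      norm_num
    rw [mul_pow, this]; ring
  rw [e]
  calc _ ≤ _ := mul_le_mul_of_nonneg_left hprod (by positivity)
    _ = _ := by ring

theorem norm_Gamma_quarter_ge : ∃ c : ℝ, 0 < c ∧ ∀ t : ℝ, 1 ≤ t →
    c ≤ t * Real.exp (Real.pi * t) * ‖Complex.Gamma (1 / 4 + (t / 2 : ℝ) * Complex.I)‖ ^ 4 := by
  obtain ⟨C, hC, h34⟩ := norm_Gamma_three_quarters_sq_le
  refine ⟨Real.pi ^ 2 / (8 * C ^ 2), by positivity, fun t ht => ?_⟩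
  set y := t / 2 with hy
  have hy2 : 1 / 2 ≤ y := by linarith
  have hty : t = 2 * y := by rw [hy]; ring
  have hpi := Real.pi_pos
  have a := norm_Gamma_half_sq_le hy2
  have b := norm_Gamma_one_sq_le hy2
  have c := h34 y
  have h := Complex.Gamma_mul_Gamma_one_sub (1 / 4 + y * Complex.I)
  have hc : 1 - (1 / 4 + y * Complex.I) = (starRingEnd ℂ) (3 / 4 + y * Complex.I) := by
    simp only [map_add, map_mul, map_div₀, Complex.conj_I, Complex.conj_ofReal, map_ofNat]
    ring
  rw [hc] at h
  have h2 := congrArg norm h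
  have him : ((Real.pi : ℂ) * (1 / 4 + y * Complex.I)).im = Real.pi * y := by simp
  have h3 := norm_sin_le_exp (z := (Real.pi : ℂ) * (1 / 4 + y * Complex.I))
    (by rw [him]; positivity)
  have h3' := exp_div_four_le_norm_sin (z := (Real.pi : ℂ) * (1 / 4 + y * Complex.I))
    (by rw [him]; nlinarith [Real.pi_gt_three])
  rw [him] at h3 h3'
  rw [norm_mul, norm_Gamma_conj, norm_div, Complex.norm_real, Real.norm_of_nonneg hpi.le] at h2
  set E := Real.exp (Real.pi * y) with hE
  have hEpos : 0 < E := Real.exp_pos _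
  rw [Real.exp_neg, ← hE] at a b
  set S := ‖Complex.sin (Real.pi * (1 / 4 + y * Complex.I))‖
  set g1 := ‖Complex.Gamma (1 / 4 + y * Complex.I)‖
  set g3 := ‖Complex.Gamma (3 / 4 + y * Complex.I)‖
  set g2 := ‖Complex.Gamma (1 / 2 + y * Complex.I)‖
  set g4 := ‖Complex.Gamma (1 + y * Complex.I)‖
  have hlow : Real.pi / E ≤ g1 * g3 := by
    rw [h2]; exact div_le_div_of_nonneg_left hpi.le (by linarith) h3
  have h5 : g3 ^ 4 ≤ C ^ 2 * (4 * Real.pi * E⁻¹ * (4 * Real.pi * y * E⁻¹)) := by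
    calc g3 ^ 4 = (g3 ^ 2) ^ 2 := by ring
      _ ≤ (C * (g2 * g4)) ^ 2 := pow_le_pow_left₀ (by positivity) c 2
      _ = C ^ 2 * (g2 ^ 2 * g4 ^ 2) := by ring
      _ ≤ _ := by gcongr
  have h6 : (Real.pi / E) ^ 4 ≤ g1 ^ 4 * g3 ^ 4 := by
    rw [← mul_pow]; exact pow_le_pow_left₀ (by positivity) hlow 4
  have h7 : (Real.pi / E) ^ 4 ≤ g1 ^ 4 * (C ^ 2 * (4 * Real.pi * E⁻¹ * (4 * Real.pi * y * E⁻¹))) :=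
    h6.trans (mul_le_mul_of_nonneg_left h5 (by positivity))
  have hEt : Real.exp (Real.pi * t) = E ^ 2 := by
    rw [hE, ← Real.exp_nat_mul, hty]; congr 1; push_cast; ring
  rw [hEt, hty]
  have h8 : (Real.pi / E) ^ 4 * E ^ 4 = Real.pi ^ 4 := by field_simp
  have h9 := mul_le_mul_of_nonneg_right h7 (pow_pos hEpos 4).le
  rw [h8] at h9
  have h10 : g1 ^ 4 * (C ^ 2 * (4 * Real.pi * E⁻¹ * (4 * Real.pi * y * E⁻¹))) * E ^ 4 =
      (8 * C ^ 2 * Real.pi ^ 2) * (2 * y * E ^ 2 * g1 ^ 4) := by field_simp; ring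
  rw [h10] at h9
  rw [div_le_iff₀ (by positivity)]
  have : 0 < Real.pi ^ 2 := by positivity
  nlinarith

open ArithmeticFunction ArithmeticFunction.sigma ArithmeticFunction.zeta in
theorem card_divisors_sq_le (n : ℕ) :
    n.divisors.card ^ 2 ≤ (σ 0 * σ 0 : ArithmeticFunction ℕ) n := by
  have h1 : (σ 0 * σ 0 : ArithmeticFunction ℕ) n =
      (n.divisors.sigma fun a => a.divisors ×ˢ (n / a).divisors).card := by
    rw [ArithmeticFunction.mul_apply, Finset.card_sigma,
      Nat.sum_divisorsAntidiagonal fun x y => σ 0 x * σ 0 y]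
    simp [sigma_zero_apply]
  rw [h1, sq, ← Finset.card_product]
  refine Finset.card_le_card_of_injOn
    (fun p => ⟨p.1, Nat.gcd p.1 p.2, p.2 / Nat.gcd p.1 p.2⟩) ?_ ?_
  · rintro ⟨a, b⟩ hab
    simp only [Finset.coe_product, Set.mem_prod, Finset.mem_coe, Nat.mem_divisors] at hab
    obtain ⟨⟨ha, hn⟩, hb, -⟩ := hab
    have ha0 : 0 < a := Nat.pos_of_dvd_of_pos ha (Nat.pos_of_ne_zero hn)
    have hna : n / a ≠ 0 := (Nat.div_pos (Nat.le_of_dvd (Nat.pos_of_ne_zero hn) ha) ha0).ne'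
    simp only [Finset.coe_sigma, Set.mem_sigma_iff, Finset.mem_coe, Nat.mem_divisors,
      Finset.mem_product]
    refine ⟨⟨ha, hn⟩, ⟨Nat.gcd_dvd_left _ _, ha0.ne'⟩, ?_, hna⟩
    rw [Nat.dvd_div_iff_mul_dvd ha, ← Nat.mul_div_assoc _ (Nat.gcd_dvd_right _ _)]
    exact Nat.lcm_dvd ha hb
  · rintro ⟨a, b⟩ hab ⟨a', b'⟩ hab' h
    simp only [Sigma.mk.injEq, heq_eq_eq, Prod.mk.injEq] at h
    obtain ⟨h1, h2, h3⟩ := h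
    have e1 := Nat.div_mul_cancel (Nat.gcd_dvd_right a b)
    have e2 := Nat.div_mul_cancel (Nat.gcd_dvd_right a' b')
    rw [h3, h2, e2] at e1
    rw [h1, e1]

theorem tsum_one_div_rpow_le {η : ℝ} (hη : 0 < η) :
    ∑' n : ℕ, 1 / (n + 1 : ℝ) ^ (1 + η) ≤ 1 + 1 / η := by
  have h := ZetaAsymptotics.zeta_limit_aux1 (s := 1 + η) (by linarith)
  have h2 : 0 ≤ ZetaAsymptotics.termTSum (1 + η) :=
    tsum_nonneg fun n => ZetaAsymptotics.term_nonneg _ _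
  have h3 : 0 ≤ (1 + η) * ZetaAsymptotics.termTSum (1 + η) := by positivity
  rw [show 1 + η - 1 = η by ring] at h
  linarith

theorem norm_riemannZeta_le {η : ℝ} (hη : 0 < η) :
    ‖riemannZeta ((1 + η : ℝ) : ℂ)‖ ≤ 1 + 1 / η := by
  rw [zeta_eq_tsum_one_div_nat_add_one_cpow (by simpa using hη)]
  have h : ∀ n : ℕ, (1 : ℂ) / (n + 1 : ℂ) ^ ((1 + η : ℝ) : ℂ)
      = ((1 / (n + 1 : ℝ) ^ (1 + η) : ℝ) : ℂ) := by
    intro n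
    rw [Complex.ofReal_div, Complex.ofReal_cpow (by positivity)]
    push_cast
    rfl
  simp_rw [h]
  rw [← Complex.ofReal_tsum, Complex.norm_real, Real.norm_of_nonneg
    (tsum_nonneg fun n => by positivity)]
  exact tsum_one_div_rpow_le hη

open ArithmeticFunction ArithmeticFunction.sigma ArithmeticFunction.zeta in
theorem summable_card_divisors_sq {η : ℝ} (hη : 0 < η) :
    Summable (fun n : ℕ => (n.divisors.card : ℝ) ^ 2 * (n : ℝ) ^ (-(1 + η))) ∧
      ∑' n : ℕ, (n.divisors.card : ℝ) ^ 2 * (n : ℝ) ^ (-(1 + η)) ≤ (1 + 1 / η) ^ 4 := by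
  set s : ℂ := ((1 + η : ℝ) : ℂ) with hs
  have hs1 : 1 < s.re := by simpa [hs] using hη
  have hz := LSeriesHasSum_zeta hs1
  have hσ := LSeriesHasSum_mul (f := (ζ : ArithmeticFunction ℂ)) (g := (ζ : ArithmeticFunction ℂ))
    (by simpa using hz) (by simpa using hz)
  have hD := LSeriesHasSum_mul hσ hσ
  have hD2 : HasSum (fun n : ℕ => (((σ 0 * σ 0 : ArithmeticFunction ℕ) n : ℝ) *
      (n : ℝ) ^ (-(1 + η)) : ℝ)) (‖riemannZeta s‖ ^ 4) := by
    have e : ∀ n : ℕ, LSeries.term (fun n => ((ζ : ArithmeticFunction ℂ) *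
        (ζ : ArithmeticFunction ℂ) * ((ζ : ArithmeticFunction ℂ) *
        (ζ : ArithmeticFunction ℂ))) n) s n = ((((σ 0 * σ 0 : ArithmeticFunction ℕ) n : ℝ) *
      (n : ℝ) ^ (-(1 + η)) : ℝ) : ℂ) := by
      intro n
      rcases eq_or_ne n 0 with rfl | hn
      · simp
      rw [LSeries.term_of_ne_zero hn]
      have : (σ 0 : ArithmeticFunction ℕ) = ζ * ζ := by
        rw [← zeta_mul_pow_eq_sigma, pow_zero_eq_zeta]
      rw [this, ← natCoe_mul, ← natCoe_mul, natCoe_apply, Real.rpow_neg (by positivity)]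
      push_cast
      rw [Complex.ofReal_cpow (by positivity), div_eq_mul_inv]
      simp [hs]
    have h1 : HasSum (fun n : ℕ => ((((σ 0 * σ 0 : ArithmeticFunction ℕ) n : ℝ) *
      (n : ℝ) ^ (-(1 + η)) : ℝ) : ℂ))
      (riemannZeta s * riemannZeta s * (riemannZeta s * riemannZeta s)) := by
      simp_rw [← e]
      exact hD
    have h2 := Complex.hasSum_re h1
    simp only [Complex.ofReal_re] at h2
    have h3 : Summable (fun n : ℕ => (((σ 0 * σ 0 : ArithmeticFunction ℕ) n : ℝ) *
      (n : ℝ) ^ (-(1 + η)) : ℝ)) := h2.summable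
    have h4 := h1.unique (Complex.hasSum_ofReal.mpr h3.hasSum)
    have h5 := congrArg norm h4
    rw [Complex.norm_real, Real.norm_of_nonneg (tsum_nonneg fun n => by positivity)] at h5
    rw [show ‖riemannZeta s‖ ^ 4 = ‖riemannZeta s * riemannZeta s *
      (riemannZeta s * riemannZeta s)‖ by simp only [norm_mul]; ring, h5]
    exact h3.hasSum
  have hle : ∀ n : ℕ, (n.divisors.card : ℝ) ^ 2 * (n : ℝ) ^ (-(1 + η)) ≤
      ((σ 0 * σ 0 : ArithmeticFunction ℕ) n : ℝ) * (n : ℝ) ^ (-(1 + η)) := fun n => by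
    gcongr
    exact_mod_cast card_divisors_sq_le n
  have hsum := Summable.of_nonneg_of_le (fun n => by positivity) hle hD2.summable
  refine ⟨hsum, (hsum.tsum_le_tsum hle hD2.summable).trans ?_⟩
  rw [hD2.tsum_eq]
  gcongr
  exact norm_riemannZeta_le hη

theorem sum_mul_exp_neg_le {x η : ℝ} (hx : 0 < x) (h0 : 0 ≤ η) (h2 : η ≤ 2) (J : ℕ) :
    ∑ j ∈ Finset.range J, ((j : ℝ) + 1) * Real.exp (-(x * (j + 1))) ≤ 256 * x ^ (-(2 + η)) := by
  set r := Real.exp (-x) with hr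
  have hr0 : 0 < r := Real.exp_pos _
  have hr1 : r < 1 := Real.exp_lt_one_iff.mpr (by linarith)
  have hs : HasSum (fun n : ℕ => (n : ℝ) * r ^ n) (r / (1 - r) ^ 2) :=
    hasSum_coe_mul_geometric_of_norm_lt_one (by rwa [Real.norm_of_nonneg hr0.le])
  have h1 : ∑ j ∈ Finset.range J, ((j : ℝ) + 1) * Real.exp (-(x * (j + 1))) ≤
      r / (1 - r) ^ 2 := by
    have e : ∀ j : ℕ, ((j : ℝ) + 1) * Real.exp (-(x * (j + 1))) =
        ((j + 1 : ℕ) : ℝ) * r ^ (j + 1) := by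
      intro j
      rw [hr, ← Real.exp_nat_mul]
      push_cast
      congr 2
      ring
    simp_rw [e]
    have := hs.summable.sum_le_tsum (Finset.range (J + 1)) (fun n _ => by positivity)
    rw [hs.tsum_eq, Finset.sum_range_succ'] at this
    simpa using this
  refine h1.trans ?_
  have hxp : (0 : ℝ) < 1 + x := by linarith
  have a1 : x * r ≤ (1 - r) := by
    have := Real.add_one_le_exp x
    have h : r * Real.exp x = 1 := by rw [hr, ← Real.exp_add]; simp
    nlinarith
  have a2 : x ≤ (1 - r) * (1 + x) := by nlinarith
  set q := Real.exp (-x / 4) with hq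
  have hq0 : 0 < q := Real.exp_pos _
  have hqr : r = q ^ 4 := by rw [hr, hq, ← Real.exp_nat_mul]; congr 1; push_cast; ring
  have a3 : (1 + x) * q ≤ 4 := by
    have := Real.add_one_le_exp (x / 4)
    have h : q * Real.exp (x / 4) = 1 := by rw [hq, ← Real.exp_add]; simp [neg_div]
    nlinarith
  have a4 : x * (1 + x) * q ^ 2 ≤ 16 * (1 - r) := by
    have h5 : ((1 + x) * q) ^ 2 ≤ 4 ^ 2 := by gcongr
    have h6 : x * (1 + x) * q ^ 2 ≤ (1 - r) * (1 + x) * (1 + x) * q ^ 2 := by gcongr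
    nlinarith
  have a5 : x ^ 2 * (1 + x) ^ 2 * r ≤ 256 * (1 - r) ^ 2 := by
    have : (x * (1 + x) * q ^ 2) ^ 2 ≤ (16 * (1 - r)) ^ 2 := by gcongr
    rw [hqr] at *
    nlinarith
  have a6 : x ^ η ≤ (1 + x) ^ 2 := by
    calc x ^ η ≤ (1 + x) ^ η := by gcongr; linarith
      _ ≤ (1 + x) ^ (2 : ℝ) := by gcongr; linarith
      _ = _ := by norm_cast
  have a7 : x ^ (2 + η) = x ^ 2 * x ^ η := by
    rw [Real.rpow_add hx]; norm_cast
  have hxe : 0 < x ^ η := by positivity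
  rw [Real.rpow_neg hx.le, a7, ← div_eq_mul_inv, div_le_div_iff₀ (by nlinarith) (by positivity)]
  have a8 : x ^ 2 * x ^ η * r ≤ x ^ 2 * (1 + x) ^ 2 * r := by gcongr
  linarith

theorem exists_divisor_sum_bound : ∃ C : ℝ, 0 < C ∧ ∀ ε : ℝ, 0 < ε → ε ≤ 1 / 2 →
    (∀ j : ℕ, Summable fun n : ℕ => (n.divisors.card : ℝ) ^ 2 *
      (n * (j + 1) * Real.exp (-(n * ε * (j + 1))))) ∧
    ∀ J : ℕ, ∑ j ∈ Finset.range J, ∑' n : ℕ, (n.divisors.card : ℝ) ^ 2 *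
      (n * (j + 1) * Real.exp (-(n * ε * (j + 1)))) ≤
        C * (ε ^ 2)⁻¹ * Real.log (1 / ε) ^ 4 := by
  have hl2 : 0 < Real.log 2 := Real.log_pos (by norm_num)
  refine ⟨256 * Real.exp 1 * (1 / Real.log 2 + 1) ^ 4, by positivity, fun ε h0 h1 => ?_⟩
  set L := Real.log (1 / ε) with hL
  have hL2 : Real.log 2 ≤ L := by
    rw [hL]
    apply Real.log_le_log (by norm_num)
    rw [le_div_iff₀ h0]
    linarith
  have hLp : 0 < L := by linarith
  have hη : 0 < 1 / L := by positivity
  have hη2 : 1 / L ≤ 2 := by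
    rw [div_le_iff₀ hLp]
    have := Real.log_two_gt_d9
    linarith
  obtain ⟨s1, s2⟩ := summable_card_divisors_sq hη
  have hε : ε ^ (-(1 / L)) = Real.exp 1 := by
    rw [Real.rpow_def_of_pos h0]
    congr 1
    have : Real.log ε = -L := by rw [hL, one_div, Real.log_inv, neg_neg]
    rw [this]
    field_simp
  have hmaj : ∀ (J n : ℕ), ∑ j ∈ Finset.range J, (n.divisors.card : ℝ) ^ 2 *
      (n * (j + 1) * Real.exp (-(n * ε * (j + 1)))) ≤ 256 * Real.exp 1 * (ε ^ 2)⁻¹ *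
        ((n.divisors.card : ℝ) ^ 2 * (n : ℝ) ^ (-(1 + 1 / L))) := by
    intro J n
    rcases Nat.eq_zero_or_pos n with rfl | hn
    · simp
    have hn' : (0 : ℝ) < n := by exact_mod_cast hn
    have := sum_mul_exp_neg_le (mul_pos hn' h0) hη.le hη2 J
    have e1 : ((n : ℝ) * ε) ^ (-(2 + 1 / L)) = (n : ℝ)⁻¹ * (n : ℝ) ^ (-(1 + 1 / L)) *
        ((ε ^ 2)⁻¹ * Real.exp 1) := by
      rw [Real.mul_rpow hn'.le h0.le, ← hε]
      congr 1
      · rw [← Real.rpow_neg_one, ← Real.rpow_add hn']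
        congr 1
        ring
      · rw [← Real.rpow_natCast, ← Real.rpow_neg h0.le, ← Real.rpow_add h0]
        congr 1
        push_cast
        ring
    rw [e1] at this
    calc _ = (n.divisors.card : ℝ) ^ 2 * (n * ∑ j ∈ Finset.range J,
          ((j : ℝ) + 1) * Real.exp (-(n * ε * (j + 1)))) := by
          rw [Finset.mul_sum, Finset.mul_sum]
          refine Finset.sum_congr rfl fun j _ => by ring
      _ ≤ (n.divisors.card : ℝ) ^ 2 * (n * (256 * ((n : ℝ)⁻¹ * (n : ℝ) ^ (-(1 + 1 / L)) *
        ((ε ^ 2)⁻¹ * Real.exp 1)))) := by gcongr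
      _ = _ := by field_simp
  have hsum : ∀ j : ℕ, Summable fun n : ℕ => (n.divisors.card : ℝ) ^ 2 *
      (n * (j + 1) * Real.exp (-(n * ε * (j + 1)))) := by
    intro j
    refine Summable.of_nonneg_of_le (fun n => by positivity) (fun n => ?_)
      (s1.mul_left (256 * Real.exp 1 * (ε ^ 2)⁻¹))
    refine le_trans ?_ (hmaj (j + 1) n)
    exact Finset.single_le_sum (f := fun j : ℕ => (n.divisors.card : ℝ) ^ 2 *
      (n * (j + 1) * Real.exp (-(n * ε * (j + 1))))) (fun i _ => by positivity) (by simp)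
  refine ⟨hsum, fun J => ?_⟩
  rw [← Summable.tsum_finsetSum (fun j _ => hsum j)]
  calc _ ≤ ∑' n : ℕ, 256 * Real.exp 1 * (ε ^ 2)⁻¹ *
        ((n.divisors.card : ℝ) ^ 2 * (n : ℝ) ^ (-(1 + 1 / L))) :=
        Summable.tsum_le_tsum (hmaj J) (summable_sum fun j _ => hsum j) (s1.mul_left _)
    _ ≤ 256 * Real.exp 1 * (ε ^ 2)⁻¹ * (1 + 1 / (1 / L)) ^ 4 := by
        rw [tsum_mul_left]
        gcongr
    _ ≤ 256 * Real.exp 1 * (ε ^ 2)⁻¹ * ((1 / Real.log 2 + 1) * L) ^ 4 := by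
        gcongr
        rw [one_div_one_div, add_mul, one_mul]
        gcongr
        rw [div_mul_eq_mul_div, one_mul, le_div_iff₀ hl2]
        linarith
    _ = _ := by ring

theorem sq_integral_le {g : ℝ → ℝ} {a b : ℝ} (hab : a < b) (hg : ContinuousOn g (Set.Icc a b)) :
    (∫ x in a..b, g x) ^ 2 ≤ (b - a) * ∫ x in a..b, g x ^ 2 := by
  have hP : 0 < b - a := by linarith
  set m := (∫ x in a..b, g x) / (b - a) with hm
  have hg' : ContinuousOn g (Set.uIcc a b) := by rwa [Set.uIcc_of_le hab.le]
  have i1 : IntervalIntegrable g volume a b := hg'.intervalIntegrable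
  have i2 : IntervalIntegrable (fun x => g x ^ 2) volume a b := (hg'.pow 2).intervalIntegrable
  have h : 0 ≤ ∫ x in a..b, (g x - m) ^ 2 :=
    intervalIntegral.integral_nonneg hab.le fun x _ => sq_nonneg _
  have e : ∫ x in a..b, (g x - m) ^ 2 =
      (∫ x in a..b, g x ^ 2) - 2 * m * (∫ x in a..b, g x) + (b - a) * m ^ 2 := by
    rw [← intervalIntegral.integral_const_mul, ← intervalIntegral.integral_sub i2 (i1.const_mul _),
      ← smul_eq_mul (b - a), ← intervalIntegral.integral_const,
      ← intervalIntegral.integral_add (i2.sub (i1.const_mul _)) (by simp)]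
    congr 1
    ext x
    ring
  rw [e] at h
  have hI : (∫ x in a..b, g x) = m * (b - a) := by rw [hm]; field_simp
  rw [hI] at h ⊢
  nlinarith

theorem integral_exp_int_mul {P : ℝ} (hP : 0 < P) (X : ℝ) {k : ℤ} (hk : k ≠ 0) :
    ∫ x in X..X + P, Complex.exp (2 * Real.pi * Complex.I * k / P * x) = 0 := by
  have hP' : (P : ℂ) ≠ 0 := by exact_mod_cast hP.ne'
  have hk' : (k : ℂ) ≠ 0 := by exact_mod_cast hk
  rw [integral_exp_mul_complex (by simp [hP', hk', Real.pi_ne_zero])]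
  have : 2 * Real.pi * Complex.I * k / P * ((X + P : ℝ) : ℂ) =
      2 * Real.pi * Complex.I * k / P * X + k * (2 * Real.pi * Complex.I) := by
    push_cast
    field_simp
  rw [this, Complex.exp_add, Complex.exp_int_mul_two_pi_mul_I]
  simp

theorem integral_norm_sq_sum_exp {P : ℝ} (hP : 0 < P) (X : ℝ) (s : Finset ℕ) (c : ℕ → ℂ) :
    ∫ x in X..X + P, ‖∑ n ∈ s, c n * Complex.exp (-(2 * Real.pi * Complex.I * n / P * x))‖ ^ 2 =
      P * ∑ n ∈ s, ‖c n‖ ^ 2 := by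
  have hconj : ∀ (m : ℕ) (x : ℝ), (starRingEnd ℂ)
      (Complex.exp (-(2 * Real.pi * Complex.I * m / P * x))) =
      Complex.exp (2 * Real.pi * Complex.I * m / P * x) := by
    intro m x
    rw [← Complex.exp_conj]
    congr 1
    simp only [map_neg, map_mul, map_div₀, map_ofNat, map_natCast, Complex.conj_ofReal,
      Complex.conj_I]
    ring
  have h : ∀ x : ℝ, ((‖∑ n ∈ s, c n *
      Complex.exp (-(2 * Real.pi * Complex.I * n / P * x))‖ ^ 2 : ℝ) : ℂ) =
      ∑ n ∈ s, ∑ m ∈ s, c n * (starRingEnd ℂ) (c m) *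
        Complex.exp (2 * Real.pi * Complex.I * ((m - n : ℤ) : ℂ) / P * x) := by
    intro x
    rw [Complex.ofReal_pow, ← Complex.mul_conj', map_sum, Finset.sum_mul_sum]
    refine Finset.sum_congr rfl fun n _ => Finset.sum_congr rfl fun m _ => ?_
    rw [map_mul, hconj]
    have : (2 * Real.pi * Complex.I * ((m - n : ℤ) : ℂ) / P * x : ℂ) =
      -(2 * Real.pi * Complex.I * n / P * x) + 2 * Real.pi * Complex.I * m / P * x := by
      push_cast
      ring
    rw [this, Complex.exp_add]
    ring
  have hc : ((∫ x in X..X + P, ‖∑ n ∈ s, c n *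
      Complex.exp (-(2 * Real.pi * Complex.I * n / P * x))‖ ^ 2 : ℝ) : ℂ) =
      ((P * ∑ n ∈ s, ‖c n‖ ^ 2 : ℝ) : ℂ) := by
    rw [← intervalIntegral.integral_ofReal]
    simp_rw [h]
    rw [intervalIntegral.integral_finsetSum
      (fun n _ => (by fun_prop : Continuous _).intervalIntegrable _ _)]
    push_cast
    rw [Finset.mul_sum]
    refine Finset.sum_congr rfl fun n hn => ?_
    rw [intervalIntegral.integral_finsetSum
      (fun n _ => (by fun_prop : Continuous _).intervalIntegrable _ _),
      Finset.sum_eq_single n]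
    · rw [intervalIntegral.integral_const_mul]
      simp [Complex.mul_conj', mul_comm]
    · intro m _ hm
      have hz := integral_exp_int_mul hP X (k := (m : ℤ) - n) (by omega)
      push_cast at hz
      rw [intervalIntegral.integral_const_mul, hz, mul_zero]
    · intro h'
      exact absurd hn h'
  exact_mod_cast hc

theorem integral_norm_sq_sum_le {P : ℝ} (hP : 0 < P) (X : ℝ) (s : Finset ℕ)
    (A A' : ℕ → ℝ → ℂ) (B : ℕ → ℝ)
    (hA : ∀ n ∈ s, ∀ x ∈ Set.Icc X (X + P), HasDerivAt (A n) (A' n x) x)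
    (hA' : ∀ n ∈ s, ContinuousOn (A' n) (Set.Icc X (X + P)))
    (hB : ∀ n ∈ s, ∀ x ∈ Set.Icc X (X + P), ‖A n x‖ ≤ B n)
    (hB' : ∀ n ∈ s, ∀ x ∈ Set.Icc X (X + P), ‖A' n x‖ ≤ B n) :
    ∫ x in X..X + P, ‖∑ n ∈ s, A n x * Complex.exp (-(2 * Real.pi * Complex.I * n / P * x))‖ ^ 2
      ≤ (2 * P + 2 * P ^ 3) * ∑ n ∈ s, B n ^ 2 := by
  set e : ℕ → ℝ → ℂ := fun n x => Complex.exp (-(2 * Real.pi * Complex.I * n / P * x)) with he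
  have hec : ∀ n, Continuous (e n) := fun n => by simp only [he]; fun_prop
  have hXP : X < X + P := by linarith
  have hu : Set.uIcc X (X + P) = Set.Icc X (X + P) := Set.uIcc_of_le hXP.le
  have hX : X ∈ Set.Icc X (X + P) := ⟨le_rfl, hXP.le⟩
  have hS0c : Continuous (fun x => ∑ n ∈ s, A n X * e n x) := by
    fun_prop
  have hDc : ContinuousOn (fun p : ℝ × ℝ => ‖∑ n ∈ s, A' n p.1 * e n p.2‖ ^ 2)
      (Set.Icc X (X + P) ×ˢ Set.Icc X (X + P)) := by
    refine (continuousOn_finsetSum _ fun n hn => ContinuousOn.mul ?_ ?_).norm.pow 2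
    · exact (hA' n hn).comp continuousOn_fst fun p hp => hp.1
    · exact ((hec n).comp continuous_snd).continuousOn
  have hDi : Integrable (Function.uncurry fun u x => ‖∑ n ∈ s, A' n u * e n x‖ ^ 2)
      ((volume.restrict (Set.Ioc X (X + P))).prod (volume.restrict (Set.Ioc X (X + P)))) := by
    rw [Measure.prod_restrict]
    exact (hDc.integrableOn_compact (isCompact_Icc.prod isCompact_Icc)).mono_set
      (Set.prod_mono Set.Ioc_subset_Icc_self Set.Ioc_subset_Icc_self)
  have hDu : ∀ x, ContinuousOn (fun u => ∑ n ∈ s, A' n u * e n x) (Set.Icc X (X + P)) := fun x =>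
    continuousOn_finsetSum _ fun n hn => (hA' n hn).mul continuousOn_const
  have hrep : ∀ x ∈ Set.Icc X (X + P), ∑ n ∈ s, A n x * e n x =
      (∑ n ∈ s, A n X * e n x) + ∫ u in X..x, ∑ n ∈ s, A' n u * e n x := by
    intro x hx
    have hsub : Set.uIcc X x ⊆ Set.Icc X (X + P) := by
      rw [Set.uIcc_of_le hx.1]
      exact Set.Icc_subset_Icc le_rfl hx.2
    have h_int : ∀ n ∈ s, IntervalIntegrable (fun u => A' n u * e n x) volume X x := fun n hn =>
      (((hA' n hn).mono hsub).mul continuousOn_const).intervalIntegrable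
    rw [intervalIntegral.integral_finsetSum h_int, ← Finset.sum_add_distrib]
    refine Finset.sum_congr rfl fun n hn => ?_
    rw [intervalIntegral.integral_mul_const, intervalIntegral.integral_eq_sub_of_hasDerivAt
      (fun y hy => hA n hn y (hsub hy)) ((hA' n hn).mono hsub).intervalIntegrable]
    ring
  have hpt : ∀ x ∈ Set.Icc X (X + P), ‖∑ n ∈ s, A n x * e n x‖ ^ 2 ≤
      2 * ‖∑ n ∈ s, A n X * e n x‖ ^ 2 +
        2 * P * ∫ u in X..X + P, ‖∑ n ∈ s, A' n u * e n x‖ ^ 2 := by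
    intro x hx
    have hcs := sq_integral_le hXP (hDu x).norm
    rw [show X + P - X = P by ring] at hcs
    have h1 : ‖∫ u in X..x, ∑ n ∈ s, A' n u * e n x‖ ≤
        ∫ u in X..X + P, ‖∑ n ∈ s, A' n u * e n x‖ := by
      refine (intervalIntegral.norm_integral_le_integral_norm hx.1).trans ?_
      refine intervalIntegral.integral_mono_interval le_rfl hx.1 hx.2
        (Filter.Eventually.of_forall fun u => norm_nonneg _) ?_
      exact ContinuousOn.intervalIntegrable (by rw [hu]; exact (hDu x).norm)
    rw [hrep x hx]
    have h2 := norm_add_le (∑ n ∈ s, A n X * e n x) (∫ u in X..x, ∑ n ∈ s, A' n u * e n x)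
    set p := ‖∑ n ∈ s, A n X * e n x‖
    set q := ‖∫ u in X..x, ∑ n ∈ s, A' n u * e n x‖
    have hp : 0 ≤ p := norm_nonneg _
    have hq : 0 ≤ q := norm_nonneg _
    have h3 : q ^ 2 ≤ (∫ u in X..X + P, ‖∑ n ∈ s, A' n u * e n x‖) ^ 2 := by gcongr
    have h4 : ‖(∑ n ∈ s, A n X * e n x) + ∫ u in X..x, ∑ n ∈ s, A' n u * e n x‖ ^ 2
      ≤ (p + q) ^ 2 := by gcongr
    nlinarith [sq_nonneg (p - q)]
  have hSc : ContinuousOn (fun x => ∑ n ∈ s, A n x * e n x) (Set.Icc X (X + P)) :=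
    continuousOn_finsetSum _ fun n hn => ContinuousOn.mul
      (fun x hx => (hA n hn x hx).continuousAt.continuousWithinAt) (hec n).continuousOn
  have hDxi : IntervalIntegrable (fun x => ∫ u in X..X + P, ‖∑ n ∈ s, A' n u * e n x‖ ^ 2)
      volume X (X + P) := by
    rw [intervalIntegrable_iff_integrableOn_Ioc_of_le hXP.le]
    simp_rw [intervalIntegral.integral_of_le hXP.le]
    exact hDi.integral_prod_right
  have hS0i : IntervalIntegrable (fun x => ‖∑ n ∈ s, A n X * e n x‖ ^ 2) volume X (X + P) :=
    (hS0c.norm.pow 2).intervalIntegrable _ _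
  calc _ ≤ ∫ x in X..X + P, (2 * ‖∑ n ∈ s, A n X * e n x‖ ^ 2 +
        2 * P * ∫ u in X..X + P, ‖∑ n ∈ s, A' n u * e n x‖ ^ 2) :=
        intervalIntegral.integral_mono_on hXP.le
          (ContinuousOn.intervalIntegrable (by rw [hu]; exact hSc.norm.pow 2))
          ((hS0i.const_mul _).add (hDxi.const_mul _)) hpt
    _ = 2 * (P * ∑ n ∈ s, ‖A n X‖ ^ 2) + 2 * P * ∫ x in X..X + P, ∫ u in X..X + P,
        ‖∑ n ∈ s, A' n u * e n x‖ ^ 2 := by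
        rw [intervalIntegral.integral_add (hS0i.const_mul _) (hDxi.const_mul _), intervalIntegral.integral_const_mul,
          intervalIntegral.integral_const_mul, integral_norm_sq_sum_exp hP]
    _ = 2 * (P * ∑ n ∈ s, ‖A n X‖ ^ 2) + 2 * P * ∫ u in X..X + P, ∫ x in X..X + P,
        ‖∑ n ∈ s, A' n u * e n x‖ ^ 2 := by
        congr 2
        simp_rw [intervalIntegral.integral_of_le hXP.le]
        exact (integral_integral_swap hDi).symm
    _ = 2 * (P * ∑ n ∈ s, ‖A n X‖ ^ 2) + 2 * P * ∫ u in X..X + P,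
        P * ∑ n ∈ s, ‖A' n u‖ ^ 2 := by
        congr 2
        simp only [he, integral_norm_sq_sum_exp hP]
    _ ≤ 2 * (P * ∑ n ∈ s, B n ^ 2) + 2 * P * ∫ u in X..X + P, P * ∑ n ∈ s, B n ^ 2 := by
        gcongr with n hn
        · exact hB n hn X hX
        · refine intervalIntegral.integral_mono_on hXP.le
            (ContinuousOn.intervalIntegrable ?_) (by simp) fun u hu' => ?_
          · rw [hu]
            exact continuousOn_const.mul (continuousOn_finsetSum _ fun n hn =>
              (hA' n hn).norm.pow 2)
          · gcongr with n hn
            exact hB' n hn u hu'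
    _ = _ := by
        rw [intervalIntegral.integral_const]
        simp only [smul_eq_mul]
        ring

/-- The density of the Gamma distribution of parameter `1 / 2`, up to normalisation. -/
noncomputable def gammaHalf (r : ℝ) : ℝ := Real.exp (-r) * r ^ ((1 / 2 : ℝ) - 1)

theorem integrable_gammaHalf : Integrable gammaHalf (volume.restrict (Set.Ioi 0)) :=
  Real.GammaIntegral_convergent (s := 1 / 2) (by norm_num)

theorem measurable_gammaHalf : Measurable fun r => (gammaHalf r : ℂ) := by
  unfold gammaHalf
  fun_prop

theorem integral_gammaHalf : ∫ r in Set.Ioi (0 : ℝ), gammaHalf r = √Real.pi := by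
  rw [← Real.Gamma_one_half_eq, Real.Gamma_eq_integral (by norm_num)]
  rfl

theorem gammaHalf_nonneg {r : ℝ} (hr : 0 < r) : 0 ≤ gammaHalf r := by
  unfold gammaHalf
  positivity

/-- The amplitude of the Bessel kernel. -/
noncomputable def besselAmp (p : ℝ) (w : ℂ) : ℂ :=
  ∫ r in Set.Ioi (0 : ℝ), (gammaHalf r : ℂ) * (Real.pi * w + r) ^ (-(p : ℂ))

theorem pi_mul_norm_le {w : ℂ} (hw : 0 < w.re) {r : ℝ} (hr : 0 < r) :
    Real.pi * ‖w‖ ≤ ‖(Real.pi * w + r : ℂ)‖ := by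
  have hpi := Real.pi_pos
  have h : (Real.pi * ‖w‖) ^ 2 ≤ ‖(Real.pi * w + r : ℂ)‖ ^ 2 := by
    rw [mul_pow, ← Complex.normSq_eq_norm_sq, ← Complex.normSq_eq_norm_sq,
      Complex.normSq_apply, Complex.normSq_apply]
    simp only [Complex.add_re, Complex.mul_re, Complex.ofReal_re, Complex.ofReal_im, zero_mul,
      sub_zero, Complex.add_im, Complex.mul_im, add_zero]
    have : 0 ≤ Real.pi * w.re * r := by positivity
    nlinarith
  exact le_of_sq_le_sq h (norm_nonneg _)

theorem norm_besselAmp_integrand_le {p : ℝ} (hp : 0 < p) {w : ℂ} (hw : 0 < w.re) {m : ℝ}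
    (hm : 0 < m) (hmw : m ≤ Real.pi * ‖w‖) {r : ℝ} (hr : 0 < r) :
    ‖(gammaHalf r : ℂ) * (Real.pi * w + r) ^ (-(p : ℂ))‖ ≤ gammaHalf r * m ^ (-p) := by
  rw [norm_mul, Complex.norm_real, Real.norm_of_nonneg (gammaHalf_nonneg hr),
    ← Complex.ofReal_neg, Complex.norm_cpow_real]
  refine mul_le_mul_of_nonneg_left ?_ (gammaHalf_nonneg hr)
  exact Real.rpow_le_rpow_of_nonpos hm (hmw.trans (pi_mul_norm_le hw hr)) (by linarith)

theorem pi_mul_add_mem_slitPlane {w : ℂ} (hw : 0 < w.re) {r : ℝ} (hr : 0 < r) :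
    (Real.pi * w + r : ℂ) ∈ Complex.slitPlane := by
  left
  simp
  positivity

theorem aestronglyMeasurable_besselAmp_integrand (p : ℝ) {w : ℂ} (hw : 0 < w.re) :
    AEStronglyMeasurable (fun r : ℝ => (gammaHalf r : ℂ) * (Real.pi * w + r) ^ (-(p : ℂ)))
      (volume.restrict (Set.Ioi 0)) := by
  refine measurable_gammaHalf.aestronglyMeasurable.mul ?_
  refine ContinuousOn.aestronglyMeasurable (fun r hr => ?_) measurableSet_Ioi
  refine ContinuousAt.continuousWithinAt ?_
  exact ContinuousAt.cpow (by fun_prop) continuousAt_const (pi_mul_add_mem_slitPlane hw hr)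

theorem norm_pos_of_re_pos {w : ℂ} (hw : 0 < w.re) : 0 < ‖w‖ :=
  hw.trans_le (Complex.re_le_norm w)

theorem norm_besselAmp_le {p : ℝ} (hp : 0 < p) {w : ℂ} (hw : 0 < w.re) :
    ‖besselAmp p w‖ ≤ √Real.pi * (Real.pi * ‖w‖) ^ (-p) := by
  have hw' := norm_pos_of_re_pos hw
  rw [besselAmp, ← integral_gammaHalf, ← integral_mul_const]
  refine norm_integral_le_of_norm_le (integrable_gammaHalf.mul_const _) ?_
  filter_upwards [ae_restrict_mem measurableSet_Ioi] with r hr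
  exact norm_besselAmp_integrand_le hp hw (by positivity) le_rfl hr

theorem hasDerivAt_besselAmp {p : ℝ} (hp : 0 < p) {w : ℂ} (hw : 0 < w.re) :
    HasDerivAt (besselAmp p) (-(p * Real.pi) * besselAmp (p + 1) w) w := by
  set s : Set ℂ := {z | w.re / 2 < z.re} with hs
  have hpi := Real.pi_pos
  have hso : IsOpen s := isOpen_lt continuous_const Complex.continuous_re
  have hws : w ∈ s := by simp only [hs, Set.mem_ofPred_eq]; linarith
  have hpos : ∀ z ∈ s, 0 < z.re := fun z hz => by
    simp only [hs, Set.mem_ofPred_eq] at hz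
    linarith
  have hm : ∀ z ∈ s, Real.pi * (w.re / 2) ≤ Real.pi * ‖z‖ := fun z hz => by
    have h1 : w.re / 2 < z.re := hz
    have := Complex.re_le_norm z
    gcongr
    linarith
  have h_int : ∀ {q : ℝ}, 0 < q → Integrable (fun r : ℝ => (gammaHalf r : ℂ) *
      (Real.pi * w + r) ^ (-(q : ℂ))) (volume.restrict (Set.Ioi 0)) := by
    intro q hq
    refine Integrable.mono' (integrable_gammaHalf.mul_const ((Real.pi * (w.re / 2)) ^ (-q)))
      (aestronglyMeasurable_besselAmp_integrand q hw) ?_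
    filter_upwards [ae_restrict_mem measurableSet_Ioi] with r hr
    exact norm_besselAmp_integrand_le hq hw (by positivity) (hm w hws) hr
  have key := hasDerivAt_integral_of_dominated_loc_of_deriv_le
    (μ := volume.restrict (Set.Ioi (0 : ℝ)))
    (F := fun (z : ℂ) (r : ℝ) => (gammaHalf r : ℂ) * (Real.pi * z + r) ^ (-(p : ℂ)))
    (F' := fun (z : ℂ) (r : ℝ) => -(p * Real.pi) *
      ((gammaHalf r : ℂ) * (Real.pi * z + r) ^ (-((p + 1 : ℝ) : ℂ))))
    (bound := fun r => p * Real.pi * (gammaHalf r * (Real.pi * (w.re / 2)) ^ (-(p + 1))))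
    (x₀ := w) (s := s) (hso.mem_nhds hws)
    (by filter_upwards [hso.mem_nhds hws] with z hz
        exact aestronglyMeasurable_besselAmp_integrand p (hpos z hz))
    (h_int hp) ((aestronglyMeasurable_besselAmp_integrand (p + 1) hw).const_mul _) ?_
    ((integrable_gammaHalf.mul_const _).const_mul _) ?_
  · have h2 := key.2
    rw [integral_const_mul] at h2
    exact h2
  · filter_upwards [ae_restrict_mem measurableSet_Ioi] with r hr z hz
    rw [norm_mul, norm_neg, norm_mul, Complex.norm_real, Complex.norm_real,
      Real.norm_of_nonneg hp.le, Real.norm_of_nonneg hpi.le]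
    gcongr
    exact norm_besselAmp_integrand_le (by linarith) (hpos z hz) (by positivity) (hm z hz) hr
  · filter_upwards [ae_restrict_mem measurableSet_Ioi] with r hr z hz
    have h1 : HasDerivAt (fun z : ℂ => (Real.pi * z + r : ℂ)) Real.pi z := by
      simpa using ((hasDerivAt_id z).const_mul (Real.pi : ℂ)).add_const (r : ℂ)
    convert! (h1.cpow_const (c := -(p : ℂ)) (pi_mul_add_mem_slitPlane (hpos z hz) hr)).const_mul
      (gammaHalf r : ℂ) using 1
    push_cast
    rw [show -(p : ℂ) - 1 = -(p + 1) by ring]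
    ring

theorem integral_comp_two_mul_arsinh (g : ℝ → ℂ) :
    ∫ v, g v = ∫ q, ((2 * (√(1 + q ^ 2))⁻¹ : ℝ) : ℂ) * g (2 * Real.arsinh q) := by
  have h := integral_image_eq_integral_abs_deriv_smul (s := Set.univ)
    (f := fun q => 2 * Real.arsinh q) (f' := fun q => 2 * (√(1 + q ^ 2))⁻¹) MeasurableSet.univ
    (fun q _ => ((Real.hasDerivAt_arsinh q).const_mul 2).hasDerivWithinAt)
    (fun x _ y _ hxy => Real.arsinh_injective (by simpa using hxy)) g
  have hr : (fun q => 2 * Real.arsinh q) '' Set.univ = Set.univ := by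
    refine Set.eq_univ_of_forall fun v => ⟨Real.sinh (v / 2), trivial, ?_⟩
    simp only [Real.arsinh_sinh]
    ring
  rw [hr] at h
  simp only [Measure.restrict_univ] at h
  rw [h]
  refine integral_congr_ae (Filter.Eventually.of_forall fun q => ?_)
  simp only
  rw [abs_of_nonneg (by positivity), Complex.real_smul]

theorem integral_gammaHalf_mul_exp (q : ℝ) :
    ∫ r in Set.Ioi (0 : ℝ), gammaHalf r * Real.exp (-(r * q ^ 2)) =
      √Real.pi * (√(1 + q ^ 2))⁻¹ := by
  have h := Real.integral_rpow_mul_exp_neg_mul_Ioi (a := 1 / 2) (r := 1 + q ^ 2) (by norm_num)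
    (by positivity)
  rw [Real.Gamma_one_half_eq, ← Real.sqrt_eq_rpow, one_div (1 + q ^ 2), Real.sqrt_inv,
    mul_comm (√(1 + q ^ 2))⁻¹] at h
  rw [← h]
  refine integral_congr_ae (Filter.Eventually.of_forall fun r => ?_)
  simp only [gammaHalf]
  rw [mul_right_comm, ← Real.exp_add, mul_comm]
  congr 2
  ring

theorem integral_exp_neg_cosh {w : ℂ} (hw : 0 < w.re) :
    ∫ v : ℝ, Complex.exp (-(Real.pi / 2 * w * Real.cosh v)) =
      Complex.exp (-(Real.pi / 2 * w)) * (2 * besselAmp (1 / 2) w) := by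
  have hpi := Real.pi_pos
  have hsp : (√Real.pi : ℂ) ≠ 0 := by exact_mod_cast (Real.sqrt_pos.mpr hpi).ne'
  have h_int : Integrable (Function.uncurry fun (q r : ℝ) => (gammaHalf r : ℂ) *
      Complex.exp (-(Real.pi * w + r) * q ^ 2)) (volume.prod (volume.restrict (Set.Ioi 0))) := by
    have hb := (integrable_exp_neg_mul_sq (b := Real.pi * w.re) (by positivity)).mul_prod
      integrable_gammaHalf
    refine hb.mono' ?_ ?_
    · refine AEStronglyMeasurable.mul ?_ ?_
      · exact (measurable_gammaHalf.comp measurable_snd).aestronglyMeasurable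
      · exact Continuous.aestronglyMeasurable (by fun_prop)
    · have : ∀ᵐ z : ℝ × ℝ ∂(volume.prod (volume.restrict (Set.Ioi 0))), 0 < z.2 :=
        Measure.quasiMeasurePreserving_snd.ae (ae_restrict_mem measurableSet_Ioi)
      filter_upwards [this] with z hz
      simp only [Function.uncurry]
      rw [norm_mul, Complex.norm_real, Real.norm_of_nonneg (gammaHalf_nonneg hz), Complex.norm_exp,
        mul_comm]
      refine mul_le_mul_of_nonneg_right ?_ (gammaHalf_nonneg hz)
      rw [Real.exp_le_exp, ← Complex.ofReal_pow, Complex.re_mul_ofReal]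
      simp
      nlinarith [sq_nonneg z.1]
  have e1 : ∀ q : ℝ, ((2 * (√(1 + q ^ 2))⁻¹ : ℝ) : ℂ) *
      Complex.exp (-(Real.pi / 2 * w * Real.cosh (2 * Real.arsinh q))) =
      Complex.exp (-(Real.pi / 2 * w)) * (2 / √Real.pi) * ∫ r in Set.Ioi (0 : ℝ),
        (gammaHalf r : ℂ) * Complex.exp (-(Real.pi * w + r) * q ^ 2) := by
    intro q
    have h1 : ∀ r : ℝ, (gammaHalf r : ℂ) * Complex.exp (-(Real.pi * w + r) * q ^ 2) =
        Complex.exp (-(Real.pi * w * q ^ 2)) * ((gammaHalf r * Real.exp (-(r * q ^ 2)) : ℝ) : ℂ) := by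
      intro r
      push_cast
      rw [mul_left_comm, ← Complex.exp_add]
      congr 2
      ring
    simp_rw [h1]
    rw [integral_const_mul, integral_complex_ofReal, integral_gammaHalf_mul_exp]
    have h2 : Real.cosh (2 * Real.arsinh q) = 1 + 2 * q ^ 2 := by
      rw [Real.cosh_two_mul, Real.cosh_sq, Real.sinh_arsinh]
      ring
    rw [h2]
    push_cast
    have h3 : Complex.exp (-(Real.pi / 2 * w * (1 + 2 * q ^ 2))) =
        Complex.exp (-(Real.pi / 2 * w)) * Complex.exp (-(Real.pi * w * q ^ 2)) := by
      rw [← Complex.exp_add]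
      congr 1
      ring
    rw [h3]
    field_simp
  rw [integral_comp_two_mul_arsinh]
  simp_rw [e1]
  rw [integral_const_mul, integral_integral_swap h_int, besselAmp]
  have e2 : ∀ r ∈ Set.Ioi (0 : ℝ), ∫ q : ℝ, (gammaHalf r : ℂ) *
      Complex.exp (-(Real.pi * w + r) * q ^ 2) =
      √Real.pi * ((gammaHalf r : ℂ) * (Real.pi * w + r) ^ (-((1 / 2 : ℝ) : ℂ))) := by
    intro r hr
    have hre : 0 < (Real.pi * w + r : ℂ).re := by
      have : (0 : ℝ) < r := hr
      simp
      positivity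
    have hne : (Real.pi * w + r : ℂ) ≠ 0 := fun h => by simp [h] at hre
    have harg : (Real.pi * w + r : ℂ).arg ≠ Real.pi :=
      Complex.mem_slitPlane_iff_arg.mp (pi_mul_add_mem_slitPlane hw hr) |>.1
    rw [integral_const_mul, integral_gaussian_complex hre, mul_left_comm]
    congr 1
    rw [Complex.cpow_def_of_ne_zero (by simp [hne, hpi.ne']), Complex.cpow_def_of_ne_zero hne,
      div_eq_mul_inv, Complex.log_ofReal_mul hpi (inv_ne_zero hne), Complex.log_inv _ harg,
      Real.sqrt_eq_rpow, Real.rpow_def_of_pos hpi, Complex.ofReal_exp, ← Complex.exp_add]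
    congr 1
    push_cast
    ring
  rw [setIntegral_congr_fun measurableSet_Ioi e2, integral_const_mul]
  field_simp

/-- The amplitude of `besselKer w / 2 + w * besselKerDeriv w`. -/
noncomputable def kerAmp (w : ℂ) : ℂ :=
  besselAmp (1 / 2) w - Real.pi * w * besselAmp (1 / 2) w - Real.pi * w * besselAmp (3 / 2) w

/-- The derivative of `kerAmp`. -/
noncomputable def kerAmpDeriv (w : ℂ) : ℂ :=
  -(Real.pi / 2) * besselAmp (3 / 2) w - Real.pi * besselAmp (1 / 2) w
    + Real.pi ^ 2 / 2 * w * besselAmp (3 / 2) w - Real.pi * besselAmp (3 / 2) w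
    + 3 * Real.pi ^ 2 / 2 * w * besselAmp (5 / 2) w

/-- The Bessel kernel. -/
noncomputable def besselKer (w : ℂ) : ℂ :=
  Complex.exp (-(Real.pi / 2 * w)) * (2 * besselAmp (1 / 2) w)

/-- The derivative of the Bessel kernel. -/
noncomputable def besselKerDeriv (w : ℂ) : ℂ :=
  -(Complex.exp (-(Real.pi / 2 * w)) * (Real.pi * besselAmp (1 / 2) w +
    Real.pi * besselAmp (3 / 2) w))

theorem hasDerivAt_besselAmp_half {w : ℂ} (hw : 0 < w.re) :
    HasDerivAt (besselAmp (1 / 2)) (-(Real.pi / 2) * besselAmp (3 / 2) w) w := by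
  have := hasDerivAt_besselAmp (p := 1 / 2) (by norm_num) hw
  norm_num at this
  convert! this using 1
  ring

theorem hasDerivAt_besselAmp_three_half {w : ℂ} (hw : 0 < w.re) :
    HasDerivAt (besselAmp (3 / 2)) (-(3 * Real.pi / 2) * besselAmp (5 / 2) w) w := by
  have := hasDerivAt_besselAmp (p := 3 / 2) (by norm_num) hw
  norm_num at this
  convert! this using 1
  ring

theorem hasDerivAt_kerAmp {w : ℂ} (hw : 0 < w.re) :
    HasDerivAt kerAmp (kerAmpDeriv w) w := by
  have h1 := hasDerivAt_besselAmp_half hw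
  have h3 := hasDerivAt_besselAmp_three_half hw
  have hl : HasDerivAt (fun w : ℂ => (Real.pi * w : ℂ)) Real.pi w := by
    simpa using (hasDerivAt_id w).const_mul (Real.pi : ℂ)
  convert! (h1.sub (hl.mul h1)).sub (hl.mul h3) using 1
  unfold kerAmpDeriv
  ring

theorem hasDerivAt_besselKer {w : ℂ} (hw : 0 < w.re) :
    HasDerivAt besselKer (besselKerDeriv w) w := by
  have h1 := hasDerivAt_besselAmp_half hw
  have hl : HasDerivAt (fun w : ℂ => (-(Real.pi / 2 * w) : ℂ)) (-(Real.pi / 2)) w := by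
    convert! ((hasDerivAt_id w).const_mul (Real.pi / 2 : ℂ)).neg using 1
    ring
  convert! hl.cexp.mul (h1.const_mul 2) using 1
  unfold besselKerDeriv
  ring

theorem besselKer_half_add (w : ℂ) :
    besselKer w / 2 + w * besselKerDeriv w =
      Complex.exp (-(Real.pi / 2 * w)) * kerAmp w := by
  unfold besselKer besselKerDeriv kerAmp
  ring

theorem norm_besselAmp_le_rpow {p : ℝ} (hp : 0 < p) {w : ℂ} (hw : 0 < w.re) :
    ‖besselAmp p w‖ ≤ 2 * ‖w‖ ^ (-p) := by
  refine (norm_besselAmp_le hp hw).trans ?_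
  have hw' := norm_pos_of_re_pos hw
  have hpi := Real.pi_gt_three
  gcongr ?_ * ?_
  · rw [Real.sqrt_le_left (by norm_num)]
    linarith [Real.pi_lt_four]
  · exact Real.rpow_le_rpow_of_nonpos hw' (by nlinarith) (by linarith)

theorem exists_kerAmp_bound : ∃ C : ℝ, 0 < C ∧ ∀ w : ℂ, 0 < w.re → 1 ≤ ‖w‖ →
    ‖kerAmp w‖ ≤ C * √‖w‖ ∧ ‖kerAmpDeriv w‖ * ‖w‖ ≤ C * √‖w‖ ∧
    ‖besselKer w‖ ≤ C * Real.exp (-(Real.pi / 2 * w.re)) ∧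
    ‖besselKerDeriv w‖ ≤ C * Real.exp (-(Real.pi / 2 * w.re)) := by
  have hpi := Real.pi_pos
  refine ⟨100 + 100 * Real.pi ^ 2, by positivity, fun w hw h1 => ?_⟩
  have hw' := norm_pos_of_re_pos hw
  set x := ‖w‖ with hx
  have hs : 1 ≤ √x := Real.one_le_sqrt.mpr h1
  have hss : √x * √x = x := Real.mul_self_sqrt hw'.le
  set u := √x with hu
  have hu0 : 0 < u := by linarith
  have e1 : x ^ (-(1 / 2 : ℝ)) = u⁻¹ := by
    rw [Real.rpow_neg hw'.le, ← Real.sqrt_eq_rpow]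
  have e3 : x ^ (-(3 / 2 : ℝ)) = u⁻¹ ^ 3 := by
    rw [← e1, ← Real.rpow_natCast, ← Real.rpow_mul hw'.le]; norm_num
  have e5 : x ^ (-(5 / 2 : ℝ)) = u⁻¹ ^ 5 := by
    rw [← e1, ← Real.rpow_natCast, ← Real.rpow_mul hw'.le]; norm_num
  have b1 := norm_besselAmp_le_rpow (p := 1 / 2) (by norm_num) hw
  have b3 := norm_besselAmp_le_rpow (p := 3 / 2) (by norm_num) hw
  have b5 := norm_besselAmp_le_rpow (p := 5 / 2) (by norm_num) hw
  rw [e1] at b1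
  rw [e3] at b3
  rw [e5] at b5
  have hi1 : u⁻¹ ≤ 1 := inv_le_one_of_one_le₀ hs
  have hi0 : 0 < u⁻¹ := by positivity
  have hiu : u⁻¹ * u = 1 := by field_simp
  set i := u⁻¹ with hi
  have c1 : x * i = u := by rw [← hss]; linear_combination u * hiu
  have i3 : i ^ 3 ≤ i := by nlinarith [sq_nonneg i, mul_pos hi0 hi0]
  have hpin : ‖(Real.pi : ℂ)‖ = Real.pi := by rw [Complex.norm_real, Real.norm_of_nonneg hpi.le]
  have hp3 := Real.pi_gt_three
  have hp32 : 3 * Real.pi ≤ Real.pi ^ 2 := by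
    rw [sq]
    exact mul_le_mul_of_nonneg_right hp3.le hpi.le
  have n1 : ‖kerAmp w‖ ≤ 2 * i + Real.pi * x * (2 * i) + Real.pi * x * (2 * i ^ 3) := by
    unfold kerAmp
    refine (norm_sub_le _ _).trans (add_le_add ((norm_sub_le _ _).trans (add_le_add b1 ?_)) ?_)
    · rw [norm_mul, norm_mul, hpin]; gcongr
    · rw [norm_mul, norm_mul, hpin]; gcongr
  have n2 : ‖kerAmpDeriv w‖ ≤ Real.pi / 2 * (2 * i ^ 3) + Real.pi * (2 * i) +
      Real.pi ^ 2 / 2 * x * (2 * i ^ 3) + Real.pi * (2 * i ^ 3) +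
      3 * Real.pi ^ 2 / 2 * x * (2 * i ^ 5) := by
    unfold kerAmpDeriv
    refine (norm_add_le _ _).trans (add_le_add ((norm_sub_le _ _).trans (add_le_add
      ((norm_add_le _ _).trans (add_le_add ((norm_sub_le _ _).trans (add_le_add ?_ ?_)) ?_)) ?_)) ?_)
    all_goals
      simp only [norm_mul, norm_div, norm_neg, norm_pow, hpin, Complex.norm_ofNat]
      gcongr
  have n3 : ‖Real.pi * besselAmp (1 / 2) w + Real.pi * besselAmp (3 / 2) w‖ ≤
      Real.pi * (2 * i) + Real.pi * (2 * i ^ 3) := by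
    refine (norm_add_le _ _).trans (add_le_add ?_ ?_)
    all_goals
      simp only [norm_mul, hpin]
      gcongr
  have hexp : ‖Complex.exp (-(Real.pi / 2 * w))‖ = Real.exp (-(Real.pi / 2 * w.re)) := by
    rw [Complex.norm_exp]
    congr 1
    have : (-(Real.pi / 2 * w) : ℂ) = ((-(Real.pi / 2) : ℝ) : ℂ) * w := by push_cast; ring
    rw [this, Complex.re_ofReal_mul]
    ring
  have i31 : i ^ 3 ≤ 1 := by linarith
  refine ⟨?_, ?_, ?_, ?_⟩
  · have : Real.pi * x * (2 * i ^ 3) ≤ Real.pi * x * (2 * i) := by gcongr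
    have e : Real.pi * x * (2 * i) = 2 * Real.pi * u := by rw [← c1]; ring
    have e' : 2 * Real.pi * u ≤ Real.pi ^ 2 * u := by gcongr; linarith
    have : 0 ≤ Real.pi ^ 2 * u := by positivity
    have : i ≤ u := by linarith
    linarith
  · have hxi : x * i ^ 3 = i := by
      rw [← hss]; linear_combination (i + u * i ^ 2) * hiu
    have hxi5 : x * i ^ 5 = i ^ 3 := by
      rw [← hss]; linear_combination (i ^ 3 + u * i ^ 4) * hiu
    have e2 : ‖kerAmpDeriv w‖ ≤ 20 * Real.pi ^ 2 * i := by
      have q1 : Real.pi ^ 2 / 2 * x * (2 * i ^ 3) = Real.pi ^ 2 * i := by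
        linear_combination Real.pi ^ 2 * hxi
      have q2 : 3 * Real.pi ^ 2 / 2 * x * (2 * i ^ 5) = 3 * Real.pi ^ 2 * i ^ 3 := by
        linear_combination 3 * Real.pi ^ 2 * hxi5
      rw [q1, q2] at n2
      have q3 : Real.pi * i ^ 3 ≤ Real.pi * i := by gcongr
      have q4 : Real.pi ^ 2 * i ^ 3 ≤ Real.pi ^ 2 * i := by gcongr
      have q5 : Real.pi * i ≤ Real.pi ^ 2 * i := by gcongr; linarith
      have q6 : 0 ≤ Real.pi ^ 2 * i := by positivity
      linarith
    calc _ ≤ 20 * Real.pi ^ 2 * i * x := by gcongr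
      _ = 20 * Real.pi ^ 2 * u := by rw [← c1]; ring
      _ ≤ _ := by gcongr; linarith [sq_nonneg Real.pi]
  · rw [besselKer, norm_mul, hexp, norm_mul, Complex.norm_ofNat, mul_comm]
    refine mul_le_mul_of_nonneg_right ?_ (Real.exp_pos _).le
    linarith [sq_nonneg Real.pi]
  · rw [besselKerDeriv, norm_neg, norm_mul, hexp, mul_comm]
    refine mul_le_mul_of_nonneg_right ?_ (Real.exp_pos _).le
    have q1 : Real.pi * (2 * i) ≤ Real.pi * 2 := by gcongr; linarith
    have q2 : Real.pi * (2 * i ^ 3) ≤ Real.pi * 2 := by gcongr; linarith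
    linarith [sq_nonneg Real.pi]

/-- The terms of the series for the derivative of the autocorrelation. -/
noncomputable def kerTerm (b : ℕ → ℂ) (z : ℂ) (n : ℕ) (x : ℝ) : ℂ :=
  b n * (Complex.exp (-(Real.pi / 2 * (n * z * x))) * kerAmp (n * z * x))

theorem re_natCast_mul_mul (n : ℕ) (z : ℂ) (x : ℝ) : ((n : ℂ) * z * x).re = n * z.re * x := by
  simp

theorem norm_natCast_mul_mul (n : ℕ) {z : ℂ} (hz : ‖z‖ = 1) {x : ℝ} (hx : 0 ≤ x) :
    ‖(n : ℂ) * z * x‖ = n * x := by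
  simp [hz, abs_of_nonneg hx]

/-- `kerTerm` with the oscillating factor removed. -/
noncomputable def kerTermAmp (b : ℕ → ℂ) (z : ℂ) (n : ℕ) (x : ℝ) : ℂ :=
  b n * (Complex.exp (((-(Real.pi / 2 * n * z.re) : ℝ) : ℂ) * x) * kerAmp (n * z * x))

/-- The derivative of `kerTermAmp`. -/
noncomputable def kerTermAmpDeriv (b : ℕ → ℂ) (z : ℂ) (n : ℕ) (x : ℝ) : ℂ :=
  b n * (Complex.exp (((-(Real.pi / 2 * n * z.re) : ℝ) : ℂ) * x) *
    (((-(Real.pi / 2 * n * z.re) : ℝ) : ℂ) * kerAmp (n * z * x)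
      + kerAmpDeriv (n * z * x) * (n * z)))

theorem kerTerm_eq (b : ℕ → ℂ) {z : ℂ} (hz : z.im ≠ 0) (n : ℕ) (x : ℝ) :
    kerTerm b z n x = kerTermAmp b z n x *
      Complex.exp (-(2 * Real.pi * Complex.I * n / ((4 / z.im : ℝ) : ℂ) * x)) := by
  unfold kerTerm kerTermAmp
  have h : Complex.exp (-(Real.pi / 2 * (n * z * x))) =
      Complex.exp (((-(Real.pi / 2 * n * z.re) : ℝ) : ℂ) * x) *
      Complex.exp (-(2 * Real.pi * Complex.I * n / ((4 / z.im : ℝ) : ℂ) * x)) := by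
    rw [← Complex.exp_add]
    congr 1
    have hz' : (z.im : ℂ) ≠ 0 := by exact_mod_cast hz
    conv_lhs => rw [← Complex.re_add_im z]
    push_cast
    field_simp
    ring
  rw [h]
  ring

theorem hasDerivAt_kerTermAmp (b : ℕ → ℂ) {z : ℂ} (hz : 0 < z.re) {n : ℕ} (hn : 0 < n) {x : ℝ}
    (hx : 0 < x) : HasDerivAt (kerTermAmp b z n) (kerTermAmpDeriv b z n x) x := by
  have hre : 0 < ((n : ℂ) * z * x).re := by rw [re_natCast_mul_mul]; positivity
  have hx1 : HasDerivAt (fun x : ℝ => (x : ℂ)) 1 x := Complex.ofRealCLM.hasDerivAt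
  have h1 : HasDerivAt (fun x : ℝ => ((n : ℂ) * z * x)) (n * z) x := by
    simpa using hx1.const_mul ((n : ℂ) * z)
  have h2 : HasDerivAt (fun x : ℝ => kerAmp (n * z * x))
      (kerAmpDeriv (n * z * x) * (n * z)) x :=
    HasDerivAt.comp (h₂ := kerAmp) (h := fun x : ℝ => (n : ℂ) * z * x) x (hasDerivAt_kerAmp hre) h1
  have h3 : HasDerivAt (fun x : ℝ => (((-(Real.pi / 2 * n * z.re) : ℝ) : ℂ) * x))
      ((-(Real.pi / 2 * n * z.re) : ℝ) : ℂ) x := by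
    simpa using hx1.const_mul ((-(Real.pi / 2 * n * z.re) : ℝ) : ℂ)
  convert! (h3.cexp.mul h2).const_mul (b n) using 1
  unfold kerTermAmpDeriv
  ring

theorem continuousAt_besselAmp {p : ℝ} (hp : 0 < p) {w : ℂ} (hw : 0 < w.re) :
    ContinuousAt (besselAmp p) w := (hasDerivAt_besselAmp hp hw).continuousAt

theorem continuousAt_kerAmpDeriv {w : ℂ} (hw : 0 < w.re) : ContinuousAt kerAmpDeriv w := by
  have h1 := continuousAt_besselAmp (p := 1 / 2) (by norm_num) hw
  have h3 := continuousAt_besselAmp (p := 3 / 2) (by norm_num) hw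
  have h5 := continuousAt_besselAmp (p := 5 / 2) (by norm_num) hw
  unfold kerAmpDeriv
  fun_prop

theorem continuousAt_kerTermAmpDeriv (b : ℕ → ℂ) {z : ℂ} (hz : 0 < z.re) {n : ℕ} (hn : 0 < n)
    {x : ℝ} (hx : 0 < x) : ContinuousAt (kerTermAmpDeriv b z n) x := by
  have hre : 0 < ((n : ℂ) * z * x).re := by rw [re_natCast_mul_mul]; positivity
  have h1 : ContinuousAt (fun x : ℝ => ((n : ℂ) * z * x)) x := by fun_prop
  have h2 : ContinuousAt (fun x : ℝ => kerAmp (n * z * x)) x :=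
    ContinuousAt.comp (f := fun x : ℝ => ((n : ℂ) * z * x)) (hasDerivAt_kerAmp hre).continuousAt h1
  have h3 : ContinuousAt (fun x : ℝ => kerAmpDeriv (n * z * x)) x :=
    ContinuousAt.comp (f := fun x : ℝ => ((n : ℂ) * z * x)) (continuousAt_kerAmpDeriv hre) h1
  unfold kerTermAmpDeriv
  fun_prop

theorem norm_exp_ofReal_mul (c x : ℝ) : ‖Complex.exp ((c : ℂ) * x)‖ = Real.exp (c * x) := by
  rw [← Complex.ofReal_mul, Complex.norm_exp_ofReal]

theorem exists_kerTermAmp_bound : ∃ C : ℝ, 0 < C ∧ ∀ (b : ℕ → ℂ) (z : ℂ), ‖z‖ = 1 → 0 < z.re →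
    ∀ n : ℕ, 0 < n → ∀ x : ℝ, 1 ≤ x →
    ‖kerTermAmp b z n x‖ ≤ C * ‖b n‖ * √(n * x) * Real.exp (-(Real.pi / 4 * n * z.re * x)) ∧
    ‖kerTermAmpDeriv b z n x‖ ≤
      C * ‖b n‖ * √(n * x) * Real.exp (-(Real.pi / 4 * n * z.re * x)) := by
  obtain ⟨C, hC, hb⟩ := exists_kerAmp_bound
  refine ⟨3 * C, by positivity, fun b z hz hre n hn x hx => ?_⟩
  have hn1 : (1 : ℝ) ≤ n := by exact_mod_cast hn
  have hpi := Real.pi_pos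
  have hre' : 0 < ((n : ℂ) * z * x).re := by rw [re_natCast_mul_mul]; positivity
  have hnorm := norm_natCast_mul_mul n hz (x := x) (by linarith)
  obtain ⟨h1, h2, -, -⟩ := hb _ hre' (by rw [hnorm]; nlinarith)
  rw [hnorm] at h1 h2
  set t := Real.pi / 4 * n * z.re * x with ht
  have ht0 : 0 ≤ t := by positivity
  have he : Real.exp (-(Real.pi / 2 * n * z.re) * x) = Real.exp (-t) * Real.exp (-t) := by
    rw [← Real.exp_add]; congr 1; rw [ht]; ring
  have he1 : Real.exp (-t) ≤ 1 := Real.exp_le_one_iff.mpr (by linarith)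
  have hE : 0 < Real.exp (-t) := Real.exp_pos _
  have hte : t * Real.exp (-t) ≤ 1 := by
    have h := Real.add_one_le_exp t
    have h' : Real.exp t * Real.exp (-t) = 1 := by rw [← Real.exp_add]; simp
    nlinarith
  set q := √(n * x) with hq
  have hq0 : 0 ≤ q := Real.sqrt_nonneg _
  constructor
  · rw [kerTermAmp, norm_mul, norm_mul, norm_exp_ofReal_mul, he]
    calc _ ≤ ‖b n‖ * (Real.exp (-t) * 1 * (C * q)) := by gcongr
      _ ≤ 3 * (‖b n‖ * (Real.exp (-t) * 1 * (C * q))) := by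
        have : 0 ≤ ‖b n‖ * (Real.exp (-t) * 1 * (C * q)) := by positivity
        linarith
      _ = _ := by ring
  · rw [kerTermAmpDeriv, norm_mul, norm_mul, norm_exp_ofReal_mul, he]
    have hd : ‖kerAmpDeriv (n * z * x) * (n * z)‖ ≤ C * q := by
      rw [norm_mul, norm_mul, hz, Complex.norm_natCast, mul_one]
      calc _ ≤ ‖kerAmpDeriv (n * z * x)‖ * (n * x) := by
            gcongr
            nlinarith
        _ ≤ _ := h2
    have hd2 : ‖((-(Real.pi / 2 * n * z.re) : ℝ) : ℂ) * kerAmp (n * z * x)‖ ≤ 2 * t * (C * q) := by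
      rw [norm_mul, Complex.norm_real, norm_neg, Real.norm_of_nonneg (by positivity)]
      have hc : Real.pi / 2 * n * z.re ≤ 2 * t := by
        have : 0 ≤ Real.pi / 2 * n * z.re := by positivity
        have h2 := mul_le_mul_of_nonneg_left hx this
        rw [ht]
        linarith
      exact mul_le_mul hc h1 (norm_nonneg _) (by positivity)
    calc _ ≤ ‖b n‖ * (Real.exp (-t) * Real.exp (-t) * (2 * t * (C * q) + C * q)) := by
          gcongr
          exact (norm_add_le _ _).trans (add_le_add hd2 hd)
      _ = ‖b n‖ * (Real.exp (-t) * (2 * (t * Real.exp (-t)) + Real.exp (-t)) * (C * q)) := by ring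
      _ ≤ ‖b n‖ * (Real.exp (-t) * (2 * 1 + 1) * (C * q)) := by gcongr
      _ = _ := by ring

theorem norm_kerTerm (b : ℕ → ℂ) {z : ℂ} (hz : z.im ≠ 0) (n : ℕ) (x : ℝ) :
    ‖kerTerm b z n x‖ = ‖kerTermAmp b z n x‖ := by
  rw [kerTerm_eq b hz, norm_mul]
  have : (-(2 * Real.pi * Complex.I * n / ((4 / z.im : ℝ) : ℂ) * x) : ℂ) =
      ((-(2 * Real.pi * n / (4 / z.im) * x) : ℝ) : ℂ) * Complex.I := by
    push_cast; ring
  rw [this, Complex.norm_exp_ofReal_mul_I, mul_one]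

theorem continuousOn_kerTerm (b : ℕ → ℂ) (hb : b 0 = 0) {z : ℂ} (hz : 0 < z.re) (hz' : z.im ≠ 0)
    (n : ℕ) : ContinuousOn (kerTerm b z n) (Set.Ioi 0) := by
  intro x hx
  rcases Nat.eq_zero_or_pos n with rfl | hn
  · have : kerTerm b z 0 = fun _ => 0 := by
      funext x; simp [kerTerm, hb]
    rw [this]
    exact continuousWithinAt_const
  · have h := (hasDerivAt_kerTermAmp b hz hn hx).continuousAt
    have : kerTerm b z n = fun x => kerTermAmp b z n x *
      Complex.exp (-(2 * Real.pi * Complex.I * n / ((4 / z.im : ℝ) : ℂ) * x)) := by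
      funext x; exact kerTerm_eq b hz' n x
    rw [this]
    refine ContinuousAt.continuousWithinAt ?_
    fun_prop

/-- A polynomially weighted exponential majorant of the terms on a bounded interval. -/
theorem exists_kerTerm_majorant : ∃ C : ℝ, 0 < C ∧ ∀ b : ℕ → ℂ,
    (∀ n : ℕ, ‖b n‖ ≤ 4 * n.divisors.card) → ∀ z : ℂ, ‖z‖ = 1 → 0 < z.re → z.im ≠ 0 →
    ∀ n : ℕ, ∀ R x : ℝ, 1 ≤ x → x ≤ R →
    ‖kerTerm b z n x‖ ≤ C * R * ((n : ℝ) ^ 2 * Real.exp (-(Real.pi / 4 * z.re) * n)) := by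
  obtain ⟨C, hC, hC'⟩ := exists_kerTermAmp_bound
  refine ⟨4 * C, by positivity, fun b hb z hz hre him n R x hx hxR => ?_⟩
  rcases Nat.eq_zero_or_pos n with rfl | hn
  · have : b 0 = 0 := by simpa using hb 0
    simp [kerTerm, this]
  have hn1 : (1 : ℝ) ≤ n := by exact_mod_cast hn
  rw [norm_kerTerm b him]
  refine (hC' b z hz hre n hn x hx).1.trans ?_
  have h1 : ‖b n‖ ≤ 4 * n := (hb n).trans (by gcongr; exact Nat.card_divisors_le_self n)
  have h2 : √(n * x) ≤ n * R := by
    have : 1 ≤ n * x := one_le_mul_of_one_le_of_one_le hn1 hx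
    calc √(n * x) ≤ n * x := by
          rw [Real.sqrt_le_left (by linarith)]
          nlinarith
      _ ≤ _ := by gcongr
  have h3 : Real.exp (-(Real.pi / 4 * n * z.re * x)) ≤ Real.exp (-(Real.pi / 4 * z.re) * n) := by
    apply Real.exp_le_exp.mpr
    have : 0 ≤ Real.pi / 4 * z.re * n := by have := Real.pi_pos; positivity
    nlinarith
  have hR : 0 ≤ R := by linarith
  calc _ ≤ C * (4 * n) * (n * R) * Real.exp (-(Real.pi / 4 * z.re) * n) := by gcongr
    _ = _ := by ring

theorem summable_sq_mul_exp_neg {c : ℝ} (hc : 0 < c) (D : ℝ) :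
    Summable fun n : ℕ => D * ((n : ℝ) ^ 2 * Real.exp (-c * n)) :=
  (Real.summable_pow_mul_exp_neg_nat_mul 2 hc).mul_left D

theorem continuousOn_tsum_kerTerm (b : ℕ → ℂ) (hb : ∀ n : ℕ, ‖b n‖ ≤ 4 * n.divisors.card) {z : ℂ}
    (hz : ‖z‖ = 1) (hre : 0 < z.re) (him : z.im ≠ 0) (R : ℝ) :
    ContinuousOn (fun x => ∑' n, kerTerm b z n x) (Set.Icc 1 R) := by
  obtain ⟨C, hC, hC'⟩ := exists_kerTerm_majorant
  have hb0 : b 0 = 0 := by simpa using hb 0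
  refine continuousOn_tsum (fun n => (continuousOn_kerTerm b hb0 hre him n).mono ?_)
    (summable_sq_mul_exp_neg (c := Real.pi / 4 * z.re) (by have := Real.pi_pos; positivity) (C * R))
    (fun n x hx => hC' b hb z hz hre him n R x hx.1 hx.2)
  intro x hx
  exact lt_of_lt_of_le one_pos hx.1

theorem exists_integral_kerTerm_block_le : ∃ C : ℝ, 0 < C ∧ ∀ b : ℕ → ℂ,
    (∀ n : ℕ, ‖b n‖ ≤ 4 * n.divisors.card) → ∀ δ : ℝ, 0 < δ → ∀ z : ℂ, ‖z‖ = 1 →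
    2 * δ / Real.pi ≤ z.re → 1 / 2 ≤ z.im → ∀ j N : ℕ,
    ∫ x in (1 + j * (4 / z.im))..(1 + j * (4 / z.im) + 4 / z.im),
      ‖∑ n ∈ Finset.range N, kerTerm b z n x‖ ^ 2 ≤
    C * ∑ n ∈ Finset.range N, (n.divisors.card : ℝ) ^ 2 *
      (n * (j + 1) * Real.exp (-(n * δ * (j + 1)))) := by
  obtain ⟨C, hC, hC'⟩ := exists_kerTermAmp_bound
  refine ⟨1040 * (144 * C ^ 2), by positivity, fun b hb δ hδ z hz hre him j N => ?_⟩
  have hb0 : b 0 = 0 := by simpa using hb 0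
  have hpi := Real.pi_pos
  have hre0 : 0 < z.re := lt_of_lt_of_le (by positivity) hre
  have him0 : 0 < z.im := by linarith
  have him1 : z.im ≤ 1 := hz ▸ Complex.im_le_norm z
  set P := 4 / z.im with hP
  have hP4 : 4 ≤ P := by rw [hP, le_div_iff₀ him0]; linarith
  have hP8 : P ≤ 8 := by rw [hP, div_le_iff₀ him0]; linarith
  have hj : (0 : ℝ) ≤ j := by positivity
  set X := 1 + j * P with hX
  have hX1 : (j : ℝ) + 1 ≤ X := by rw [hX]; nlinarith
  have hX9 : X + P ≤ 9 * (j + 1) := by rw [hX]; nlinarith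
  set B : ℕ → ℝ := fun n => C * ‖b n‖ * √(n * (X + P)) * Real.exp (-(Real.pi / 4 * n * z.re * X))
    with hB
  have key : ∀ n : ℕ, ∀ x ∈ Set.Icc X (X + P),
      C * ‖b n‖ * √(n * x) * Real.exp (-(Real.pi / 4 * n * z.re * x)) ≤ B n := by
    intro n x hx
    rw [hB]
    obtain ⟨hx1, hx2⟩ := hx
    dsimp only
    gcongr
  have hpos : ∀ n ∈ (Finset.range N).erase 0, 0 < n := by
    intro n hn
    exact Nat.pos_of_ne_zero (Finset.ne_of_mem_erase hn)
  have h1 : ∀ x ∈ Set.Icc X (X + P), 1 ≤ x := fun x hx => by linarith [hx.1]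
  have hmain := integral_norm_sq_sum_le (P := P) (by linarith) X ((Finset.range N).erase 0)
    (kerTermAmp b z) (kerTermAmpDeriv b z) B
    (fun n hn x hx => hasDerivAt_kerTermAmp b hre0 (hpos n hn) (by linarith [h1 x hx]))
    (fun n hn x hx => (continuousAt_kerTermAmpDeriv b hre0 (hpos n hn)
      (by linarith [h1 x hx])).continuousWithinAt)
    (fun n hn x hx => (hC' b z hz hre0 n (hpos n hn) x (h1 x hx)).1.trans (key n x hx))
    (fun n hn x hx => (hC' b z hz hre0 n (hpos n hn) x (h1 x hx)).2.trans (key n x hx))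
  have heq : ∀ x : ℝ, ∑ n ∈ (Finset.range N).erase 0, kerTermAmp b z n x *
      Complex.exp (-(2 * Real.pi * Complex.I * n / P * x)) =
      ∑ n ∈ Finset.range N, kerTerm b z n x := by
    intro x
    rw [← Finset.sum_erase (s := Finset.range N) (a := 0) (f := fun n => kerTerm b z n x)
      (by simp [kerTerm, hb0])]
    exact Finset.sum_congr rfl fun n _ => (kerTerm_eq b him0.ne' n x).symm
  simp only [heq] at hmain
  refine hmain.trans ?_
  have hBn : ∀ n : ℕ, B n ^ 2 ≤ 144 * C ^ 2 * ((n.divisors.card : ℝ) ^ 2 *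
      (n * (j + 1) * Real.exp (-(n * δ * (j + 1))))) := by
    intro n
    have e1 : B n ^ 2 = C ^ 2 * ‖b n‖ ^ 2 * (n * (X + P)) *
        Real.exp (-(Real.pi / 2 * n * z.re * X)) := by
      rw [hB]
      dsimp only
      rw [mul_pow, mul_pow, mul_pow, Real.sq_sqrt (by positivity), ← Real.exp_nat_mul]
      congr 2
      push_cast
      ring
    have e2 : Real.exp (-(Real.pi / 2 * n * z.re * X)) ≤ Real.exp (-(n * δ * (j + 1))) := by
      apply Real.exp_le_exp.mpr
      have a1 : δ ≤ Real.pi / 2 * z.re := by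
        rw [div_le_iff₀ hpi] at hre; linarith
      have a2 : δ * (j + 1) ≤ Real.pi / 2 * z.re * X := by gcongr
      have a3 := mul_le_mul_of_nonneg_left a2 (Nat.cast_nonneg (α := ℝ) n)
      linarith
    have e3 : ‖b n‖ ^ 2 ≤ (4 * (n.divisors.card : ℝ)) ^ 2 := by
      gcongr; exact hb n
    rw [e1]
    calc _ ≤ C ^ 2 * (4 * (n.divisors.card : ℝ)) ^ 2 * (n * (9 * (j + 1))) *
          Real.exp (-(n * δ * (j + 1))) := by gcongr
      _ = _ := by ring
  have hP3 : 2 * P + 2 * P ^ 3 ≤ 1040 := by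
    have : P ^ 3 ≤ 8 ^ 3 := by gcongr
    linarith
  have hsum : ∑ n ∈ (Finset.range N).erase 0, B n ^ 2 ≤ ∑ n ∈ Finset.range N, 144 * C ^ 2 *
      ((n.divisors.card : ℝ) ^ 2 * (n * (j + 1) * Real.exp (-(n * δ * (j + 1))))) := by
    calc _ ≤ ∑ n ∈ Finset.range N, B n ^ 2 :=
          Finset.sum_le_sum_of_subset_of_nonneg (Finset.erase_subset _ _) fun _ _ _ => sq_nonneg _
      _ ≤ _ := Finset.sum_le_sum fun n _ => hBn n
  rw [← Finset.mul_sum] at hsum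
  calc _ ≤ 1040 * (144 * C ^ 2 * ∑ n ∈ Finset.range N,
      ((n.divisors.card : ℝ) ^ 2 * (n * (j + 1) * Real.exp (-(n * δ * (j + 1)))))) :=
        mul_le_mul hP3 hsum (Finset.sum_nonneg fun _ _ => sq_nonneg _) (by norm_num)
    _ = _ := by ring

theorem tendsto_integral_kerTerm (b : ℕ → ℂ) (hb : ∀ n : ℕ, ‖b n‖ ≤ 4 * n.divisors.card) {z : ℂ}
    (hz : ‖z‖ = 1) (hre : 0 < z.re) (him : z.im ≠ 0) {X Y : ℝ} (hX : 1 ≤ X) (hXY : X ≤ Y) :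
    Filter.Tendsto (fun N : ℕ => ∫ x in X..Y, ‖∑ n ∈ Finset.range N, kerTerm b z n x‖ ^ 2)
      Filter.atTop (nhds (∫ x in X..Y, ‖∑' n, kerTerm b z n x‖ ^ 2)) := by
  obtain ⟨C, hC, hC'⟩ := exists_kerTerm_majorant
  have hb0 : b 0 = 0 := by simpa using hb 0
  set u : ℕ → ℝ := fun n => C * Y * ((n : ℝ) ^ 2 * Real.exp (-(Real.pi / 4 * z.re) * n)) with hu
  have hus : Summable u := summable_sq_mul_exp_neg (by have := Real.pi_pos; positivity) _
  have hub : ∀ n : ℕ, ∀ x ∈ Set.Icc X Y, ‖kerTerm b z n x‖ ≤ u n := fun n x hx =>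
    hC' b hb z hz hre him n Y x (hX.trans hx.1) hx.2
  have hu0 : ∀ n, 0 ≤ u n := fun n => (norm_nonneg _).trans (hub n Y ⟨hXY, le_rfl⟩)
  refine intervalIntegral.tendsto_integral_filter_of_dominated_convergence
    (fun _ => (∑' n, u n) ^ 2) ?_ ?_ ?_ ?_
  · refine Filter.Eventually.of_forall fun N => ContinuousOn.aestronglyMeasurable ?_
      measurableSet_uIoc
    refine ContinuousOn.pow (ContinuousOn.norm (continuousOn_finsetSum _ fun n _ =>
      (continuousOn_kerTerm b hb0 hre him n).mono ?_)) 2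
    intro x hx
    rw [Set.uIoc_of_le hXY] at hx
    exact lt_of_lt_of_le one_pos (hX.trans hx.1.le)
  · refine Filter.Eventually.of_forall fun N => Filter.Eventually.of_forall fun x hx => ?_
    rw [Set.uIoc_of_le hXY] at hx
    rw [norm_pow, norm_norm]
    gcongr
    calc _ ≤ ∑ n ∈ Finset.range N, u n :=
          norm_sum_le_of_le _ fun n _ => hub n x ⟨hx.1.le, hx.2⟩
      _ ≤ _ := hus.sum_le_tsum _ fun n _ => hu0 n
  · exact intervalIntegrable_const
  · refine Filter.Eventually.of_forall fun x hx => ?_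
    rw [Set.uIoc_of_le hXY] at hx
    have : Summable fun n => kerTerm b z n x :=
      Summable.of_norm_bounded hus fun n => hub n x ⟨hx.1.le, hx.2⟩
    exact (this.hasSum.tendsto_sum_nat.norm).pow 2

theorem exists_integral_kerTerm_le : ∃ C : ℝ, 0 < C ∧ ∀ b : ℕ → ℂ,
    (∀ n : ℕ, ‖b n‖ ≤ 4 * n.divisors.card) → ∀ δ : ℝ, 0 < δ → δ ≤ 1 / 2 → ∀ z : ℂ, ‖z‖ = 1 →
    2 * δ / Real.pi ≤ z.re → 1 / 2 ≤ z.im →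
    IntegrableOn (fun x => ‖∑' n, kerTerm b z n x‖ ^ 2) (Set.Ioi 1) ∧
    ∫ x in Set.Ioi 1, ‖∑' n, kerTerm b z n x‖ ^ 2 ≤
      C * (δ ^ 2)⁻¹ * Real.log (1 / δ) ^ 4 := by
  obtain ⟨C₁, hC₁, h₁⟩ := exists_integral_kerTerm_block_le
  obtain ⟨C₂, hC₂, h₂⟩ := exists_divisor_sum_bound
  refine ⟨C₁ * C₂, by positivity, fun b hb δ hδ hδ2 z hz hre him => ?_⟩
  obtain ⟨hs, hsum⟩ := h₂ δ hδ hδ2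
  have hpi := Real.pi_pos
  have hre0 : 0 < z.re := lt_of_lt_of_le (by positivity) hre
  have him0 : 0 < z.im := by linarith
  set F : ℝ → ℝ := fun x => ‖∑' n, kerTerm b z n x‖ ^ 2 with hF
  set P := 4 / z.im with hP
  have hP0 : 0 < P := by positivity
  have hFc : ∀ R, ContinuousOn F (Set.Icc 1 R) := fun R =>
    (continuousOn_tsum_kerTerm b hb hz hre0 him0.ne' R).norm.pow 2
  set a : ℕ → ℝ := fun j => 1 + j * P with ha
  have ha1 : ∀ j, 1 ≤ a j := fun j => by
    have : 0 ≤ j * P := by positivity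
    simp only [ha]; linarith
  have hblock : ∀ j : ℕ, ∫ x in a j..a (j + 1), F x ≤ C₁ * ∑' n : ℕ, (n.divisors.card : ℝ) ^ 2 *
      (n * (j + 1) * Real.exp (-(n * δ * (j + 1)))) := by
    intro j
    have e : a (j + 1) = 1 + j * P + P := by simp only [ha]; push_cast; ring
    rw [e]
    refine le_of_tendsto (tendsto_integral_kerTerm b hb hz hre0 him0.ne' (ha1 j)
      (by simp only [ha]; linarith)) (Filter.Eventually.of_forall fun N => ?_)
    refine (h₁ b hb δ hδ z hz hre him j N).trans ?_
    gcongr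
    exact (hs j).sum_le_tsum _ fun n _ => by positivity
  have h_int : ∀ R R', 1 ≤ R → 1 ≤ R' → IntervalIntegrable F volume R R' := fun R R' h h' => by
    refine ((hFc (max R R')).mono ?_).intervalIntegrable
    intro x hx
    rw [Set.mem_uIcc] at hx
    rcases hx with hx | hx
    · exact ⟨h.trans hx.1, hx.2.trans (le_max_right _ _)⟩
    · exact ⟨h'.trans hx.1, hx.2.trans (le_max_left _ _)⟩
  have htot : ∀ J : ℕ, ∫ x in (1 : ℝ)..a J, F x ≤ C₁ * C₂ * (δ ^ 2)⁻¹ * Real.log (1 / δ) ^ 4 := by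
    intro J
    have e0 : a 0 = 1 := by simp [ha]
    have := intervalIntegral.sum_integral_adjacent_intervals (f := F) (μ := volume) (a := a) (n := J)
      (fun k _ => h_int _ _ (ha1 k) (ha1 (k + 1)))
    rw [e0] at this
    rw [← this]
    calc _ ≤ ∑ j ∈ Finset.range J, C₁ * ∑' n : ℕ, (n.divisors.card : ℝ) ^ 2 *
          (n * (j + 1) * Real.exp (-(n * δ * (j + 1)))) := Finset.sum_le_sum fun j _ => hblock j
      _ ≤ C₁ * (C₂ * (δ ^ 2)⁻¹ * Real.log (1 / δ) ^ 4) := by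
        rw [← Finset.mul_sum]
        gcongr
        exact hsum J
      _ = _ := by ring
  have hat : Filter.Tendsto a Filter.atTop Filter.atTop :=
    Filter.tendsto_atTop_add_const_left _ _
      (Filter.Tendsto.atTop_mul_const hP0 tendsto_natCast_atTop_atTop)
  have hI : IntegrableOn F (Set.Ioi 1) := by
    refine integrableOn_Ioi_of_intervalIntegral_norm_bounded
      (C₁ * C₂ * (δ ^ 2)⁻¹ * Real.log (1 / δ) ^ 4) 1 (fun J => ?_) hat
      (Filter.Eventually.of_forall fun J => ?_)
    · exact (h_int 1 (a J) le_rfl (ha1 J)).1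
    · refine le_trans (le_of_eq ?_) (htot J)
      refine intervalIntegral.integral_congr fun x _ => ?_
      simp [hF]
  exact ⟨hI, le_of_tendsto (intervalIntegral_tendsto_integral_Ioi 1 hI hat)
    (Filter.Eventually.of_forall htot)⟩

/-- The coefficients of `-(1 - 2⁻ˢ)(1 - 2 * 2⁻ˢ) * ζ(s)`. -/
def thetaCoeff (n : ℕ) : ℂ :=
  3 * (if 2 ∣ n then 1 else 0) - 2 * (if 4 ∣ n then 1 else 0) - 1

theorem thetaCoeff_zero : thetaCoeff 0 = 0 := by norm_num [thetaCoeff]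

theorem conj_thetaCoeff (n : ℕ) : (starRingEnd ℂ) (thetaCoeff n) = thetaCoeff n := by
  unfold thetaCoeff
  split_ifs <;> simp [map_ofNat]

theorem norm_thetaCoeff_le (n : ℕ) : ‖thetaCoeff n‖ ≤ 2 := by
  unfold thetaCoeff
  by_cases h4 : 4 ∣ n
  · have h2 : 2 ∣ n := dvd_trans (by norm_num) h4
    norm_num [h4, h2]
  · split_ifs <;> norm_num

theorem hasSum_ite_dvd {k : ℕ} (hk : k ≠ 0) {f : ℕ → ℂ} {A : ℂ}
    (h : HasSum (fun n => f (k * n)) A) : HasSum (fun n => (if k ∣ n then 1 else 0) * f n) A := by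
  have hinj : Function.Injective fun n : ℕ => k * n := fun a b hab =>
    Nat.eq_of_mul_eq_mul_left (Nat.pos_of_ne_zero hk) hab
  rw [← hinj.hasSum_iff]
  · convert! h using 2 with n
    simp
  · intro n hn
    have : ¬ k ∣ n := fun ⟨m, hm⟩ => hn ⟨m, hm.symm⟩
    simp [this]

theorem hasSum_thetaCoeff_mul {f : ℕ → ℂ} {A B D : ℂ} (hA : HasSum (fun n => f (2 * n)) A)
    (hB : HasSum (fun n => f (4 * n)) B) (hD : HasSum f D) :
    HasSum (fun n => thetaCoeff n * f n) (3 * A - 2 * B - D) := by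
  have h2 := (hasSum_ite_dvd (by norm_num) hA).mul_left 3
  have h4 := (hasSum_ite_dvd (by norm_num) hB).mul_left 2
  convert! (h2.sub h4).sub hD using 2 with n
  unfold thetaCoeff
  ring

/-- The theta series attached to `thetaCoeff`. -/
noncomputable def altTheta (z : ℂ) : ℂ :=
  ∑' n : ℕ, thetaCoeff n * Complex.exp (-(Real.pi / 4 * ((n : ℂ) ^ 2 * z)))

theorem hasSum_exp_sq {z : ℂ} (hz : 0 < z.re) :
    HasSum (fun n : ℕ => Complex.exp (-(Real.pi * ((n : ℂ) ^ 2 * z))))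
      ((jacobiTheta (Complex.I * z) + 1) / 2) := by
  have h := hasSum_nat_jacobiTheta (τ := Complex.I * z) (by simpa using hz)
  rw [← hasSum_nat_add_iff' 1]
  convert! h using 1
  · funext n
    congr 1
    push_cast
    linear_combination (Real.pi * ((n : ℂ) + 1) ^ 2 * z) * (-Complex.I_mul_I)
  · simp
    ring

theorem hasSum_altTheta {z : ℂ} (hz : 0 < z.re) :
    HasSum (fun n : ℕ => thetaCoeff n * Complex.exp (-(Real.pi / 4 * ((n : ℂ) ^ 2 * z))))
      ((3 * jacobiTheta (Complex.I * z) - 2 * jacobiTheta (Complex.I * (4 * z)) -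
        jacobiTheta (Complex.I * (z / 4))) / 2) := by
  have h1 := hasSum_exp_sq hz
  have h2 := hasSum_exp_sq (z := 4 * z) (by simpa using hz)
  have h3 := hasSum_exp_sq (z := z / 4) (by simpa using hz)
  convert! hasSum_thetaCoeff_mul
    (f := fun n : ℕ => Complex.exp (-(Real.pi / 4 * ((n : ℂ) ^ 2 * z)))) ?_ ?_ ?_ using 1
  rotate_left 4
  · convert! h1 using 3 with n
    push_cast; ring
  · convert! h2 using 3 with n
    push_cast; ring
  · convert! h3 using 3 with n
    ring
  · ring

theorem jacobiTheta_inv {z : ℂ} (hz : z ≠ 0) :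
    jacobiTheta (Complex.I * z⁻¹) = z ^ (1 / 2 : ℂ) * jacobiTheta (Complex.I * z) := by
  have h := jacobiTheta₂_functional_equation 0 (Complex.I * z)
  have e1 : -Complex.I * (Complex.I * z) = z := by
    linear_combination (-z) * Complex.I_mul_I
  have e2 : -1 / (Complex.I * z) = Complex.I * z⁻¹ := by
    field_simp
    rw [Complex.I_sq]
  rw [e1, e2] at h
  simp only [← jacobiTheta_eq_jacobiTheta₂, zero_div] at h
  rw [h]
  have : z ^ (1 / 2 : ℂ) ≠ 0 := by simp [Complex.cpow_eq_zero_iff, hz]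
  field_simp
  simp

theorem altTheta_inv {z : ℂ} (hz : 0 < z.re) :
    altTheta z⁻¹ = z ^ (1 / 2 : ℂ) * altTheta z := by
  have hz0 : z ≠ 0 := by rintro rfl; simp at hz
  have hi : 0 < (z⁻¹).re := by
    rw [Complex.inv_re]
    have := Complex.normSq_pos.mpr hz0
    positivity
  have h4 : ((4 : ℂ)) ^ (1 / 2 : ℂ) = 2 := by
    rw [show (4 : ℂ) = (((2 : ℝ) ^ (2 : ℝ) : ℝ) : ℂ) by norm_num,
      show (1 / 2 : ℂ) = ((1 / 2 : ℝ) : ℂ) by norm_num, ← Complex.ofReal_cpow (by norm_num),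
      ← Real.rpow_mul (by norm_num)]
    norm_num
  have hq : (4 * (z / 4)) ^ (1 / 2 : ℂ) = (4 : ℂ) ^ (1 / 2 : ℂ) * (z / 4) ^ (1 / 2 : ℂ) := by
    rw [Complex.cpow_def_of_ne_zero (by simpa using hz0), Complex.cpow_def_of_ne_zero (by norm_num),
      Complex.cpow_def_of_ne_zero (by simpa using hz0), ← Complex.exp_add]
    have hl := Complex.log_ofReal_mul (r := 4) (by norm_num) (x := z / 4) (by simpa using hz0)
    have hl4 := Complex.ofReal_log (x := 4) (by norm_num)
    push_cast at hl hl4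
    rw [hl, hl4]
    ring_nf
  have hq2 : (4 * z) ^ (1 / 2 : ℂ) = (4 : ℂ) ^ (1 / 2 : ℂ) * z ^ (1 / 2 : ℂ) := by
    rw [Complex.cpow_def_of_ne_zero (by simpa using hz0), Complex.cpow_def_of_ne_zero (by norm_num),
      Complex.cpow_def_of_ne_zero (by simpa using hz0), ← Complex.exp_add]
    have hl := Complex.log_ofReal_mul (r := 4) (by norm_num) (x := z) (by simpa using hz0)
    have hl4 := Complex.ofReal_log (x := 4) (by norm_num)
    push_cast at hl hl4
    rw [hl, hl4]
    ring_nf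
  rw [mul_div_cancel₀ _ (by norm_num), h4] at hq
  rw [h4] at hq2
  have a1 := jacobiTheta_inv hz0
  have a2 := jacobiTheta_inv (z := z / 4) (by simpa using hz0)
  have a3 := jacobiTheta_inv (z := 4 * z) (by simpa using hz0)
  rw [show (z / 4)⁻¹ = 4 * z⁻¹ by field_simp] at a2
  rw [show (4 * z)⁻¹ = z⁻¹ / 4 by field_simp] at a3
  unfold altTheta
  rw [(hasSum_altTheta hz).tsum_eq, (hasSum_altTheta hi).tsum_eq, a1, a2, a3, hq2, hq]
  ring

theorem altTheta_conj (z : ℂ) : altTheta ((starRingEnd ℂ) z) = (starRingEnd ℂ) (altTheta z) := by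
  unfold altTheta
  rw [Complex.conj_tsum]
  refine tsum_congr fun n => ?_
  rw [map_mul, conj_thetaCoeff, ← Complex.exp_conj]
  simp [map_ofNat]

theorem norm_exp_sq (n : ℕ) (z : ℂ) :
    ‖Complex.exp (-(Real.pi / 4 * ((n : ℂ) ^ 2 * z)))‖ =
      Real.exp (-(Real.pi / 4 * ((n : ℝ) ^ 2 * z.re))) := by
  rw [Complex.norm_exp]
  congr 1
  have : (-(Real.pi / 4 * ((n : ℂ) ^ 2 * z)) : ℂ) = ((-(Real.pi / 4 * (n : ℝ) ^ 2) : ℝ) : ℂ) * z := by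
    push_cast; ring
  rw [this, Complex.re_ofReal_mul]
  ring

/-- Exponential decay of `altTheta` away from the imaginary axis. -/
theorem norm_altTheta_le {m : ℝ} (hm : 0 < m) : ∃ C : ℝ, 0 < C ∧ ∀ z : ℂ, m ≤ z.re →
    ‖altTheta z‖ ≤ C * Real.exp (-(Real.pi / 8 * z.re)) := by
  have hpi := Real.pi_pos
  have hs : Summable fun n : ℕ => 2 * Real.exp (n * (-(Real.pi / 8 * m))) :=
    (Real.summable_exp_nat_mul_iff.mpr (by
      have : 0 < Real.pi / 8 * m := by positivity
      linarith)).mul_left 2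
  refine ⟨∑' n : ℕ, 2 * Real.exp (n * (-(Real.pi / 8 * m))), ?_, fun z hz => ?_⟩
  · exact hs.tsum_pos (fun n => by positivity) 0 (by positivity)
  · unfold altTheta
    rw [← tsum_mul_right]
    refine tsum_of_norm_bounded (hs.mul_right _).hasSum fun n => ?_
    rcases Nat.eq_zero_or_pos n with rfl | hn
    · simp only [thetaCoeff_zero, zero_mul, norm_zero]
      positivity
    · have hn1 : (1 : ℝ) ≤ n := by exact_mod_cast hn
      have hz0 : 0 < z.re := by linarith
      rw [norm_mul, norm_exp_sq, mul_assoc, ← Real.exp_add]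
      refine mul_le_mul (norm_thetaCoeff_le n) (Real.exp_le_exp.mpr ?_) (by positivity)
        (by norm_num)
      have h1 : (n : ℝ) * m + z.re ≤ 2 * (n ^ 2 * z.re) := by
        have : n * m ≤ n * z.re := by gcongr
        have h2 : n * z.re ≤ n ^ 2 * z.re := by
          gcongr; nlinarith
        have h3 : z.re ≤ n * z.re := by nlinarith
        linarith
      have h4 := mul_le_mul_of_nonneg_left h1 (show 0 ≤ Real.pi / 8 by positivity)
      linarith

theorem continuousAt_altTheta {z : ℂ} (hz : 0 < z.re) : ContinuousAt altTheta z := by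
  have h : ∀ w : ℂ, 0 < w.re → ContinuousAt (fun w => jacobiTheta (Complex.I * w)) w := by
    intro w hw
    exact ContinuousAt.comp (g := jacobiTheta) (f := fun w => Complex.I * w)
      (continuousAt_jacobiTheta (by simpa using hw)) (by fun_prop)
  have h1 := h z hz
  have h2 : ContinuousAt (fun z => jacobiTheta (Complex.I * (4 * z))) z :=
    ContinuousAt.comp (g := fun w => jacobiTheta (Complex.I * w)) (f := fun z : ℂ => 4 * z)
      (h _ (by simpa using hz)) (by fun_prop)
  have h3 : ContinuousAt (fun z => jacobiTheta (Complex.I * (z / 4))) z :=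
    ContinuousAt.comp (g := fun w => jacobiTheta (Complex.I * w)) (f := fun z : ℂ => z / 4)
      (h _ (by simpa using hz)) (by fun_prop)
  have : (fun z => (3 * jacobiTheta (Complex.I * z) - 2 * jacobiTheta (Complex.I * (4 * z)) -
        jacobiTheta (Complex.I * (z / 4))) / 2) =ᶠ[nhds z] altTheta := by
    filter_upwards [(isOpen_lt continuous_const Complex.continuous_re).mem_nhds hz] with w hw
    exact (hasSum_altTheta hw).tsum_eq.symm
  refine ContinuousAt.congr ?_ this
  fun_prop

theorem integrableOn_rpow_mul_exp_neg {σ m : ℝ} (hσ : 0 < σ) (hm : 0 < m) :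
    IntegrableOn (fun t : ℝ => t ^ (σ - 1) * Real.exp (-(m * t))) (Set.Ioi 0) := by
  have := integrableOn_rpow_mul_exp_neg_mul_rpow (s := σ - 1) (p := 1) (b := m) (by linarith)
    one_pos hm
  refine this.congr_fun (fun t _ => ?_) measurableSet_Ioi
  simp

theorem norm_exp_neg_mul_ofReal (r : ℂ) (t : ℝ) :
    ‖Complex.exp (-(r * t))‖ = Real.exp (-(r.re * t)) := by
  rw [Complex.norm_exp]; congr 1; simp

theorem norm_cpow_mul_exp {a r : ℂ} {t : ℝ} (ht : 0 < t) :
    ‖(t : ℂ) ^ (a - 1) * Complex.exp (-(r * t))‖ = t ^ (a.re - 1) * Real.exp (-(r.re * t)) := by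
  rw [norm_mul, Complex.norm_cpow_eq_rpow_re_of_pos ht, norm_exp_neg_mul_ofReal]
  simp

theorem continuousOn_cpow_mul_exp (a r : ℂ) :
    ContinuousOn (fun t : ℝ => (t : ℂ) ^ (a - 1) * Complex.exp (-(r * t))) (Set.Ioi 0) := by
  intro t ht
  refine ContinuousAt.continuousWithinAt ?_
  have : ContinuousAt (fun t : ℝ => (t : ℂ) ^ (a - 1)) t :=
    ContinuousAt.cpow (by fun_prop) (by fun_prop) (Or.inl (by simpa using ht))
  fun_prop

theorem integrableOn_cpow_mul_exp {a r : ℂ} (ha : 0 < a.re) (hr : 0 < r.re) :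
    IntegrableOn (fun t : ℝ => (t : ℂ) ^ (a - 1) * Complex.exp (-(r * t))) (Set.Ioi 0) := by
  refine (integrableOn_rpow_mul_exp_neg ha hr).mono'
    ((continuousOn_cpow_mul_exp a r).aestronglyMeasurable measurableSet_Ioi) ?_
  filter_upwards [ae_restrict_mem measurableSet_Ioi] with t ht
  exact (norm_cpow_mul_exp ht).le

theorem hasDerivAt_integral_cpow_mul_exp {a r : ℂ} (ha : 0 < a.re) (hr : 0 < r.re) :
    DifferentiableAt ℂ (fun r : ℂ => ∫ t in Set.Ioi (0 : ℝ),
      (t : ℂ) ^ (a - 1) * Complex.exp (-(r * t))) r := by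
  have hm : 0 < r.re / 2 := by linarith
  refine (hasDerivAt_integral_of_dominated_loc_of_deriv_le
    (s := {w : ℂ | r.re / 2 < w.re})
    (bound := fun t => t ^ (a.re + 1 - 1) * Real.exp (-(r.re / 2 * t)))
    (F' := fun (w : ℂ) (t : ℝ) => (t : ℂ) ^ (a - 1) * (Complex.exp (-(w * t)) * -(t : ℂ)))
    ?_ ?_ ?_ ?_ ?_ ?_ ?_).2.differentiableAt
  · exact (isOpen_lt continuous_const Complex.continuous_re).mem_nhds (by
      change r.re / 2 < r.re; linarith)
  · exact Filter.Eventually.of_forall fun w =>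
      (continuousOn_cpow_mul_exp a w).aestronglyMeasurable measurableSet_Ioi
  · exact integrableOn_cpow_mul_exp ha hr
  · have : (fun t : ℝ => (t : ℂ) ^ (a - 1) * (Complex.exp (-(r * t)) * -(t : ℂ))) =
        fun t : ℝ => ((t : ℂ) ^ (a - 1) * Complex.exp (-(r * t))) * -(t : ℂ) := by
      funext t; ring
    rw [this]
    exact ((continuousOn_cpow_mul_exp a r).mul (by fun_prop)).aestronglyMeasurable
      measurableSet_Ioi
  · filter_upwards [ae_restrict_mem measurableSet_Ioi] with t ht w hw
    have ht' : 0 < t := ht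
    rw [← mul_assoc, norm_mul, norm_cpow_mul_exp ht', norm_neg, Complex.norm_real,
      Real.norm_of_nonneg ht'.le]
    have e : t ^ (a.re + 1 - 1) = t ^ (a.re - 1) * t := by
      nth_rewrite 3 [← Real.rpow_one t]
      rw [← Real.rpow_add ht']
      congr 1; ring
    rw [e]
    have : Real.exp (-(w.re * t)) ≤ Real.exp (-(r.re / 2 * t)) := by
      apply Real.exp_le_exp.mpr
      have := mul_le_mul_of_nonneg_right (le_of_lt (show r.re / 2 < w.re from hw)) ht'.le
      linarith
    calc _ ≤ t ^ (a.re - 1) * Real.exp (-(r.re / 2 * t)) * t := by gcongr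
      _ = _ := by ring
  · exact integrableOn_rpow_mul_exp_neg (by linarith) hm
  · filter_upwards with t w hw
    have h1 : HasDerivAt (fun w : ℂ => -(w * t)) (-(t : ℂ)) w := by
      have h0 := ((hasDerivAt_id w).mul_const (t : ℂ)).neg
      rw [one_mul] at h0
      exact h0
    exact h1.cexp.const_mul _

/-- The Gamma integral along a rotated ray. -/
theorem integral_cpow_mul_exp_neg {a r : ℂ} (ha : 0 < a.re) (hr : 0 < r.re) :
    ∫ t in Set.Ioi (0 : ℝ), (t : ℂ) ^ (a - 1) * Complex.exp (-(r * t)) =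
      r ^ (-a) * Complex.Gamma a := by
  have hopen : IsOpen {w : ℂ | 0 < w.re} := isOpen_lt continuous_const Complex.continuous_re
  have hpre : IsPreconnected {w : ℂ | 0 < w.re} := (convex_halfSpace_re_gt 0).isPreconnected
  have h1 : AnalyticOnNhd ℂ (fun r : ℂ => ∫ t in Set.Ioi (0 : ℝ),
      (t : ℂ) ^ (a - 1) * Complex.exp (-(r * t))) {w : ℂ | 0 < w.re} :=
    DifferentiableOn.analyticOnNhd (fun w hw =>
      (hasDerivAt_integral_cpow_mul_exp ha hw).differentiableWithinAt) hopen
  have h2 : AnalyticOnNhd ℂ (fun r : ℂ => r ^ (-a) * Complex.Gamma a) {w : ℂ | 0 < w.re} :=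
    DifferentiableOn.analyticOnNhd (fun w hw => by
      have hw' : w ∈ Complex.slitPlane := Or.inl hw
      exact ((differentiableAt_id.cpow_const hw').mul_const _).differentiableWithinAt) hopen
  refine h1.eqOn_of_preconnected_of_frequently_eq h2 hpre (z₀ := 1) (by simp) ?_ hr
  have hf : Filter.Tendsto (fun x : ℝ => (x : ℂ)) (nhdsWithin 1 {1}ᶜ) (nhdsWithin 1 {1}ᶜ) := by
    refine tendsto_nhdsWithin_of_tendsto_nhds_of_eventually_within _ ?_ ?_
    · have : ContinuousAt (fun x : ℝ => (x : ℂ)) 1 := by fun_prop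
      simpa [ContinuousAt] using this.tendsto.mono_left nhdsWithin_le_nhds
    · filter_upwards [self_mem_nhdsWithin] with x hx
      simpa using hx
  refine hf.frequently (Filter.Eventually.frequently ?_)
  filter_upwards [nhdsWithin_le_nhds (lt_mem_nhds (zero_lt_one' ℝ))] with x hx
  rw [Complex.integral_cpow_mul_exp_neg_mul_Ioi ha hx, one_div, ← Complex.ofReal_inv,
    Complex.cpow_neg, Complex.ofReal_inv, Complex.inv_cpow]
  rw [Complex.arg_ofReal_of_nonneg hx.le]
  exact Real.pi_pos.ne

theorem hasSum_zeta {s : ℂ} (hs : 1 < s.re) :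
    HasSum (fun n : ℕ => (n : ℂ) ^ (-s)) (riemannZeta s) := by
  have h : Summable fun n : ℕ => 1 / (n : ℂ) ^ s := Complex.summable_one_div_nat_cpow.mpr hs
  rw [zeta_eq_tsum_one_div_nat_cpow hs]
  convert! h.hasSum using 2 with n
  rw [Complex.cpow_neg, one_div]

theorem hasSum_thetaCoeff_mul_cpow {s : ℂ} (hs : 1 < s.re) :
    HasSum (fun n : ℕ => thetaCoeff n * (n : ℂ) ^ (-s))
      ((3 * 2 ^ (-s) - 2 * 4 ^ (-s) - 1) * riemannZeta s) := by
  have h := hasSum_zeta hs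
  have e : (3 * 2 ^ (-s) - 2 * 4 ^ (-s) - 1) * riemannZeta s =
      3 * (2 ^ (-s) * riemannZeta s) - 2 * (4 ^ (-s) * riemannZeta s) - riemannZeta s := by ring
  rw [e]
  refine hasSum_thetaCoeff_mul ?_ ?_ h
  · convert! h.mul_left ((2 : ℂ) ^ (-s)) using 2 with n
    have := Complex.natCast_mul_natCast_cpow 2 n (-s)
    push_cast at this ⊢
    exact this
  · convert! h.mul_left ((4 : ℂ) ^ (-s)) using 2 with n
    have := Complex.natCast_mul_natCast_cpow 4 n (-s)
    push_cast at this ⊢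
    exact this

theorem cpow_natCast_sq_mul {n : ℕ} (hn : 0 < n) {w : ℂ} (hw : w ≠ 0) (s : ℂ) :
    ((n : ℂ) ^ 2 * w) ^ (-(s / 2)) = (n : ℂ) ^ (-s) * w ^ (-(s / 2)) := by
  have hn0 : (n : ℂ) ≠ 0 := by exact_mod_cast hn.ne'
  have hnr : (0 : ℝ) < n := by exact_mod_cast hn
  have hl := Complex.log_ofReal_mul (r := (n : ℝ) ^ 2) (by positivity) hw
  rw [Real.log_pow] at hl
  push_cast at hl
  rw [Complex.cpow_def_of_ne_zero (mul_ne_zero (pow_ne_zero 2 hn0) hw),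
    Complex.cpow_def_of_ne_zero hn0, Complex.cpow_def_of_ne_zero hw, hl, ← Complex.exp_add]
  ring_nf

theorem re_mul_ofReal' (z : ℂ) (x : ℝ) : (z * x).re = z.re * x := by simp

theorem mellin_altTheta_of_one_lt_re {z s : ℂ} (hz : 0 < z.re) (hs : 1 < s.re) :
    mellin (fun x : ℝ => altTheta (z * x)) (s / 2) =
      (Real.pi / 4 * z) ^ (-(s / 2)) * Complex.Gamma (s / 2) *
        ((3 * 2 ^ (-s) - 2 * 4 ^ (-s) - 1) * riemannZeta s) := by
  have hpi := Real.pi_pos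
  have hz0 : z ≠ 0 := by rintro rfl; simp at hz
  have hs2 : (s / 2).re = s.re / 2 := by simp
  have hsp : 0 < (s / 2).re := by rw [hs2]; linarith
  have hw0 : (Real.pi / 4 * z : ℂ) ≠ 0 := by
    have : (Real.pi : ℂ) ≠ 0 := by exact_mod_cast hpi.ne'
    simp [this, hz0]
  have hr : ∀ n : ℕ, ((n : ℂ) ^ 2 * (Real.pi / 4 * z)).re = (n : ℝ) ^ 2 * (Real.pi / 4 * z.re) := by
    intro n
    have : (n : ℂ) ^ 2 * (Real.pi / 4 * z) = (((n : ℝ) ^ 2 * (Real.pi / 4) : ℝ) : ℂ) * z := by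
      push_cast; ring
    rw [this, Complex.re_ofReal_mul]; ring
  have hrpos : ∀ n : ℕ, 0 < n → 0 < ((n : ℂ) ^ 2 * (Real.pi / 4 * z)).re := by
    intro n hn
    rw [hr]
    have : (0 : ℝ) < n := by exact_mod_cast hn
    positivity
  set F : ℕ → ℝ → ℂ := fun n t => thetaCoeff n *
    ((t : ℂ) ^ (s / 2 - 1) * Complex.exp (-((n : ℂ) ^ 2 * (Real.pi / 4 * z) * t))) with hF
  have hFint : ∀ n, IntegrableOn (F n) (Set.Ioi 0) := by
    intro n
    rcases Nat.eq_zero_or_pos n with rfl | hn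
    · simp [hF, thetaCoeff_zero]
    · exact (integrableOn_cpow_mul_exp hsp (hrpos n hn)).const_mul _
  have hFval : ∀ n, ∫ t in Set.Ioi (0 : ℝ), F n t = (Real.pi / 4 * z) ^ (-(s / 2)) *
      Complex.Gamma (s / 2) * (thetaCoeff n * (n : ℂ) ^ (-s)) := by
    intro n
    simp only [hF]
    rw [integral_const_mul]
    rcases Nat.eq_zero_or_pos n with rfl | hn
    · simp [thetaCoeff_zero]
    · rw [integral_cpow_mul_exp_neg hsp (hrpos n hn), cpow_natCast_sq_mul hn hw0]
      ring
  have hFnorm : ∀ n : ℕ, ∫ t in Set.Ioi (0 : ℝ), ‖F n t‖ ≤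
      2 * (Real.pi / 4 * z.re) ^ (-(s.re / 2)) * Real.Gamma (s.re / 2) * (n : ℝ) ^ (-s.re) := by
    intro n
    have hG : 0 < Real.Gamma (s.re / 2) := Real.Gamma_pos_of_pos (by linarith)
    rcases Nat.eq_zero_or_pos n with rfl | hn
    · simp only [hF, thetaCoeff_zero, zero_mul, norm_zero, integral_zero]
      positivity
    have hn0 : (0 : ℝ) < n := by exact_mod_cast hn
    have e1 : ∫ t in Set.Ioi (0 : ℝ), ‖F n t‖ = ‖thetaCoeff n‖ * ∫ t in Set.Ioi (0 : ℝ),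
        t ^ (s.re / 2 - 1) * Real.exp (-((n : ℝ) ^ 2 * (Real.pi / 4 * z.re) * t)) := by
      rw [← integral_const_mul]
      refine setIntegral_congr_fun measurableSet_Ioi fun t ht => ?_
      simp only [hF]
      rw [norm_mul, norm_cpow_mul_exp ht, hr, hs2]
    rw [e1, Real.integral_rpow_mul_exp_neg_mul_Ioi (by linarith) (by positivity)]
    have e2 : (1 / ((n : ℝ) ^ 2 * (Real.pi / 4 * z.re))) ^ (s.re / 2) =
        (Real.pi / 4 * z.re) ^ (-(s.re / 2)) * (n : ℝ) ^ (-s.re) := by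
      rw [one_div, Real.inv_rpow (by positivity), ← Real.rpow_neg (by positivity),
        Real.mul_rpow (by positivity) (by positivity), ← Real.rpow_natCast, ← Real.rpow_mul hn0.le]
      rw [mul_comm]
      congr 2
      push_cast; ring
    rw [e2]
    calc _ ≤ 2 * ((Real.pi / 4 * z.re) ^ (-(s.re / 2)) * (n : ℝ) ^ (-s.re) *
        Real.Gamma (s.re / 2)) := by
          gcongr
          exact norm_thetaCoeff_le n
      _ = _ := by ring
  have hsummable : Summable fun n => ∫ t in Set.Ioi (0 : ℝ), ‖F n t‖ :=
    Summable.of_nonneg_of_le (fun n => integral_nonneg fun _ => norm_nonneg _) hFnorm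
      ((Real.summable_nat_rpow.mpr (by linarith)).mul_left _)
  have hsum := hasSum_integral_of_summable_integral_norm hFint hsummable
  simp only [hFval] at hsum
  have h2 := (hasSum_thetaCoeff_mul_cpow hs).mul_left
    ((Real.pi / 4 * z) ^ (-(s / 2)) * Complex.Gamma (s / 2))
  rw [h2.unique hsum, mellin]
  refine setIntegral_congr_fun measurableSet_Ioi fun t ht => ?_
  have ht' : 0 < (z * t).re := by rw [re_mul_ofReal']; exact mul_pos hz ht
  simp only [hF, smul_eq_mul]
  unfold altTheta
  rw [← tsum_mul_left]
  refine tsum_congr fun n => ?_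
  rw [show -(Real.pi / 4 * ((n : ℂ) ^ 2 * (z * t))) = -((n : ℂ) ^ 2 * (Real.pi / 4 * z) * t) by ring]
  ring

theorem exists_norm_altTheta_ray_le {z : ℂ} (hz : 0 < z.re) : ∃ C : ℝ, 0 < C ∧
    ∀ x : ℝ, 1 ≤ x → ‖altTheta (z * x)‖ ≤ C * Real.exp (-(Real.pi / 8 * z.re * x)) := by
  obtain ⟨C, hC, h⟩ := norm_altTheta_le hz
  refine ⟨C, hC, fun x hx => ?_⟩
  have := h (z * x) (by rw [re_mul_ofReal']; nlinarith)
  rw [re_mul_ofReal'] at this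
  rwa [mul_assoc]

theorem altTheta_ray_inv {z : ℂ} (hz1 : ‖z‖ = 1) (hz : 0 < z.re) {x : ℝ} (hx : 0 < x) :
    altTheta (z * (x⁻¹ : ℝ)) = ((starRingEnd ℂ) z * x) ^ (1 / 2 : ℂ) *
      (starRingEnd ℂ) (altTheta (z * x)) := by
  have hz0 : z ≠ 0 := by rintro rfl; simp at hz
  have h1 : (z * (x⁻¹ : ℝ)) = ((starRingEnd ℂ) z * x)⁻¹ := by
    rw [mul_inv, ← Complex.inv_eq_conj hz1, inv_inv, Complex.ofReal_inv]
  rw [h1, altTheta_inv (by rw [re_mul_ofReal']; simpa using mul_pos hz hx), ← altTheta_conj]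
  simp

theorem norm_altTheta_ray_inv {z : ℂ} (hz1 : ‖z‖ = 1) (hz : 0 < z.re) {x : ℝ} (hx : 0 < x) :
    ‖altTheta (z * (x⁻¹ : ℝ))‖ = x ^ (1 / 2 : ℝ) * ‖altTheta (z * x)‖ := by
  rw [altTheta_ray_inv hz1 hz hx, norm_mul, RCLike.norm_conj]
  congr 1
  rw [show (1 / 2 : ℂ) = ((1 / 2 : ℝ) : ℂ) by norm_num, Complex.norm_cpow_real]
  simp [hz1, abs_of_pos hx]

theorem continuousOn_altTheta_ray {z : ℂ} (hz : 0 < z.re) :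
    ContinuousOn (fun x : ℝ => altTheta (z * x)) (Set.Ioi 0) := by
  intro x hx
  refine ContinuousAt.continuousWithinAt ?_
  exact ContinuousAt.comp (g := altTheta) (f := fun x : ℝ => z * x)
    (continuousAt_altTheta (by rw [re_mul_ofReal']; exact mul_pos hz hx)) (by fun_prop)

theorem altTheta_ray_isBigO_atTop {z : ℂ} (hz : 0 < z.re) :
    (fun x : ℝ => altTheta (z * x)) =O[Filter.atTop]
      fun x => Real.exp (-(Real.pi / 8 * z.re) * x) := by
  obtain ⟨C, hC, h⟩ := exists_norm_altTheta_ray_le hz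
  refine Asymptotics.IsBigO.of_bound C ?_
  filter_upwards [Filter.eventually_ge_atTop 1] with x hx
  rw [Real.norm_of_nonneg (Real.exp_pos _).le]
  convert h x hx using 3
  ring

theorem altTheta_ray_isBigO_zero {z : ℂ} (hz1 : ‖z‖ = 1) (hz : 0 < z.re) (b : ℝ) :
    (fun x : ℝ => altTheta (z * x)) =O[nhdsWithin 0 (Set.Ioi 0)] (· ^ (-b) : ℝ → ℝ) := by
  have hpi := Real.pi_pos
  have h1 := (altTheta_ray_isBigO_atTop hz).trans
    (isLittleO_exp_neg_mul_rpow_atTop (a := Real.pi / 8 * z.re) (by positivity)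
      (b - 1 / 2)).isBigO
  obtain ⟨C, hC⟩ := (h1.comp_tendsto tendsto_inv_nhdsGT_zero).bound
  refine Asymptotics.IsBigO.of_bound C ?_
  filter_upwards [hC, self_mem_nhdsWithin] with x hx hx0
  have hx0' : 0 < x := hx0
  have hi : 0 < x⁻¹ := inv_pos.mpr hx0'
  have h2 := norm_altTheta_ray_inv hz1 hz hi
  rw [inv_inv] at h2
  simp only [Function.comp] at hx
  rw [h2]
  calc _ ≤ x⁻¹ ^ (1 / 2 : ℝ) * (C * ‖x⁻¹ ^ (b - 1 / 2)‖) := by gcongr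
    _ = C * ‖x ^ (-b)‖ := by
      rw [Real.norm_of_nonneg (by positivity), Real.norm_of_nonneg (by positivity),
        mul_left_comm, ← Real.rpow_add hi, Real.inv_rpow hx0'.le, ← Real.rpow_neg hx0'.le]
      congr 2
      ring

theorem mellin_altTheta {z s : ℂ} (hz1 : ‖z‖ = 1) (hz : 0 < z.re) (hs : 0 < s.im) :
    mellin (fun x : ℝ => altTheta (z * x)) (s / 2) =
      (Real.pi / 4 * z) ^ (-(s / 2)) * Complex.Gamma (s / 2) *
        ((3 * 2 ^ (-s) - 2 * 4 ^ (-s) - 1) * riemannZeta s) := by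
  have hpi := Real.pi_pos
  have hz0 : z ≠ 0 := by rintro rfl; simp at hz
  have hw0 : (Real.pi / 4 * z : ℂ) ≠ 0 := by
    have : (Real.pi : ℂ) ≠ 0 := by exact_mod_cast hpi.ne'
    simp [this, hz0]
  have hopen : IsOpen {w : ℂ | 0 < w.im} := isOpen_lt continuous_const Complex.continuous_im
  have hpre : IsPreconnected {w : ℂ | 0 < w.im} := (convex_halfSpace_im_gt 0).isPreconnected
  have h1 : AnalyticOnNhd ℂ (fun s => mellin (fun x : ℝ => altTheta (z * x)) (s / 2))
      {w : ℂ | 0 < w.im} := by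
    refine DifferentiableOn.analyticOnNhd (fun w hw => ?_) hopen
    have := mellin_differentiableAt_of_isBigO_rpow_exp (s := w / 2)
      (a := Real.pi / 8 * z.re) (by positivity)
      ((continuousOn_altTheta_ray hz).locallyIntegrableOn measurableSet_Ioi)
      (altTheta_ray_isBigO_atTop hz) (altTheta_ray_isBigO_zero hz1 hz ((w / 2).re - 1))
      (by linarith)
    exact (DifferentiableAt.comp (g := mellin (fun x : ℝ => altTheta (z * x)))
      (f := fun w : ℂ => w / 2) w this (by fun_prop)).differentiableWithinAt
  have h2 : AnalyticOnNhd ℂ (fun s : ℂ => (Real.pi / 4 * z) ^ (-(s / 2)) * Complex.Gamma (s / 2) *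
        ((3 * 2 ^ (-s) - 2 * 4 ^ (-s) - 1) * riemannZeta s)) {w : ℂ | 0 < w.im} := by
    refine DifferentiableOn.analyticOnNhd (fun w hw => ?_) hopen
    have hw' : 0 < w.im := hw
    refine DifferentiableAt.differentiableWithinAt ?_
    have a1 : DifferentiableAt ℂ (fun s : ℂ => (Real.pi / 4 * z) ^ (-(s / 2))) w :=
      DifferentiableAt.const_cpow (by fun_prop) (Or.inl hw0)
    have a2 : DifferentiableAt ℂ (fun s : ℂ => Complex.Gamma (s / 2)) w := by
      refine DifferentiableAt.comp (g := Complex.Gamma) (f := fun s : ℂ => s / 2) w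
        (Complex.differentiableAt_Gamma _ fun m hm => ?_) (by fun_prop)
      have := congrArg Complex.im hm
      simp at this
      linarith
    have a3 : DifferentiableAt ℂ (fun s : ℂ => (2 : ℂ) ^ (-s)) w :=
      DifferentiableAt.const_cpow (by fun_prop) (Or.inl (by norm_num))
    have a4 : DifferentiableAt ℂ (fun s : ℂ => (4 : ℂ) ^ (-s)) w :=
      DifferentiableAt.const_cpow (by fun_prop) (Or.inl (by norm_num))
    have a5 : DifferentiableAt ℂ riemannZeta w := differentiableAt_riemannZeta (by
      rintro rfl; simp at hw')
    fun_prop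
  refine h1.eqOn_of_preconnected_of_eventuallyEq h2 hpre (z₀ := 2 + Complex.I) (by simp) ?_ hs
  filter_upwards [(isOpen_lt continuous_const Complex.continuous_re).mem_nhds
    (show (1 : ℝ) < (2 + Complex.I).re by simp)] with w hw
  exact mellin_altTheta_of_one_lt_re hz hw

/-- The theta series along a ray in logarithmic coordinates. -/
noncomputable def thetaExp (z : ℂ) (u : ℝ) : ℂ :=
  (Real.exp (-(1 / 4) * u) : ℝ) • altTheta (z * (Real.exp (-u) : ℝ))

/-- The unit vector with argument `π / 2 - δ`. -/
noncomputable def ray (δ : ℝ) : ℂ := Complex.exp ((Real.pi / 2 - δ : ℝ) * Complex.I)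

theorem norm_ray (δ : ℝ) : ‖ray δ‖ = 1 := Complex.norm_exp_ofReal_mul_I _

theorem ray_re (δ : ℝ) : (ray δ).re = Real.sin δ := by
  rw [ray, Complex.exp_ofReal_mul_I_re, Real.cos_pi_div_two_sub]

theorem ray_im (δ : ℝ) : (ray δ).im = Real.cos δ := by
  rw [ray, Complex.exp_ofReal_mul_I_im, Real.sin_pi_div_two_sub]

theorem two_mul_div_pi_le_ray_re {δ : ℝ} (h0 : 0 < δ) (h1 : δ ≤ 1 / 2) :
    2 * δ / Real.pi ≤ (ray δ).re := by
  rw [ray_re]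
  have := Real.mul_le_sin h0.le (by linarith [Real.pi_gt_three])
  calc _ = 2 / Real.pi * δ := by ring
    _ ≤ _ := this

theorem ray_re_pos {δ : ℝ} (h0 : 0 < δ) (h1 : δ ≤ 1 / 2) : 0 < (ray δ).re :=
  lt_of_lt_of_le (by have := Real.pi_pos; positivity) (two_mul_div_pi_le_ray_re h0 h1)

theorem half_le_ray_im {δ : ℝ} (h0 : 0 < δ) (h1 : δ ≤ 1 / 2) : 1 / 2 ≤ (ray δ).im := by
  rw [ray_im]
  have := Real.one_sub_sq_div_two_le_cos (x := δ)
  nlinarith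

theorem arg_ray {δ : ℝ} (h0 : 0 < δ) (h1 : δ ≤ 1 / 2) : (ray δ).arg = Real.pi / 2 - δ := by
  have hpi := Real.pi_gt_three
  rw [ray, Complex.exp_mul_I, Complex.arg_cos_add_sin_mul_I]
  constructor <;> linarith

theorem norm_thetaFactor_ge : ∃ c : ℝ, 0 < c ∧ ∀ s : ℂ, s.re = 1 / 2 →
    c ≤ ‖(3 * (2 : ℂ) ^ (-s) - 2 * (4 : ℂ) ^ (-s) - 1 : ℂ)‖ := by
  have h2 : 1 < √2 := by rw [Real.lt_sqrt] <;> norm_num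
  have h2' : √2 * √2 = 2 := Real.mul_self_sqrt (by norm_num)
  refine ⟨(1 - √2 / 2) * (√2 - 1), mul_pos (by nlinarith) (by linarith), fun s hs => ?_⟩
  have h4 := Complex.natCast_mul_natCast_cpow 2 2 (-s)
  norm_num at h4
  rw [h4]
  have hx : ‖(2 : ℂ) ^ (-s)‖ = √2 / 2 := by
    have := Complex.norm_cpow_eq_rpow_re_of_pos (x := 2) (by norm_num) (-s)
    push_cast at this
    rw [this, Complex.neg_re, hs, Real.rpow_neg (by norm_num), ← Real.sqrt_eq_rpow]
    field_simp
    linarith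
  set x := (2 : ℂ) ^ (-s)
  have e : 3 * x - 2 * (x * x) - 1 = -((1 - x) * (1 - 2 * x)) := by ring
  rw [e, norm_neg, norm_mul]
  have a1 : 1 - √2 / 2 ≤ ‖1 - x‖ := by
    have := norm_sub_norm_le (1 : ℂ) x
    rwa [norm_one, hx] at this
  have a2 : √2 - 1 ≤ ‖1 - 2 * x‖ := by
    have := norm_sub_norm_le (2 * x) (1 : ℂ)
    rw [norm_one, norm_mul, hx, norm_sub_rev] at this
    norm_num at this
    linarith
  exact mul_le_mul a1 a2 (by linarith) (norm_nonneg _)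

open scoped FourierTransform in
theorem fourier_thetaExp {z : ℂ} (hz1 : ‖z‖ = 1) (hz : 0 < z.re) {t : ℝ} (ht : 0 < t) :
    𝓕 (thetaExp z) (t / (4 * Real.pi)) =
      (Real.pi / 4 * z) ^ (-((1 / 2 + t * Complex.I) / 2)) *
        Complex.Gamma ((1 / 2 + t * Complex.I) / 2) *
        ((3 * 2 ^ (-(1 / 2 + t * Complex.I)) - 2 * 4 ^ (-(1 / 2 + t * Complex.I)) - 1) *
          riemannZeta (1 / 2 + t * Complex.I)) := by
  rw [← mellin_altTheta hz1 hz (s := 1 / 2 + t * Complex.I) (by simpa using ht), mellin_eq_fourier]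
  have h1 : ((1 / 2 + t * Complex.I) / 2 : ℂ).re = 1 / 4 := by simp; norm_num
  have h2 : ((1 / 2 + t * Complex.I) / 2 : ℂ).im = t / 2 := by simp
  rw [h1, h2]
  have : t / 2 / (2 * Real.pi) = t / (4 * Real.pi) := by ring
  rw [this]
  rfl

open scoped FourierTransform in
theorem exists_le_norm_fourier_thetaExp : ∃ c : ℝ, 0 < c ∧ ∀ δ : ℝ, 0 < δ → δ ≤ 1 / 2 →
    ∀ t : ℝ, 1 ≤ t →
    c * (Real.exp (-(2 * δ * t)) * ‖riemannZeta (1 / 2 + t * Complex.I)‖ ^ 4) ≤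
      t * ‖𝓕 (thetaExp (ray δ)) (t / (4 * Real.pi))‖ ^ 4 := by
  obtain ⟨c₁, hc₁, h₁⟩ := norm_thetaFactor_ge
  obtain ⟨c₂, hc₂, h₂⟩ := norm_Gamma_quarter_ge
  have hpi := Real.pi_pos
  refine ⟨4 / Real.pi * c₂ * c₁ ^ 4, by positivity, fun δ h0 h1 t ht => ?_⟩
  rw [fourier_thetaExp (norm_ray δ) (ray_re_pos h0 h1) (by linarith)]
  have hz0 : ray δ ≠ 0 := Complex.exp_ne_zero _
  have hre : (-((1 / 2 + t * Complex.I) / 2) : ℂ).re = -(1 / 4) := by simp; norm_num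
  have him : (-((1 / 2 + t * Complex.I) / 2) : ℂ).im = -(t / 2) := by simp
  have hw : (Real.pi / 4 * ray δ : ℂ) = ((Real.pi / 4 : ℝ) : ℂ) * ray δ := by push_cast; ring
  have hw0 : (Real.pi / 4 * ray δ : ℂ) ≠ 0 := by
    rw [hw]
    exact mul_ne_zero (by exact_mod_cast (by positivity : Real.pi / 4 ≠ 0)) hz0
  have ha : (Real.pi / 4 * ray δ : ℂ).arg = Real.pi / 2 - δ := by
    rw [hw, Complex.arg_real_mul _ (by positivity), arg_ray h0 h1]
  have hn : ‖(Real.pi / 4 * ray δ : ℂ)‖ = Real.pi / 4 := by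
    rw [hw, norm_mul, norm_ray, mul_one, Complex.norm_real, Real.norm_of_nonneg (by positivity)]
  have hp : ‖(Real.pi / 4 * ray δ : ℂ) ^ (-((1 / 2 + t * Complex.I) / 2))‖ ^ 4 =
      4 / Real.pi * (Real.exp (Real.pi * t) * Real.exp (-(2 * δ * t))) := by
    rw [Complex.norm_cpow_of_ne_zero hw0, ha, hn, hre, him, div_pow, ← Real.exp_nat_mul,
      ← Real.rpow_natCast, ← Real.rpow_mul (by positivity), ← Real.exp_add, div_eq_mul_inv,
      ← Real.exp_neg]
    congr 1
    · norm_num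
      rw [Real.rpow_neg_one]
      field_simp
    · congr 1
      push_cast
      ring
  have hg := h₂ t ht
  have hf := h₁ (1 / 2 + t * Complex.I) (by simp)
  have hge : ((1 / 2 + t * Complex.I) / 2 : ℂ) = 1 / 4 + (t / 2 : ℝ) * Complex.I := by
    push_cast; ring
  rw [norm_mul, norm_mul, norm_mul, mul_pow, mul_pow, mul_pow, hp, hge]
  set Γ := ‖Complex.Gamma (1 / 4 + (t / 2 : ℝ) * Complex.I)‖
  set Z := ‖riemannZeta (1 / 2 + t * Complex.I)‖
  set E := Real.exp (-(2 * δ * t))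
  set A := ‖(3 * 2 ^ (-(1 / 2 + t * Complex.I)) - 2 * 4 ^ (-(1 / 2 + t * Complex.I)) - 1 : ℂ)‖
  calc _ = 4 / Real.pi * E * Z ^ 4 * (c₂ * c₁ ^ 4) := by ring
    _ ≤ 4 / Real.pi * E * Z ^ 4 * (t * Real.exp (Real.pi * t) * Γ ^ 4 * A ^ 4) := by gcongr
    _ = _ := by ring

theorem exists_thetaExp_neg {z : ℂ} (hz1 : ‖z‖ = 1) (hz : 0 < z.re) : ∃ ω : ℂ, ‖ω‖ = 1 ∧
    ∀ u : ℝ, thetaExp z (-u) = ω * (starRingEnd ℂ) (thetaExp z u) := by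
  have hz0 : (starRingEnd ℂ) z ≠ 0 := by
    rw [Ne, map_eq_zero]; rintro rfl; simp at hz
  refine ⟨(starRingEnd ℂ) z ^ (1 / 2 : ℂ), ?_, fun u => ?_⟩
  · rw [show (1 / 2 : ℂ) = ((1 / 2 : ℝ) : ℂ) by norm_num, Complex.norm_cpow_real]
    simp [hz1]
  · have hE : 0 < Real.exp (-u) := Real.exp_pos _
    have h := altTheta_ray_inv hz1 hz hE
    rw [← Real.exp_neg, neg_neg] at h
    have hc : ((starRingEnd ℂ) z * (Real.exp (-u) : ℝ)) ^ (1 / 2 : ℂ) =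
        (Real.exp (-(u / 2)) : ℝ) * (starRingEnd ℂ) z ^ (1 / 2 : ℂ) := by
      have hl := Complex.log_ofReal_mul hE hz0
      rw [Real.log_exp] at hl
      rw [mul_comm, Complex.cpow_def_of_ne_zero (mul_ne_zero (by exact_mod_cast hE.ne') hz0),
        Complex.cpow_def_of_ne_zero hz0, hl, Complex.ofReal_exp, ← Complex.exp_add]
      congr 1
      push_cast
      ring
    unfold thetaExp
    rw [neg_neg, h, hc]
    have he : Real.exp (-(1 / 4) * -u) * Real.exp (-(u / 2)) = Real.exp (-(1 / 4) * u) := by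
      rw [← Real.exp_add]; congr 1; ring
    rw [Complex.real_smul, Complex.real_smul, map_mul, Complex.conj_ofReal, ← he]
    push_cast
    ring

theorem continuous_thetaExp {z : ℂ} (hz : 0 < z.re) : Continuous (thetaExp z) := by
  unfold thetaExp
  have : Continuous fun u : ℝ => altTheta (z * (Real.exp (-u) : ℝ)) :=
    (continuousOn_altTheta_ray hz).comp_continuous (f := fun u : ℝ => Real.exp (-u)) (by fun_prop)
      fun u => Real.exp_pos _
  fun_prop

theorem integrable_exp_neg_mul_abs {a : ℝ} (ha : 0 < a) :
    Integrable fun u : ℝ => Real.exp (-(a * |u|)) := by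
  rw [← integrableOn_univ, ← Set.Iic_union_Ioi (a := (0 : ℝ))]
  refine IntegrableOn.union ?_ ?_
  · refine (integrableOn_exp_mul_Iic ha 0).congr_fun (fun u hu => ?_) measurableSet_Iic
    simp [abs_of_nonpos (show u ≤ 0 from hu)]
  · refine (integrableOn_exp_mul_Ioi (a := -a) (by linarith) 0).congr_fun (fun u hu => ?_)
      measurableSet_Ioi
    simp [abs_of_pos (show 0 < u from hu)]

theorem exists_pow_mul_exp_neg_le {c : ℝ} (hc : 0 < c) (k : ℕ) : ∃ M : ℝ, 0 < M ∧
    ∀ x : ℝ, 0 < x → x ^ k * Real.exp (-(c * x)) ≤ M := by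
  refine ⟨(k.factorial : ℝ) / c ^ k, by positivity, fun x hx => ?_⟩
  have h := Real.pow_div_factorial_le_exp (c * x) (by positivity) k
  rw [Real.exp_neg, ← div_eq_mul_inv, div_le_div_iff₀ (Real.exp_pos _) (by positivity)]
  rw [div_le_iff₀ (by positivity), mul_pow] at h
  linarith

theorem exists_norm_thetaExp_le {z : ℂ} (hz1 : ‖z‖ = 1) (hz : 0 < z.re) : ∃ M : ℝ, 0 < M ∧
    ∀ u : ℝ, ‖thetaExp z u‖ ≤ M * Real.exp (-(1 / 4 * |u|)) := by
  have hpi := Real.pi_pos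
  obtain ⟨C, hC, h⟩ := exists_norm_altTheta_ray_le hz
  obtain ⟨M, hM, hM'⟩ := exists_pow_mul_exp_neg_le (c := Real.pi / 8 * z.re) (by positivity) 1
  obtain ⟨ω, hω, hsymm⟩ := exists_thetaExp_neg hz1 hz
  have hneg : ∀ u : ℝ, u ≤ 0 → ‖thetaExp z u‖ ≤ C * M * Real.exp (-(1 / 4 * |u|)) := by
    intro u hu
    have h1 : 1 ≤ Real.exp (-u) := Real.one_le_exp (by linarith)
    have h2 := h _ h1
    have h3 := hM' (Real.exp (-u)) (by positivity)
    rw [thetaExp, norm_smul, Real.norm_of_nonneg (Real.exp_pos _).le, abs_of_nonpos hu]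
    set x := Real.exp (-u) with hx
    have e1 : Real.exp (-(1 / 4) * u) ≤ Real.exp (-(1 / 4 * -u)) * x := by
      rw [hx, ← Real.exp_add]
      apply Real.exp_le_exp.mpr
      linarith
    rw [pow_one] at h3
    calc _ ≤ (Real.exp (-(1 / 4 * -u)) * x) * (C * Real.exp (-(Real.pi / 8 * z.re * x))) := by
          gcongr
      _ = C * (x * Real.exp (-(Real.pi / 8 * z.re * x))) * Real.exp (-(1 / 4 * -u)) := by ring
      _ ≤ _ := by gcongr
  refine ⟨C * M, by positivity, fun u => ?_⟩
  rcases le_total u 0 with hu | hu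
  · exact hneg u hu
  · have h1 := hneg (-u) (by linarith)
    rwa [hsymm, norm_mul, hω, one_mul, RCLike.norm_conj, abs_neg] at h1

theorem integrable_thetaExp {z : ℂ} (hz1 : ‖z‖ = 1) (hz : 0 < z.re) :
    Integrable (thetaExp z) := by
  obtain ⟨M, hM, h⟩ := exists_norm_thetaExp_le hz1 hz
  exact ((integrable_exp_neg_mul_abs (by norm_num)).const_mul M).mono'
    (continuous_thetaExp hz).aestronglyMeasurable (Filter.Eventually.of_forall h)

/-- The Dirichlet convolution square of `thetaCoeff`. -/
noncomputable def thetaConvCoeff (n : ℕ) : ℂ :=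
  ∑ p ∈ n.divisorsAntidiagonal, thetaCoeff p.1 * thetaCoeff p.2

theorem norm_thetaConvCoeff_le (n : ℕ) : ‖thetaConvCoeff n‖ ≤ 4 * n.divisors.card := by
  unfold thetaConvCoeff
  refine (norm_sum_le _ _).trans ((Finset.sum_le_card_nsmul _ _ 4 fun p _ => ?_).trans ?_)
  · rw [norm_mul]
    have h1 := norm_thetaCoeff_le p.1
    have h2 := norm_thetaCoeff_le p.2
    nlinarith [norm_nonneg (thetaCoeff p.1), norm_nonneg (thetaCoeff p.2)]
  · have : n.divisorsAntidiagonal.card = n.divisors.card := by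
      rw [← Nat.map_div_right_divisors, Finset.card_map]
    rw [this, nsmul_eq_mul, mul_comm]

/-- The product of two terms of the theta series, on the multiplicative convolution. -/
noncomputable def thetaPair (z : ℂ) (y : ℝ) (p : ℕ × ℕ) (u : ℝ) : ℂ :=
  (thetaCoeff p.1 * Complex.exp (-(Real.pi / 4 * ((p.1 : ℂ) ^ 2 * (z * (Real.exp (-u) : ℝ)))))) *
    (thetaCoeff p.2 *
      Complex.exp (-(Real.pi / 4 * ((p.2 : ℂ) ^ 2 * (z * (Real.exp (-(y - u)) : ℝ))))))

theorem sq_mul_exp_add_sq_mul_exp {m n : ℝ} (hm : 0 < m) (hn : 0 < n) (y v : ℝ) :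
    m ^ 2 * Real.exp (-(v + (y / 2 + Real.log m - Real.log n))) +
      n ^ 2 * Real.exp (-(y - (v + (y / 2 + Real.log m - Real.log n)))) =
    2 * (m * n * Real.exp (-y / 2)) * Real.cosh v := by
  have e1 : Real.exp (-(v + (y / 2 + Real.log m - Real.log n))) =
      Real.exp (-v) * Real.exp (-y / 2) * n / m := by
    rw [show -(v + (y / 2 + Real.log m - Real.log n)) = -v + -y / 2 + Real.log n - Real.log m by
      ring, Real.exp_sub, Real.exp_add, Real.exp_add, Real.exp_log hm, Real.exp_log hn]
  have e2 : Real.exp (-(y - (v + (y / 2 + Real.log m - Real.log n)))) =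
      Real.exp v * Real.exp (-y / 2) * m / n := by
    rw [show -(y - (v + (y / 2 + Real.log m - Real.log n))) =
      v + -y / 2 + Real.log m - Real.log n by ring, Real.exp_sub, Real.exp_add, Real.exp_add,
      Real.exp_log hm, Real.exp_log hn]
  rw [e1, e2, Real.cosh_eq]
  field_simp
  ring

theorem thetaPair_shift (z : ℂ) (y : ℝ) {m n : ℕ} (hm : 0 < m) (hn : 0 < n) (v : ℝ) :
    thetaPair z y (m, n) (v + (y / 2 + Real.log m - Real.log n)) =
      thetaCoeff m * thetaCoeff n * Complex.exp
        (-(Real.pi / 2 * (((m * n : ℕ) : ℂ) * z * (Real.exp (-y / 2) : ℝ)) * Real.cosh v)) := by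
  have h := sq_mul_exp_add_sq_mul_exp (m := m) (n := n) (by exact_mod_cast hm)
    (by exact_mod_cast hn) y v
  have h' := congrArg (fun x : ℝ => (x : ℂ)) h
  simp only [Complex.ofReal_add, Complex.ofReal_mul, Complex.ofReal_pow, Complex.ofReal_natCast,
    Complex.ofReal_ofNat] at h'
  unfold thetaPair
  rw [mul_mul_mul_comm, ← Complex.exp_add]
  congr 2
  push_cast at h' ⊢
  linear_combination (-(Real.pi / 4 * z)) * h'

theorem thetaPair_of_eq_zero (z : ℂ) (y : ℝ) {p : ℕ × ℕ} (hp : p.1 * p.2 = 0) :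
    thetaPair z y p = 0 := by
  funext u
  rcases mul_eq_zero.mp hp with h | h <;> simp [thetaPair, h, thetaCoeff_zero]

theorem half_add_abs_le_cosh (v : ℝ) : (1 + |v|) / 2 ≤ Real.cosh v := by
  have h1 := Real.one_le_cosh v
  have h2 : |v| ≤ Real.cosh v := by
    rw [← Real.cosh_abs]
    exact (Real.self_le_sinh_iff.mpr (abs_nonneg v)).trans (Real.sinh_lt_cosh _).le
  linarith

theorem norm_thetaPair_shift_le {z : ℂ} (hz : 0 < z.re) (y : ℝ) {m n : ℕ} (hm : 0 < m)
    (hn : 0 < n) (v : ℝ) :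
    ‖thetaPair z y (m, n) (v + (y / 2 + Real.log m - Real.log n))‖ ≤
      4 * (Real.exp (-(Real.pi / 8 * z.re * Real.exp (-y / 2)) * m) *
        Real.exp (-(Real.pi / 8 * z.re * Real.exp (-y / 2)) * n)) *
        Real.exp (-(Real.pi / 4 * z.re * Real.exp (-y / 2) * |v|)) := by
  have hpi := Real.pi_pos
  rw [thetaPair_shift z y hm hn, norm_mul, norm_mul, ← Real.exp_add, mul_assoc 4,
    ← Real.exp_add]
  have hc : ‖thetaCoeff m‖ * ‖thetaCoeff n‖ ≤ 4 := by
    nlinarith [norm_nonneg (thetaCoeff m), norm_nonneg (thetaCoeff n), norm_thetaCoeff_le m,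
      norm_thetaCoeff_le n]
  refine mul_le_mul hc ?_ (norm_nonneg _) (by norm_num)
  rw [Complex.norm_exp]
  apply Real.exp_le_exp.mpr
  have e : (-(Real.pi / 2 * (((m * n : ℕ) : ℂ) * z * (Real.exp (-y / 2) : ℝ)) * Real.cosh v) : ℂ) =
      ((-(Real.pi / 2 * (m * n * Real.exp (-y / 2)) * Real.cosh v) : ℝ) : ℂ) * z := by
    push_cast; ring
  rw [e, Complex.re_ofReal_mul]
  have hm1 : (1 : ℝ) ≤ m := by exact_mod_cast hm
  have hn1 : (1 : ℝ) ≤ n := by exact_mod_cast hn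
  have h1 : ((m : ℝ) + n) / 2 ≤ m * n := by nlinarith
  have h2 : (1 : ℝ) ≤ m * n := one_le_mul_of_one_le_of_one_le hm1 hn1
  have hv := half_add_abs_le_cosh v
  have h3 : ((m : ℝ) + n) / 4 + |v| / 2 ≤ m * n * Real.cosh v := by
    have : (m : ℝ) * n * ((1 + |v|) / 2) ≤ m * n * Real.cosh v := by gcongr
    nlinarith [abs_nonneg v]
  have h4 := mul_le_mul_of_nonneg_left h3
    (show 0 ≤ Real.pi / 2 * z.re * Real.exp (-y / 2) by positivity)
  linarith

theorem continuous_thetaPair (z : ℂ) (y : ℝ) (p : ℕ × ℕ) : Continuous (thetaPair z y p) := by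
  unfold thetaPair
  fun_prop

theorem integrable_thetaPair {z : ℂ} (hz : 0 < z.re) (y : ℝ) (p : ℕ × ℕ) :
    Integrable (thetaPair z y p) := by
  have hpi := Real.pi_pos
  obtain ⟨m, n⟩ := p
  by_cases hp : m * n = 0
  · rw [thetaPair_of_eq_zero z y hp]; exact integrable_zero _ _ _
  · have hm : 0 < m := Nat.pos_of_ne_zero (left_ne_zero_of_mul hp)
    have hn : 0 < n := Nat.pos_of_ne_zero (right_ne_zero_of_mul hp)
    have h : Integrable fun v =>
        thetaPair z y (m, n) (v + (y / 2 + Real.log m - Real.log n)) := by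
      refine Integrable.mono' ((integrable_exp_neg_mul_abs
        (a := Real.pi / 4 * z.re * Real.exp (-y / 2)) (by positivity)).const_mul _)
        ((continuous_thetaPair z y (m, n)).comp (by fun_prop)).aestronglyMeasurable
        (Filter.Eventually.of_forall fun v => norm_thetaPair_shift_le hz y hm hn v)
    have := h.comp_add_right (-(y / 2 + Real.log m - Real.log n))
    simpa only [neg_add_cancel_right] using this

theorem integral_norm_thetaPair_le {z : ℂ} (hz : 0 < z.re) (y : ℝ) (p : ℕ × ℕ) :
    ∫ u, ‖thetaPair z y p u‖ ≤
      (4 * ∫ v : ℝ, Real.exp (-(Real.pi / 4 * z.re * Real.exp (-y / 2) * |v|))) *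
      (Real.exp (-(Real.pi / 8 * z.re * Real.exp (-y / 2)) * p.1) *
        Real.exp (-(Real.pi / 8 * z.re * Real.exp (-y / 2)) * p.2)) := by
  have hpi := Real.pi_pos
  obtain ⟨m, n⟩ := p
  by_cases hp : m * n = 0
  · rw [thetaPair_of_eq_zero z y hp]
    simp only [Pi.zero_apply, norm_zero, integral_zero]
    have : 0 ≤ ∫ v : ℝ, Real.exp (-(Real.pi / 4 * z.re * Real.exp (-y / 2) * |v|)) :=
      integral_nonneg fun _ => (Real.exp_pos _).le
    positivity
  · have hm : 0 < m := Nat.pos_of_ne_zero (left_ne_zero_of_mul hp)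
    have hn : 0 < n := Nat.pos_of_ne_zero (right_ne_zero_of_mul hp)
    rw [← integral_add_right_eq_self _ (y / 2 + Real.log m - Real.log n)]
    have hi := integrable_exp_neg_mul_abs
      (a := Real.pi / 4 * z.re * Real.exp (-y / 2)) (by positivity)
    refine (integral_mono_of_nonneg (Filter.Eventually.of_forall fun v => norm_nonneg _)
      (hi.const_mul _) (Filter.Eventually.of_forall fun v =>
        norm_thetaPair_shift_le hz y hm hn v)).trans (le_of_eq ?_)
    rw [integral_const_mul]
    ring

theorem integral_thetaPair {z : ℂ} (hz : 0 < z.re) (y : ℝ) (p : ℕ × ℕ) :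
    ∫ u, thetaPair z y p u = thetaCoeff p.1 * thetaCoeff p.2 *
      besselKer (((p.1 * p.2 : ℕ) : ℂ) * z * (Real.exp (-y / 2) : ℝ)) := by
  obtain ⟨m, n⟩ := p
  by_cases hp : m * n = 0
  · rw [thetaPair_of_eq_zero z y hp]
    rcases mul_eq_zero.mp hp with h | h <;> simp [h, thetaCoeff_zero]
  · have hm : 0 < m := Nat.pos_of_ne_zero (left_ne_zero_of_mul hp)
    have hn : 0 < n := Nat.pos_of_ne_zero (right_ne_zero_of_mul hp)
    rw [← integral_add_right_eq_self _ (y / 2 + Real.log m - Real.log n)]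
    simp_rw [thetaPair_shift z y hm hn]
    rw [integral_const_mul, integral_exp_neg_cosh, besselKer]
    rw [re_natCast_mul_mul]
    have : (0 : ℝ) < ((m * n : ℕ) : ℝ) := by exact_mod_cast Nat.mul_pos hm hn
    positivity

theorem hasSum_besselKer_thetaConv {z : ℂ} (hz : 0 < z.re) (y : ℝ) :
    HasSum (fun n : ℕ => thetaConvCoeff n * besselKer (n * z * (Real.exp (-y / 2) : ℝ)))
      (∫ u : ℝ, altTheta (z * (Real.exp (-u) : ℝ)) * altTheta (z * (Real.exp (-(y - u)) : ℝ))) := by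
  have hpi := Real.pi_pos
  have hs : Summable fun n : ℕ => Real.exp (-(Real.pi / 8 * z.re * Real.exp (-y / 2)) * n) := by
    have := Real.summable_exp_nat_mul_iff (a := -(Real.pi / 8 * z.re * Real.exp (-y / 2)))
    simp_rw [mul_comm (_ : ℝ) ((_ : ℕ) : ℝ)]
    rw [this, neg_lt_zero]
    positivity
  have hsum := hasSum_integral_of_summable_integral_norm (integrable_thetaPair hz y)
    (Summable.of_nonneg_of_le (fun p => integral_nonneg fun _ => norm_nonneg _)
      (integral_norm_thetaPair_le hz y)
      ((hs.mul_of_nonneg hs (fun _ => (Real.exp_pos _).le)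
        (fun _ => (Real.exp_pos _).le)).mul_left _))
  have hprod : ∀ u : ℝ, ∑' p, thetaPair z y p u =
      altTheta (z * (Real.exp (-u) : ℝ)) * altTheta (z * (Real.exp (-(y - u)) : ℝ)) := by
    intro u
    have h1 := (hasSum_altTheta (z := z * (Real.exp (-u) : ℝ)) (by
      rw [Complex.re_mul_ofReal]; positivity)).summable.norm
    have h2 := (hasSum_altTheta (z := z * (Real.exp (-(y - u)) : ℝ)) (by
      rw [Complex.re_mul_ofReal]; positivity)).summable.norm
    exact (tsum_mul_tsum_of_summable_norm h1 h2).symm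
  simp_rw [hprod, integral_thetaPair hz y] at hsum
  convert! hsum.tsum_fiberwise (fun p : ℕ × ℕ => p.1 * p.2) using 1
  funext n
  rcases Nat.eq_zero_or_pos n with rfl | hn
  · have h0 : thetaConvCoeff 0 = 0 := by simp [thetaConvCoeff]
    rw [h0, zero_mul]
    symm
    convert tsum_zero with p
    have hp : (p : ℕ × ℕ).1 * (p : ℕ × ℕ).2 = 0 := p.2
    rcases mul_eq_zero.mp hp with h | h <;> simp [h, thetaCoeff_zero]
  · have hset : (fun p : ℕ × ℕ => p.1 * p.2) ⁻¹' {n} = (n.divisorsAntidiagonal : Set (ℕ × ℕ)) := by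
      ext p
      simp [hn.ne']
    rw [hset, Finset.tsum_subtype' n.divisorsAntidiagonal (fun p : ℕ × ℕ =>
      thetaCoeff p.1 * thetaCoeff p.2 *
        besselKer (((p.1 * p.2 : ℕ) : ℂ) * z * (Real.exp (-y / 2) : ℝ))), thetaConvCoeff,
      Finset.sum_mul]
    refine Finset.sum_congr rfl fun p hp => ?_
    rw [(Nat.mem_divisorsAntidiagonal.mp hp).1]

theorem norm_exp_neg_mul_mul (w : ℂ) :
    ‖Complex.exp (-(Real.pi / 2 * w))‖ = Real.exp (-(Real.pi / 2 * w.re)) := by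
  rw [Complex.norm_exp]
  congr 1
  have : (-(Real.pi / 2 * w) : ℂ) = ((-(Real.pi / 2) : ℝ) : ℂ) * w := by push_cast; ring
  rw [this, Complex.re_ofReal_mul]
  ring

theorem exists_norm_besselKerDeriv_le {a : ℝ} (ha : 0 < a) : ∃ D : ℝ, 0 < D ∧
    ∀ w : ℂ, 0 < w.re → a ≤ ‖w‖ →
      ‖besselKerDeriv w‖ ≤ D * Real.exp (-(Real.pi / 2 * w.re)) := by
  have hpi := Real.pi_pos
  refine ⟨Real.pi * (2 * a ^ (-(1 / 2) : ℝ)) + Real.pi * (2 * a ^ (-(3 / 2) : ℝ)), by positivity,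
    fun w hw h => ?_⟩
  have hp : ∀ p : ℝ, 0 < p → ‖(Real.pi : ℂ) * besselAmp p w‖ ≤ Real.pi * (2 * a ^ (-p)) := by
    intro p hp
    rw [norm_mul, Complex.norm_real, Real.norm_of_nonneg hpi.le]
    gcongr
    refine (norm_besselAmp_le_rpow hp hw).trans ?_
    gcongr 2 * ?_
    exact Real.rpow_le_rpow_of_nonpos ha h (by linarith)
  unfold besselKerDeriv
  rw [norm_neg, norm_mul, norm_exp_neg_mul_mul, mul_comm]
  gcongr
  exact (norm_add_le _ _).trans (add_le_add (hp _ (by norm_num)) (hp _ (by norm_num)))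

/-- The multiplicative autocorrelation of the theta series. -/
noncomputable def autoconv (z : ℂ) (y : ℝ) : ℂ := ∫ u : ℝ, thetaExp z u * thetaExp z (y - u)

theorem hasSum_autoconv {z : ℂ} (hz : 0 < z.re) (y : ℝ) :
    HasSum (fun n : ℕ => thetaConvCoeff n * besselKer (n * z * (Real.exp (-y / 2) : ℝ)))
      ((Real.exp (y / 4) : ℝ) * autoconv z y) := by
  convert! hasSum_besselKer_thetaConv hz y using 1
  unfold autoconv
  rw [← integral_const_mul]
  congr 1
  funext u
  unfold thetaExp
  have h : Real.exp (y / 4) * Real.exp (-(1 / 4) * u) * Real.exp (-(1 / 4) * (y - u)) = 1 := by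
    rw [← Real.exp_add, ← Real.exp_add, Real.exp_eq_one_iff]; ring
  have h' : (Real.exp (y / 4) : ℂ) * (Real.exp (-(1 / 4) * u) : ℝ) *
      (Real.exp (-(1 / 4) * (y - u)) : ℝ) = 1 := by exact_mod_cast h
  rw [Complex.real_smul, Complex.real_smul]
  linear_combination (altTheta (z * (Real.exp (-u) : ℝ)) *
    altTheta (z * (Real.exp (-(y - u)) : ℝ))) * h'

theorem hasDerivAt_tsum_besselKer {z : ℂ} (hz1 : ‖z‖ = 1) (hz : 0 < z.re) {x : ℝ} (hx : 0 < x) :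
    Summable (fun n : ℕ => thetaConvCoeff n * (besselKerDeriv (n * z * x) * (n * z))) ∧
    HasDerivAt (fun x : ℝ => ∑' n : ℕ, thetaConvCoeff n * besselKer (n * z * x))
      (∑' n : ℕ, thetaConvCoeff n * (besselKerDeriv (n * z * x) * (n * z))) x := by
  have hpi := Real.pi_pos
  obtain ⟨D, hD, hD'⟩ := exists_norm_besselKerDeriv_le (a := x / 2) (by positivity)
  have hb0 : thetaConvCoeff 0 = 0 := by simp [thetaConvCoeff]
  have hu := summable_sq_mul_exp_neg (c := Real.pi / 4 * z.re * x) (by positivity) (4 * D)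
  have hxm : x ∈ Set.Ioi (x / 2) := by simp only [Set.mem_Ioi]; linarith
  have hbd : ∀ n : ℕ, ∀ v ∈ Set.Ioi (x / 2),
      ‖thetaConvCoeff n * (besselKerDeriv (n * z * v) * (n * z))‖ ≤
      4 * D * ((n : ℝ) ^ 2 * Real.exp (-(Real.pi / 4 * z.re * x) * n)) := by
    intro n v hv
    rw [Set.mem_Ioi] at hv
    have hv0 : 0 < v := by linarith
    rcases Nat.eq_zero_or_pos n with rfl | hn
    · simp [hb0]
    have hn1 : (1 : ℝ) ≤ n := by exact_mod_cast hn
    have h1 : ‖thetaConvCoeff n‖ ≤ 4 * n :=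
      (norm_thetaConvCoeff_le n).trans (by gcongr; exact Nat.card_divisors_le_self n)
    have h2 := hD' (n * z * v) (by rw [re_natCast_mul_mul]; positivity) (by
      rw [norm_natCast_mul_mul n hz1 hv0.le]; nlinarith)
    rw [re_natCast_mul_mul] at h2
    have h3 : Real.exp (-(Real.pi / 2 * (n * z.re * v))) ≤
        Real.exp (-(Real.pi / 4 * z.re * x) * n) := by
      apply Real.exp_le_exp.mpr
      have := mul_le_mul_of_nonneg_left hv.le (show 0 ≤ Real.pi / 2 * (n * z.re) by positivity)
      linarith
    rw [norm_mul, norm_mul, norm_mul, hz1, mul_one, Complex.norm_natCast]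
    calc _ ≤ 4 * n * (D * Real.exp (-(Real.pi / 4 * z.re * x) * n) * n) := by
          gcongr
          exact h2.trans (by gcongr)
      _ = _ := by ring
  refine ⟨Summable.of_norm_bounded hu fun n => hbd n x hxm, ?_⟩
  refine hasDerivAt_tsum_of_isPreconnected hu isOpen_Ioi isPreconnected_Ioi
    (g := fun (n : ℕ) (v : ℝ) => thetaConvCoeff n * besselKer (n * z * v))
    (g' := fun (n : ℕ) (v : ℝ) => thetaConvCoeff n * (besselKerDeriv (n * z * v) * (n * z)))
    (fun n v hv => ?_) hbd hxm ?_ hxm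
  · rw [Set.mem_Ioi] at hv
    have hv0 : 0 < v := by linarith
    rcases Nat.eq_zero_or_pos n with rfl | hn
    · simpa [hb0] using hasDerivAt_const v (0 : ℂ)
    have hre : 0 < ((n : ℂ) * z * v).re := by rw [re_natCast_mul_mul]; positivity
    have hx1 : HasDerivAt (fun x : ℝ => (x : ℂ)) 1 v := Complex.ofRealCLM.hasDerivAt
    have h1 : HasDerivAt (fun x : ℝ => ((n : ℂ) * z * x)) (n * z) v := by
      simpa using hx1.const_mul ((n : ℂ) * z)
    exact (HasDerivAt.comp (h₂ := besselKer) (h := fun x : ℝ => ((n : ℂ) * z * x)) v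
      (hasDerivAt_besselKer hre) h1).const_mul _
  · have h := (hasSum_autoconv hz (-2 * Real.log x)).summable
    have : -(-2 * Real.log x) / 2 = Real.log x := by ring
    rwa [this, Real.exp_log hx] at h

theorem hasDerivAt_autoconv {z : ℂ} (hz1 : ‖z‖ = 1) (hz : 0 < z.re) (y : ℝ) :
    HasDerivAt (autoconv z) (-(1 / 2) * (Real.exp (-y / 4) : ℝ) *
      ∑' n, kerTerm thetaConvCoeff z n (Real.exp (-y / 2))) y := by
  obtain ⟨hs, hd⟩ := hasDerivAt_tsum_besselKer hz1 hz (Real.exp_pos (-y / 2))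
  have hG : autoconv z = fun y : ℝ => ((Real.exp (-y / 4) : ℝ) : ℂ) *
      ∑' n : ℕ, thetaConvCoeff n * besselKer (n * z * (Real.exp (-y / 2) : ℝ)) := by
    funext y
    rw [(hasSum_autoconv hz y).tsum_eq, ← mul_assoc, ← Complex.ofReal_mul, ← Real.exp_add,
      show -y / 4 + y / 4 = 0 by ring, Real.exp_zero, Complex.ofReal_one, one_mul]
  have hk : ∑' n, kerTerm thetaConvCoeff z n (Real.exp (-y / 2)) =
      (∑' n : ℕ, thetaConvCoeff n * besselKer (n * z * (Real.exp (-y / 2) : ℝ))) / 2 +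
      (Real.exp (-y / 2) : ℝ) * ∑' n : ℕ, thetaConvCoeff n *
        (besselKerDeriv (n * z * (Real.exp (-y / 2) : ℝ)) * (n * z)) := by
    rw [← tsum_div_const, ← tsum_mul_left,
      ← (hasSum_autoconv hz y).summable.div_const 2 |>.tsum_add (hs.mul_left _)]
    congr 1
    funext n
    unfold kerTerm
    rw [← besselKer_half_add]
    ring
  rw [hG, hk]
  have he : ∀ c : ℝ, HasDerivAt (fun y : ℝ => Real.exp (-y / c)) (-(1 / c) * Real.exp (-y / c)) y := by
    intro c
    have := ((hasDerivAt_id y).neg.div_const c).exp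
    convert! this using 1
    simp only [Pi.neg_apply, id]
    ring
  have h4 : HasDerivAt (fun y : ℝ => ((Real.exp (-y / 4) : ℝ) : ℂ))
      ((-(1 / 4) * Real.exp (-y / 4) : ℝ) : ℂ) y := (he 4).ofReal_comp
  have h2 := HasDerivAt.scomp (h := fun y : ℝ => Real.exp (-y / 2)) y hd (he 2)
  convert! h4.mul h2 using 1
  simp only [Function.comp_apply, Complex.real_smul]
  push_cast
  ring

theorem autoconv_neg {z : ℂ} (hz1 : ‖z‖ = 1) (hz : 0 < z.re) : ∃ ω : ℂ, ‖ω‖ = 1 ∧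
    ∀ y : ℝ, autoconv z (-y) = ω * (starRingEnd ℂ) (autoconv z y) := by
  obtain ⟨ω, hω, h⟩ := exists_thetaExp_neg hz1 hz
  refine ⟨ω ^ 2, by rw [norm_pow, hω, one_pow], fun y => ?_⟩
  unfold autoconv
  rw [← integral_conj, ← integral_const_mul, ← integral_neg_eq_self]
  congr 1
  funext u
  rw [show -y - -u = -(y - u) by ring, h, h, map_mul]
  ring

theorem norm_deriv_autoconv_neg {z : ℂ} (hz1 : ‖z‖ = 1) (hz : 0 < z.re) (y : ℝ) :
    ‖deriv (autoconv z) (-y)‖ = ‖deriv (autoconv z) y‖ := by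
  obtain ⟨ω, hω, h⟩ := autoconv_neg hz1 hz
  have hd := (hasDerivAt_autoconv hz1 hz y).differentiableAt.hasDerivAt
  have hf : (fun y => autoconv z (-y)) = fun y => ω * (starRingEnd ℂ) (autoconv z y) := funext h
  have h1 : deriv (fun y => autoconv z (-y)) y = -deriv (autoconv z) (-y) := deriv_comp_neg _ _
  have h2 : HasDerivAt (fun y => ω * (starRingEnd ℂ) (autoconv z y))
      (ω * (starRingEnd ℂ) (deriv (autoconv z) y)) y := hd.star.const_mul ω
  rw [hf, h2.deriv] at h1
  rw [← norm_neg, ← h1, norm_mul, hω, one_mul, RCLike.norm_conj]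

theorem exists_norm_tsum_kerTerm_le {z : ℂ} (hz1 : ‖z‖ = 1) (hz : 0 < z.re) (hz' : z.im ≠ 0) :
    ∃ K : ℝ, 0 < K ∧ ∀ x : ℝ, 1 ≤ x → ‖∑' n, kerTerm thetaConvCoeff z n x‖ ≤
      K * (x * Real.exp (-(Real.pi / 8 * z.re * x))) := by
  have hpi := Real.pi_pos
  obtain ⟨C, hC, hC'⟩ := exists_kerTermAmp_bound
  have hb0 : thetaConvCoeff 0 = 0 := by simp [thetaConvCoeff]
  have hu := summable_sq_mul_exp_neg (c := Real.pi / 8 * z.re) (by positivity) (4 * C)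
  refine ⟨∑' n : ℕ, 4 * C * ((n : ℝ) ^ 2 * Real.exp (-(Real.pi / 8 * z.re) * n)),
    hu.tsum_pos (fun n => by positivity) 1 (by norm_num; positivity), fun x hx => ?_⟩
  rw [← tsum_mul_right]
  refine tsum_of_norm_bounded (hu.mul_right _).hasSum fun n => ?_
  rcases Nat.eq_zero_or_pos n with rfl | hn
  · simp [kerTerm, hb0]
  have hn1 : (1 : ℝ) ≤ n := by exact_mod_cast hn
  rw [norm_kerTerm _ hz']
  refine (hC' _ z hz1 hz n hn x hx).1.trans ?_
  have h1 : ‖thetaConvCoeff n‖ ≤ 4 * n :=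
    (norm_thetaConvCoeff_le n).trans (by gcongr; exact Nat.card_divisors_le_self n)
  have h0 : 1 ≤ n * x := one_le_mul_of_one_le_of_one_le hn1 hx
  have h2 : √(n * x) ≤ n * x := by
    rw [Real.sqrt_le_left (by linarith)]
    nlinarith
  have h3 : Real.exp (-(Real.pi / 4 * n * z.re * x)) ≤
      Real.exp (-(Real.pi / 8 * z.re) * n) * Real.exp (-(Real.pi / 8 * z.re * x)) := by
    rw [← Real.exp_add]
    apply Real.exp_le_exp.mpr
    have h4 : (n + x) / 2 ≤ n * x := by nlinarith
    have := mul_le_mul_of_nonneg_left h4 (show 0 ≤ Real.pi / 4 * z.re by positivity)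
    linarith
  calc _ ≤ C * (4 * n) * (n * x) * (Real.exp (-(Real.pi / 8 * z.re) * n) *
        Real.exp (-(Real.pi / 8 * z.re * x))) := by gcongr
    _ = _ := by ring

theorem norm_deriv_autoconv {z : ℂ} (hz1 : ‖z‖ = 1) (hz : 0 < z.re) (y : ℝ) :
    ‖deriv (autoconv z) y‖ = 1 / 2 * Real.exp (y / 4) *
      ‖∑' n, kerTerm thetaConvCoeff z n (Real.exp (y / 2))‖ := by
  rw [← norm_deriv_autoconv_neg hz1 hz, (hasDerivAt_autoconv hz1 hz (-y)).deriv, neg_neg, norm_mul,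
    norm_mul, Complex.norm_real, Real.norm_of_nonneg (Real.exp_pos _).le]
  norm_num

theorem exists_norm_deriv_autoconv_le {z : ℂ} (hz1 : ‖z‖ = 1) (hz : 0 < z.re) (hz' : z.im ≠ 0) :
    ∃ M : ℝ, 0 < M ∧ ∀ y : ℝ, ‖deriv (autoconv z) y‖ ≤ M * Real.exp (-(1 / 2 * |y|)) := by
  have hpi := Real.pi_pos
  obtain ⟨K, hK, hK'⟩ := exists_norm_tsum_kerTerm_le hz1 hz hz'
  obtain ⟨M, hM, hM'⟩ := exists_pow_mul_exp_neg_le (c := Real.pi / 8 * z.re) (by positivity) 3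
  have hpos : ∀ y : ℝ, 0 ≤ y → ‖deriv (autoconv z) y‖ ≤ K * M * Real.exp (-(1 / 2 * |y|)) := by
    intro y hy
    rw [norm_deriv_autoconv hz1 hz, abs_of_nonneg hy]
    have h1 := hK' (Real.exp (y / 2)) (Real.one_le_exp (by linarith))
    have h2 := hM' (Real.exp (y / 2)) (Real.exp_pos _)
    have h3 : Real.exp (y / 4) ≤ Real.exp (y / 2) := Real.exp_le_exp.mpr (by linarith)
    have h4 : Real.exp (-(1 / 2 * y)) * Real.exp (y / 2) = 1 := by
      rw [← Real.exp_add, Real.exp_eq_one_iff]; ring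
    set x := Real.exp (y / 2)
    set i := Real.exp (-(1 / 2 * y))
    set E := Real.exp (-(Real.pi / 8 * z.re * x))
    have hx : 0 < x := Real.exp_pos _
    have hE : 0 < E := Real.exp_pos _
    calc _ ≤ 1 * x * (K * (x * E)) := by gcongr; norm_num
      _ = K * (x ^ 3 * E) * i := by linear_combination (-(K * x ^ 2 * E)) * h4
      _ ≤ K * M * i := by gcongr
  refine ⟨K * M, by positivity, fun y => ?_⟩
  rcases le_total 0 y with hy | hy
  · exact hpos y hy
  · have := hpos (-y) (by linarith)
    rwa [norm_deriv_autoconv_neg hz1 hz, abs_neg] at this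

theorem integrable_deriv_autoconv {z : ℂ} (hz1 : ‖z‖ = 1) (hz : 0 < z.re) (hz' : z.im ≠ 0) :
    Integrable (deriv (autoconv z)) ∧ MemLp (deriv (autoconv z)) 2 := by
  obtain ⟨M, hM, h⟩ := exists_norm_deriv_autoconv_le hz1 hz hz'
  have hm : AEStronglyMeasurable (deriv (autoconv z)) :=
    (stronglyMeasurable_deriv _).aestronglyMeasurable
  refine ⟨((integrable_exp_neg_mul_abs (by norm_num)).const_mul M).mono' hm
    (Filter.Eventually.of_forall h), ?_⟩
  rw [memLp_two_iff_integrable_sq_norm hm]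
  refine ((integrable_exp_neg_mul_abs (a := 1) (by norm_num)).const_mul (M ^ 2)).mono'
    (hm.norm.pow 2) (Filter.Eventually.of_forall fun y => ?_)
  rw [Real.norm_of_nonneg (by positivity)]
  refine (pow_le_pow_left₀ (norm_nonneg _) (h y) 2).trans (le_of_eq ?_)
  rw [mul_pow, ← Real.exp_nat_mul]
  congr 2
  push_cast
  ring

theorem integral_norm_sq_deriv_autoconv {z : ℂ} (hz1 : ‖z‖ = 1) (hz : 0 < z.re) :
    ∫ y, ‖deriv (autoconv z) y‖ ^ 2 =
      ∫ x in Set.Ioi 1, ‖∑' n, kerTerm thetaConvCoeff z n x‖ ^ 2 := by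
  have himg : (fun y : ℝ => Real.exp (y / 2)) '' Set.Ioi 0 = Set.Ioi 1 := by
    ext x
    simp only [Set.mem_image, Set.mem_Ioi]
    constructor
    · rintro ⟨y, hy, rfl⟩
      exact Real.one_lt_exp_iff.mpr (by linarith)
    · intro hx
      exact ⟨2 * Real.log x, by have := Real.log_pos hx; linarith, by
        rw [mul_div_cancel_left₀ _ (by norm_num), Real.exp_log (by linarith)]⟩
  rw [← himg, integral_image_eq_integral_abs_deriv_smul measurableSet_Ioi
    (f' := fun y => 1 / 2 * Real.exp (y / 2)) (fun y _ => ?_) (fun a _ b _ hab => ?_)]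
  · have heven : ∀ y : ℝ, ‖deriv (autoconv z) y‖ ^ 2 = ‖deriv (autoconv z) |y|‖ ^ 2 := by
      intro y
      rcases abs_choice y with h | h <;> rw [h]
      rw [norm_deriv_autoconv_neg hz1 hz]
    rw [integral_congr_ae (Filter.Eventually.of_forall heven),
      integral_comp_abs (f := fun y => ‖deriv (autoconv z) y‖ ^ 2), ← integral_const_mul]
    congr 1
    funext y
    rw [norm_deriv_autoconv hz1 hz, abs_of_pos (by positivity), smul_eq_mul, mul_pow,
      mul_pow, ← Real.exp_nat_mul, show ((2 : ℕ) : ℝ) * (y / 4) = y / 2 by push_cast; ring]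
    ring
  · have := ((hasDerivAt_id y).div_const 2).exp
    convert! this.hasDerivWithinAt using 1
    simp only [id]
    ring
  · have := Real.exp_injective hab
    linarith

open scoped FourierTransform in
theorem norm_sq_fourier_deriv_autoconv {z : ℂ} (hz1 : ‖z‖ = 1) (hz : 0 < z.re) (hz' : z.im ≠ 0)
    (ξ : ℝ) : ‖𝓕 (deriv (autoconv z)) ξ‖ ^ 2 =
      (2 * Real.pi * ξ) ^ 2 * ‖𝓕 (thetaExp z) ξ‖ ^ 4 := by
  have hi := integrable_thetaExp hz1 hz
  have hconv : autoconv z =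
      convolution (thetaExp z) (thetaExp z) (ContinuousLinearMap.mul ℂ ℂ) volume := rfl
  have h_int : Integrable (autoconv z) := by
    rw [hconv]; exact hi.integrable_convolution _ hi
  rw [Real.fourier_deriv h_int (fun y => (hasDerivAt_autoconv hz1 hz y).differentiableAt)
    (integrable_deriv_autoconv hz1 hz hz').1, hconv]
  simp only
  rw [Real.fourier_mul_convolution_eq hi hi, norm_smul, norm_mul]
  simp only [norm_mul, Complex.norm_real, Complex.norm_I, Complex.norm_ofNat, Real.norm_eq_abs,
    mul_pow, sq_abs, one_pow]
  ring

open scoped FourierTransform in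
theorem integrable_norm_sq_fourier_deriv_autoconv {z : ℂ} (hz1 : ‖z‖ = 1) (hz : 0 < z.re)
    (hz' : z.im ≠ 0) :
    Integrable (fun t : ℝ => ‖𝓕 (deriv (autoconv z)) (t / (4 * Real.pi))‖ ^ 2) ∧
    ∫ t : ℝ, ‖𝓕 (deriv (autoconv z)) (t / (4 * Real.pi))‖ ^ 2 =
      4 * Real.pi * ∫ x in Set.Ioi 1, ‖∑' n, kerTerm thetaConvCoeff z n x‖ ^ 2 := by
  have hpi := Real.pi_pos
  obtain ⟨h1, h2⟩ := integrable_deriv_autoconv hz1 hz hz'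
  obtain ⟨hm, he⟩ := plancherel h1 h2
  constructor
  · have := (memLp_two_iff_integrable_sq_norm hm.1).mp hm
    exact this.comp_div (by positivity)
  · rw [Measure.integral_comp_div (fun ξ => ‖𝓕 (deriv (autoconv z)) ξ‖ ^ 2), he,
      integral_norm_sq_deriv_autoconv hz1 hz, abs_of_pos (by positivity), smul_eq_mul]

theorem continuousOn_norm_zeta_pow :
    ContinuousOn (fun t : ℝ => ‖riemannZeta (1 / 2 + t * Complex.I)‖ ^ 4) (Set.Ici 1) := by
  intro t ht
  have ht : (1 : ℝ) ≤ t := ht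
  have h : ContinuousAt riemannZeta (1 / 2 + t * Complex.I) := by
    refine (differentiableAt_riemannZeta fun h => ?_).continuousAt
    have := congrArg Complex.im h
    simp at this
    linarith
  have h2 : ContinuousAt (fun t : ℝ => (1 / 2 + t * Complex.I : ℂ)) t := by fun_prop
  exact ((ContinuousAt.comp (g := riemannZeta) (f := fun t : ℝ => (1 / 2 + t * Complex.I : ℂ))
    h h2).norm.pow 4).continuousWithinAt

theorem intervalIntegrable_norm_zeta_pow {a b : ℝ} (ha : 1 ≤ a) (hb : 1 ≤ b) :
    IntervalIntegrable (fun t : ℝ => ‖riemannZeta (1 / 2 + t * Complex.I)‖ ^ 4) volume a b :=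
  (continuousOn_norm_zeta_pow.mono fun _ ht =>
    (le_min ha hb).trans ht.1).intervalIntegrable

open scoped FourierTransform in
theorem exists_integral_dyadic_le : ∃ C : ℝ, 0 < C ∧ ∀ T : ℝ, 2 ≤ T →
    ∫ t in T / 2..T, ‖riemannZeta (1 / 2 + t * Complex.I)‖ ^ 4 ≤ C * (T * Real.log T ^ 4) := by
  have hpi := Real.pi_pos
  obtain ⟨C, hC, hC'⟩ := exists_integral_kerTerm_le
  obtain ⟨c, hc, hc'⟩ := exists_le_norm_fourier_thetaExp
  refine ⟨8 * Real.exp 2 / c * (4 * Real.pi * C), by positivity, fun T hT => ?_⟩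
  have hT0 : 0 < T := by linarith
  have hδ0 : 0 < 1 / T := by positivity
  have hδ1 : 1 / T ≤ 1 / 2 := by gcongr
  have hz1 := norm_ray (1 / T)
  have hz := ray_re_pos hδ0 hδ1
  have him := half_le_ray_im hδ0 hδ1
  have hz' : (ray (1 / T)).im ≠ 0 := by linarith
  obtain ⟨h_int, heq⟩ := integrable_norm_sq_fourier_deriv_autoconv hz1 hz hz'
  have hle := (hC' thetaConvCoeff norm_thetaConvCoeff_le (1 / T) hδ0 hδ1 _ hz1
    (two_mul_div_pi_le_ray_re hδ0 hδ1) him).2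
  have hpt : ∀ t ∈ Set.Ioc (T / 2) T, ‖riemannZeta (1 / 2 + t * Complex.I)‖ ^ 4 ≤
      8 * Real.exp 2 / (c * T) *
        ‖𝓕 (deriv (autoconv (ray (1 / T)))) (t / (4 * Real.pi))‖ ^ 2 := by
    intro t ht
    have ht1 : 1 ≤ t := by linarith [ht.1]
    have h := hc' (1 / T) hδ0 hδ1 t ht1
    rw [norm_sq_fourier_deriv_autoconv hz1 hz hz']
    set Z := ‖riemannZeta (1 / 2 + t * Complex.I)‖ ^ 4
    set F := ‖𝓕 (thetaExp (ray (1 / T))) (t / (4 * Real.pi))‖ ^ 4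
    have hZ : 0 ≤ Z := by positivity
    have hF : 0 ≤ F := by positivity
    have e1 : Real.exp (-2) ≤ Real.exp (-(2 * (1 / T) * t)) := by
      apply Real.exp_le_exp.mpr
      have : t / T ≤ 1 := (div_le_one hT0).mpr ht.2
      have e : 2 * (1 / T) * t = 2 * (t / T) := by ring
      rw [e]
      linarith
    have e2 : Real.exp (-2) * Real.exp 2 = 1 := by rw [← Real.exp_add]; norm_num
    have e3 : (2 * Real.pi * (t / (4 * Real.pi))) ^ 2 = t ^ 2 / 4 := by
      field_simp
      norm_num
    rw [e3]
    have h1 : c * (Real.exp (-2) * Z) ≤ t * F := le_trans (by gcongr) h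
    have h2 : c * Z ≤ Real.exp 2 * (t * F) := by
      calc c * Z = Real.exp 2 * (c * (Real.exp (-2) * Z)) := by linear_combination (-(c * Z)) * e2
        _ ≤ _ := by gcongr
    have h3 : T * (c * Z) ≤ 2 * t * (Real.exp 2 * (t * F)) := by
      gcongr
      linarith [ht.1]
    rw [div_mul_eq_mul_div, le_div_iff₀ (by positivity)]
    linarith
  have hI := intervalIntegrable_norm_zeta_pow (a := T / 2) (b := T) (by linarith) (by linarith)
  rw [intervalIntegrable_iff_integrableOn_Ioc_of_le (by linarith)] at hI
  rw [intervalIntegral.integral_of_le (by linarith)]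
  calc _ ≤ ∫ t in Set.Ioc (T / 2) T, 8 * Real.exp 2 / (c * T) *
        ‖𝓕 (deriv (autoconv (ray (1 / T)))) (t / (4 * Real.pi))‖ ^ 2 :=
        setIntegral_mono_on hI (h_int.const_mul _).integrableOn measurableSet_Ioc hpt
    _ ≤ ∫ t, 8 * Real.exp 2 / (c * T) *
        ‖𝓕 (deriv (autoconv (ray (1 / T)))) (t / (4 * Real.pi))‖ ^ 2 :=
        setIntegral_le_integral (h_int.const_mul _)
          (Filter.Eventually.of_forall fun t => by simp only [Pi.zero_apply]; positivity)
    _ ≤ 8 * Real.exp 2 / (c * T) * (4 * Real.pi *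
        (C * ((1 / T) ^ 2)⁻¹ * Real.log (1 / (1 / T)) ^ 4)) := by
        rw [integral_const_mul, heq]
        gcongr
    _ = _ := by
        rw [one_div_one_div]
        field_simp

theorem integral_le_of_dyadic {f : ℝ → ℝ} (hf : ∀ t, 0 ≤ f t)
    (hi : ∀ a b : ℝ, 1 ≤ a → 1 ≤ b → IntervalIntegrable f volume a b) {C : ℝ} (hC : 0 < C)
    (h : ∀ T : ℝ, 2 ≤ T → ∫ t in T / 2..T, f t ≤ C * (T * Real.log T ^ 4)) (n : ℕ) :
    ∀ T : ℝ, 1 ≤ T → T ≤ 2 ^ (n + 1) →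
      ∫ t in (1 : ℝ)..T, f t ≤ 2 * C * (T * Real.log T ^ 4) + ∫ t in (1 : ℝ)..2, f t := by
  have hbase : ∀ T : ℝ, 1 ≤ T → T ≤ 2 →
      ∫ t in (1 : ℝ)..T, f t ≤ 2 * C * (T * Real.log T ^ 4) + ∫ t in (1 : ℝ)..2, f t := by
    intro T h1 h2
    have h3 : ∫ t in (1 : ℝ)..T, f t ≤ ∫ t in (1 : ℝ)..2, f t :=
      intervalIntegral.integral_mono_interval le_rfl h1 h2 (Filter.Eventually.of_forall hf)
        (hi 1 2 le_rfl (by norm_num))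
    have : 0 ≤ 2 * C * (T * Real.log T ^ 4) := by positivity
    linarith
  induction n with
  | zero => intro T h1 h2; exact hbase T h1 (by simpa using h2)
  | succ n ih =>
    intro T h1 h2
    rcases le_total T 2 with hT | hT
    · exact hbase T h1 hT
    have h3 := ih (T / 2) (by linarith) (by rw [pow_succ] at h2; linarith)
    have h4 := h T hT
    have hlog : Real.log (T / 2) ^ 4 ≤ Real.log T ^ 4 :=
      pow_le_pow_left₀ (Real.log_nonneg (by linarith))
        (Real.log_le_log (by linarith) (by linarith)) 4
    rw [← intervalIntegral.integral_add_adjacent_intervals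
      (hi 1 (T / 2) le_rfl (by linarith)) (hi (T / 2) T (by linarith) h1)]
    have : 2 * C * (T / 2 * Real.log (T / 2) ^ 4) ≤ C * (T * Real.log T ^ 4) := by
      calc _ = C * (T * Real.log (T / 2) ^ 4) := by ring
        _ ≤ _ := by gcongr
    linarith

end HardyLittlewood

/-- Hardy–Littlewood fourth moment bound: for `T ≥ 2`,
`∫₁ᵀ |ζ(1/2+it)|⁴ dt = O(T (log T)⁴)`. -/
theorem hardy_littlewood_fourth_moment_bound :
    ∃ C : ℝ, 0 < C ∧ ∀ T : ℝ, 2 ≤ T →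
      (∫ t in (1:ℝ)..T, ‖riemannZeta (1/2 + t * Complex.I)‖ ^ 4) ≤
        C * T * (Real.log T) ^ 4 := by
  obtain ⟨C, hC, h⟩ := HardyLittlewood.exists_integral_dyadic_le
  have hl : 0 < Real.log 2 := Real.log_pos (by norm_num)
  have hI : 0 ≤ ∫ t in (1:ℝ)..2, ‖riemannZeta (1 / 2 + t * Complex.I)‖ ^ 4 :=
    intervalIntegral.integral_nonneg (by norm_num) fun t _ => by positivity
  refine ⟨2 * C + (∫ t in (1:ℝ)..2, ‖riemannZeta (1 / 2 + t * Complex.I)‖ ^ 4) / Real.log 2 ^ 4,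
    by positivity, fun T hT => ?_⟩
  obtain ⟨n, hn⟩ := pow_unbounded_of_one_lt T (one_lt_two (α := ℝ))
  have hn' : T ≤ 2 ^ (n + 1) := hn.le.trans (pow_le_pow_right₀ (by norm_num) (Nat.le_succ n))
  refine (HardyLittlewood.integral_le_of_dyadic (fun t => by positivity)
    (fun a b => HardyLittlewood.intervalIntegrable_norm_zeta_pow) hC h n T (by linarith) hn').trans ?_
  set I := ∫ t in (1:ℝ)..2, ‖riemannZeta (1 / 2 + t * Complex.I)‖ ^ 4
  have h1 : Real.log 2 ^ 4 ≤ T * Real.log T ^ 4 := by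
    have : Real.log 2 ^ 4 ≤ Real.log T ^ 4 :=
      pow_le_pow_left₀ hl.le (Real.log_le_log (by norm_num) hT) 4
    nlinarith [pow_pos hl 4]
  have h2 : I ≤ I / Real.log 2 ^ 4 * (T * Real.log T ^ 4) := by
    rw [div_mul_eq_mul_div, le_div_iff₀ (by positivity)]
    gcongr
  linarith
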